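/- arXiv:2505.11105 — 3 statements merged into one kernel-verified Lean document; each statement's English description precedes it below -/
import Mathlib

section
/- For every integer t > 1 there exists a constant C such that for every n, every n-vertex F_t^3-free 3-graph has at most t·C(n,2) + Cn hyperedges. -/
/-- `H` contains a copy of `F_t^3`, the 3-expansion of the `t`-fan. -/
def ContainsFanExp {V : Type*} [DecidableEq V] (t : ℕ) (H : Finset (Finset V)) : Prop :=
  ∃ f : Unit ⊕ Fin 5 × Fin t → V, Function.Injective f ∧
    ∀ i : Fin t,
      ({f (Sum.inl ()), f (Sum.inr (0, i)), f (Sum.inr (2, i))} : Finset V) ∈ H ∧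
      ({f (Sum.inl ()), f (Sum.inr (1, i)), f (Sum.inr (3, i))} : Finset V) ∈ H ∧
      ({f (Sum.inr (0, i)), f (Sum.inr (1, i)), f (Sum.inr (4, i))} : Finset V) ∈ H

section

open Finset

/-- Every nonempty set of `k` pairs inside `e` has a member lying in more than `k * t` edges. -/
def IsRich {V : Type*} [DecidableEq V] (t : ℕ) (H : Finset (Finset V)) (e : Finset V) : Prop :=
  ∀ P ⊆ powersetCard 2 e, P.Nonempty → ∃ p ∈ P, #P * t < #{f ∈ H | p ⊆ f}

/-- A large set on which every vertex has few out-neighbours contains an independent set. -/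
lemma exists_independent_subset {ι : Type*} [DecidableEq ι] (r : ι → ι → Prop)
    [∀ i j, Decidable (r i j)] (D k : ℕ) (I : Finset ι)
    (hD : ∀ i ∈ I, #{j ∈ I | r i j} ≤ D) (hI : (2 * D + 1) * k ≤ #I) :
    ∃ J ⊆ I, #J = k ∧ ∀ i ∈ J, ∀ j ∈ J, i ≠ j → ¬ r i j := by
  induction k generalizing I with
  | zero => exact ⟨∅, by simp, by simp, by simp⟩
  | succ k ih =>
    have hne : I.Nonempty := by
      rw [← card_pos]
      nlinarith
    obtain ⟨i₀, hi₀, hin⟩ : ∃ j ∈ I, #{i ∈ I | r i j} ≤ D := by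
      refine exists_le_of_sum_le hne ?_
      calc ∑ j ∈ I, #{i ∈ I | r i j} = ∑ i ∈ I, #{j ∈ I | r i j} :=
            (sum_card_bipartiteAbove_eq_sum_card_bipartiteBelow r).symm
        _ ≤ ∑ _i ∈ I, D := sum_le_sum hD
    have hout := hD i₀ hi₀
    set R : Finset ι := {i₀} ∪ ({j ∈ I | r i₀ j} ∪ {i ∈ I | r i i₀}) with hR
    have hRcard : #R ≤ 2 * D + 1 := by
      have h1 := card_union_le ({i₀} : Finset ι) ({j ∈ I | r i₀ j} ∪ {i ∈ I | r i i₀})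
      have h2 := card_union_le {j ∈ I | r i₀ j} {i ∈ I | r i i₀}
      rw [card_singleton, ← hR] at h1
      omega
    obtain ⟨J, hJI, hJ, hind⟩ := ih (I \ R)
      (fun i hi ↦ (card_le_card (filter_subset_filter _ sdiff_subset)).trans
        (hD i (mem_sdiff.1 hi).1))
      (by
        have := le_card_sdiff R I
        rw [mul_add, mul_one] at hI
        omega)
    have hJR : ∀ j ∈ J, j ≠ i₀ ∧ ¬ r i₀ j ∧ ¬ r j i₀ := by
      intro j hj
      have := mem_sdiff.1 (hJI hj)
      simp only [hR, mem_union, mem_singleton, mem_filter, not_or, not_and] at this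
      exact ⟨this.2.1, this.2.2.1 this.1, this.2.2.2 this.1⟩
    refine ⟨insert i₀ J, ?_, ?_, ?_⟩
    · exact insert_subset hi₀ (hJI.trans sdiff_subset)
    · rw [card_insert_of_notMem (fun h ↦ (hJR _ h).1 rfl), hJ]
    · intro i hi j hj hij
      rcases mem_insert.1 hi with hi | hi <;> rcases mem_insert.1 hj with hj | hj
      · exact absurd (hi.trans hj.symm) hij
      · exact hi ▸ (hJR j hj).2.1
      · exact hj ▸ (hJR i hi).2.2
      · exact hind i hi j hj hij

variable {V : Type*} [DecidableEq V]

/-- A rich triple provides, for each of its three pairs, a bounded set of third vertices, with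
sizes suited to the Hall condition. -/
lemma IsRich.exists_candidates [Fintype V] {t : ℕ} {H : Finset (Finset V)}
    (hH : ∀ e ∈ H, #e = 3) {v a b : V} (hva : v ≠ a) (hvb : v ≠ b) (hab : a ≠ b)
    (h : IsRich t H {v, a, b}) :
    ∃ A : Fin 3 → Finset V, (∀ x ∈ A 0, ({v, a, x} : Finset V) ∈ H) ∧
      (∀ x ∈ A 1, ({v, b, x} : Finset V) ∈ H) ∧ (∀ x ∈ A 2, ({a, b, x} : Finset V) ∈ H) ∧
      (∀ j, #(A j) ≤ 3 * t) ∧ (∀ j, ∀ x ∈ A j, x ≠ v ∧ x ≠ a ∧ x ≠ b) ∧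
      ∀ S : Finset (Fin 3), S.Nonempty → ∃ j ∈ S, #S * t ≤ #(A j) := by
  let q : Fin 3 → Finset V := ![{v, a}, {v, b}, {a, b}]
  have hq2 : ∀ j, #(q j) = 2 := by
    intro j
    fin_cases j <;> simp [q, *]
  have hqe : ∀ j, q j ⊆ {v, a, b} := by
    intro j
    fin_cases j <;> simp [q, insert_subset_iff]
  have hqinj : Function.Injective q := by
    have key : ∀ x y z : V, x ≠ z → y ≠ z → ∀ w, ({x, y} : Finset V) ≠ {w, z} := by
      intro x y z hx hy w hc
      have : z ∈ ({x, y} : Finset V) := hc ▸ (by simp)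
      simp only [mem_insert, mem_singleton] at this
      rcases this with h | h
      · exact hx h.symm
      · exact hy h.symm
    have h01 : q 0 ≠ q 1 := key v a b hvb hab v
    have h02 : q 0 ≠ q 2 := key v a b hvb hab a
    have h12 : q 1 ≠ q 2 := by
      simp only [q]
      rw [pair_comm a b]
      exact key v b a hva hab.symm b
    intro i j hij
    fin_cases i <;> fin_cases j <;> simp_all [eq_comm]
  let N : Fin 3 → Finset V := fun j ↦ {x | x ∉ ({v, a, b} : Finset V) ∧ insert x (q j) ∈ H}
  have hN : ∀ j, #{f ∈ H | q j ⊆ f} ≤ #(N j) + 1 := by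
    intro j
    have hsub : ({f ∈ H | q j ⊆ f} : Finset (Finset V)) ⊆
        insert {v, a, b} ((N j).image fun x ↦ insert x (q j)) := by
      intro f hf
      obtain ⟨hfH, hqf⟩ := mem_filter.1 hf
      obtain ⟨x, hx⟩ : ∃ x, f \ q j = {x} := by
        rw [← card_eq_one, card_sdiff_of_subset hqf, hH f hfH, hq2]
      have hfx : insert x (q j) = f := by
        rw [insert_eq, ← hx, sdiff_union_of_subset hqf]
      by_cases hxe : x ∈ ({v, a, b} : Finset V)
      · refine mem_insert.2 (Or.inl (eq_of_subset_of_card_le ?_ ?_))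
        · rw [← hfx]
          exact insert_subset hxe (hqe j)
        · rw [hH f hfH]
          exact card_le_three
      · refine mem_insert_of_mem (mem_image.2 ⟨x, ?_, hfx⟩)
        simp only [N, mem_filter, mem_univ, true_and]
        exact ⟨hxe, hfx ▸ hfH⟩
    calc _ ≤ _ := card_le_card hsub
      _ ≤ _ := card_insert_le _ _
      _ ≤ _ := Nat.add_le_add_right card_image_le 1
  have hA : ∀ j, ∃ A ⊆ N j, #A = min (#(N j)) (3 * t) := fun j ↦
    exists_subset_card_eq (min_le_left _ _)
  choose A hAN hAc using hA
  have hmem : ∀ j, ∀ x ∈ A j, x ∉ ({v, a, b} : Finset V) ∧ insert x (q j) ∈ H := by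
    intro j x hx
    simpa [N] using hAN j hx
  have hrot : ∀ x y z : V, insert x ({y, z} : Finset V) = {y, z, x} := by
    intro x y z
    ext
    simp only [mem_insert, mem_singleton]
    tauto
  refine ⟨A, fun x hx ↦ ?_, fun x hx ↦ ?_, fun x hx ↦ ?_, fun j ↦ ?_, fun j x hx ↦ ?_,
    fun S hS ↦ ?_⟩
  · exact hrot x v a ▸ (hmem 0 x hx).2
  · exact hrot x v b ▸ (hmem 1 x hx).2
  · exact hrot x a b ▸ (hmem 2 x hx).2
  · exact hAc j ▸ min_le_right _ _
  · simpa using (hmem j x hx).1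
  · obtain ⟨p, hp, hlt⟩ := h (S.image q)
      (fun p hp ↦ by
        obtain ⟨j, -, rfl⟩ := mem_image.1 hp
        exact mem_powersetCard.2 ⟨hqe j, hq2 j⟩)
      (hS.image q)
    obtain ⟨j, hj, rfl⟩ := mem_image.1 hp
    rw [card_image_of_injective S hqinj] at hlt
    refine ⟨j, hj, ?_⟩
    rw [hAc j]
    refine le_min ?_ (Nat.mul_le_mul_right t (card_finset_fin_le S))
    have := hN j
    omega

/-- A large matching of rich triples through a common vertex yields an expanded fan. -/
lemma containsFanExp_of_matching [Fintype V] {t : ℕ} {H : Finset (Finset V)}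
    (hH : ∀ e ∈ H, #e = 3) (v : V) (M : Finset (Finset V))
    (hM : ∀ p ∈ M, #p = 2 ∧ v ∉ p ∧ IsRich t H (insert v p))
    (hdisj : (M : Set (Finset V)).PairwiseDisjoint id)
    (hcard : (2 * (9 * t) + 1) * t ≤ #M) : ContainsFanExp t H := by
  have hex : ∀ p : M, ∃ a b : V, ∃ A : Fin 3 → Finset V, p.1 = {a, b} ∧ a ≠ b ∧ v ≠ a ∧ v ≠ b ∧
      (∀ x ∈ A 0, ({v, a, x} : Finset V) ∈ H) ∧
      (∀ x ∈ A 1, ({v, b, x} : Finset V) ∈ H) ∧ (∀ x ∈ A 2, ({a, b, x} : Finset V) ∈ H) ∧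
      (∀ j, #(A j) ≤ 3 * t) ∧ (∀ j, ∀ x ∈ A j, x ≠ v ∧ x ≠ a ∧ x ≠ b) ∧
      ∀ S : Finset (Fin 3), S.Nonempty → ∃ j ∈ S, #S * t ≤ #(A j) := by
    rintro ⟨p, hp⟩
    obtain ⟨h2, hv, hr⟩ := hM p hp
    obtain ⟨a, b, hab, rfl⟩ := card_eq_two.1 h2
    simp only [mem_insert, mem_singleton, not_or] at hv
    obtain ⟨A, hA⟩ := hr.exists_candidates hH hv.1 hv.2 hab
    exact ⟨a, b, A, rfl, hab, hv.1, hv.2, hA⟩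
  choose a b A hpab hab hva hvb hA0 hA1 hA2 hAc hAne hAS using hex
  have hpd : ∀ p q : M, p ≠ q → Disjoint p.1 q.1 := fun p q hpq ↦
    hdisj p.2 q.2 (fun h ↦ hpq (Subtype.ext h))
  let r : M → M → Prop := fun p q ↦ ∃ x ∈ univ.biUnion (A p), x ∈ q.1
  classical
  have hr : ∀ p ∈ (univ : Finset M), #{q ∈ (univ : Finset M) | r p q} ≤ 9 * t := by
    intro p _
    have h1 : #(univ.biUnion (A p)) ≤ 9 * t := by
      refine card_biUnion_le.trans ((sum_le_sum fun j _ ↦ hAc p j).trans ?_)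
      simp only [sum_const, card_univ, Fintype.card_fin, smul_eq_mul]
      omega
    refine le_trans ?_ h1
    refine card_le_card_of_forall_subsingleton (fun (q : M) (x : V) ↦ x ∈ q.1) ?_ ?_
    · intro q hq
      exact (mem_filter.1 hq).2
    · rintro x - q ⟨-, hq⟩ q' ⟨-, hq'⟩
      by_contra hne
      exact disjoint_left.1 (hpd q q' hne) hq hq'
  obtain ⟨J, -, hJt, hJ⟩ := exists_independent_subset r (9 * t) t univ hr (by simpa using hcard)
  let g : Fin t ≃ J := (J.equivFinOfCardEq hJt).symm
  let m : Fin t → M := fun i ↦ (g i).1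
  have hm : Function.Injective m := Subtype.val_injective.comp g.injective
  have hmr : ∀ i j, i ≠ j → ∀ k, ∀ x ∈ A (m i) k, x ∉ (m j).1 := by
    intro i j hij k x hx hxj
    exact hJ _ (g i).2 _ (g j).2 (fun h ↦ hij (hm h))
      ⟨x, mem_biUnion.2 ⟨k, mem_univ _, hx⟩, hxj⟩
  obtain ⟨c, hcinj, hc⟩ := (all_card_le_biUnion_card_iff_exists_injective
    (fun s : Fin t × Fin 3 ↦ A (m s.1) s.2)).1 (by
      intro S
      rcases S.eq_empty_or_nonempty with rfl | ⟨s₀, hs₀⟩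
      · simp
      let F : Fin t → Finset (Fin 3) := fun i ↦ {j | (i, j) ∈ S}
      obtain ⟨i, -, hi⟩ := exists_max_image univ (fun i ↦ #(F i)) ⟨s₀.1, mem_univ _⟩
      have hne : (F i).Nonempty := by
        rw [← card_pos]
        refine lt_of_lt_of_le ?_ (hi s₀.1 (mem_univ _))
        exact card_pos.2 ⟨s₀.2, by simpa [F] using hs₀⟩
      obtain ⟨j, hj, hle⟩ := hAS (m i) (F i) hne
      have hS : #S ≤ #(F i) * t := by
        have hsub : S ⊆ (univ.sigma F).image fun s ↦ (s.1, s.2) := by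
          rintro ⟨x, y⟩ hs
          exact mem_image.2 ⟨⟨x, y⟩, by simpa [F] using hs, rfl⟩
        calc #S ≤ _ := card_le_card hsub
          _ ≤ #(univ.sigma F) := card_image_le
          _ = ∑ x, #(F x) := card_sigma _ _
          _ ≤ ∑ _x : Fin t, #(F i) := sum_le_sum hi
          _ = #(F i) * t := by simp [mul_comm]
      refine hS.trans (hle.trans (card_le_card ?_))
      exact subset_biUnion_of_mem (fun s : Fin t × Fin 3 ↦ A (m s.1) s.2)
        (show (i, j) ∈ S by simpa [F] using hj))
  have hamem : ∀ i, a (m i) ∈ (m i).1 := fun i ↦ by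
    rw [hpab (m i)]
    simp
  have hbmem : ∀ i, b (m i) ∈ (m i).1 := fun i ↦ by
    rw [hpab (m i)]
    simp
  have hsame : ∀ i j x, x ∈ (m i).1 → x ∈ (m j).1 → i = j := by
    intro i j x hi hj
    by_contra hne
    exact disjoint_left.1 (hpd _ _ (hm.ne hne)) hi hj
  have hcv : ∀ s, c s ≠ v := fun s ↦ (hAne _ _ _ (hc s)).1
  have hcp : ∀ s i, c s ∉ (m i).1 := by
    intro s i hmem
    by_cases hsi : s.1 = i
    · subst hsi
      rw [hpab (m s.1)] at hmem
      simp only [mem_insert, mem_singleton] at hmem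
      have := hAne _ _ _ (hc s)
      tauto
    · exact hmr s.1 i hsi s.2 _ (hc s) hmem
  have hca : ∀ s i, c s ≠ a (m i) := fun s i h ↦ hcp s i (h ▸ hamem i)
  have hcb : ∀ s i, c s ≠ b (m i) := fun s i h ↦ hcp s i (h ▸ hbmem i)
  have haa : ∀ i j, a (m i) = a (m j) → i = j := fun i j h ↦ hsame i j _ (hamem i) (h ▸ hamem j)
  have hbb : ∀ i j, b (m i) = b (m j) → i = j := fun i j h ↦ hsame i j _ (hbmem i) (h ▸ hbmem j)
  have hab' : ∀ i j, a (m i) ≠ b (m j) := by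
    intro i j h
    obtain rfl := hsame i j _ (hamem i) (h ▸ hbmem j)
    exact hab _ h
  let f : Unit ⊕ Fin 5 × Fin t → V := Sum.elim (fun _ ↦ v) fun s ↦
    ![a (m s.2), b (m s.2), c (s.2, 0), c (s.2, 1), c (s.2, 2)] s.1
  refine ⟨f, ?_, fun i ↦ ⟨?_, ?_, ?_⟩⟩
  · have hfv : ∀ s, f (Sum.inr s) ≠ v := by
      rintro ⟨k, i⟩
      fin_cases k
      · exact (hva _).symm
      · exact (hvb _).symm
      · exact hcv _
      · exact hcv _
      · exact hcv _
    have hcc : ∀ i j k l, c (i, k) = c (j, l) → i = j ∧ k = l := fun i j k l h ↦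
      Prod.mk.inj (hcinj h)
    rintro (x | ⟨k, i⟩) (y | ⟨l, j⟩) h
    · rfl
    · exact absurd h.symm (hfv _)
    · exact absurd h (hfv _)
    · fin_cases k <;> fin_cases l <;>
        first
        | exact congrArg _ (congrArg _ (haa i j h))
        | exact congrArg _ (congrArg _ (hbb i j h))
        | exact congrArg _ (congrArg _ (hcc i j _ _ h).1)
        | exact absurd h (hab' i j)
        | exact absurd h.symm (hab' j i)
        | exact absurd h (hca _ _)
        | exact absurd h (hcb _ _)
        | exact absurd h.symm (hca _ _)
        | exact absurd h.symm (hcb _ _)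
        | exact absurd (hcc i j _ _ h).2 (by decide)
  · exact hA0 _ _ (hc (i, 0))
  · exact hA1 _ _ (hc (i, 1))
  · exact hA2 _ _ (hc (i, 2))

/-- In a 3-graph without an expanded fan, the rich triples through `v` have a bounded cover
avoiding `v`. -/
lemma exists_cover_of_not_containsFanExp [Fintype V] {t : ℕ} {H : Finset (Finset V)}
    (hH : ∀ e ∈ H, #e = 3) (hF : ¬ ContainsFanExp t H) (v : V) :
    ∃ S : Finset V, #S ≤ 2 * ((2 * (9 * t) + 1) * t) ∧
      ∀ e ∈ H, IsRich t H e → v ∈ e → ∃ u ∈ e, u ≠ v ∧ u ∈ S := by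
  classical
  let L : Finset (Finset V) := {p | #p = 2 ∧ v ∉ p ∧ IsRich t H (insert v p)}
  obtain ⟨M, hM, hmax⟩ := exists_max_image
    {M : Finset (Finset V) | M ⊆ L ∧ (M : Set (Finset V)).PairwiseDisjoint id} card
    ⟨∅, by simp⟩
  simp only [mem_filter, mem_univ, true_and] at hM hmax
  have hML : ∀ p ∈ M, #p = 2 ∧ v ∉ p ∧ IsRich t H (insert v p) := by
    intro p hp
    simpa [L] using hM.1 hp
  have hlt : #M < (2 * (9 * t) + 1) * t := by
    by_contra! hge
    exact hF (containsFanExp_of_matching hH v M hML hM.2 hge)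
  refine ⟨M.biUnion id, ?_, fun e he hr hve ↦ ?_⟩
  · calc #(M.biUnion id) ≤ ∑ p ∈ M, #p := card_biUnion_le
      _ = ∑ p ∈ M, 2 := sum_congr rfl fun p hp ↦ (hML p hp).1
      _ = 2 * #M := by simp [mul_comm]
      _ ≤ _ := Nat.mul_le_mul_left 2 hlt.le
  · by_contra! hcon
    have hd : ∀ p ∈ M, Disjoint (e.erase v) p := by
      intro p hp
      refine disjoint_left.2 fun u hu hup ↦ ?_
      obtain ⟨huv, hue⟩ := mem_erase.1 hu
      exact hcon u hue huv (mem_biUnion.2 ⟨p, hp, hup⟩)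
    have he2 : #(e.erase v) = 2 := by rw [card_erase_of_mem hve, hH e he]
    have hnot : e.erase v ∉ M := by
      intro hmem
      have := hd _ hmem
      rw [disjoint_self_iff_empty] at this
      simp [this] at he2
    have := hmax (insert (e.erase v) M) ⟨insert_subset (by simp [L, he2, insert_erase hve, hr]) hM.1,
      by
        rw [coe_insert]
        exact hM.2.insert fun p hp _ ↦ hd p hp⟩
    rw [card_insert_of_notMem hnot] at this
    omega

/-- If each vertex of each triple of `B` points to another vertex of that triple in a small
out-neighbourhood, then `B` is small. -/
lemma card_le_of_cover [Fintype V] {B : Finset (Finset V)} (hB : ∀ e ∈ B, #e = 3)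
    (S : V → Finset V) (k : ℕ) (hS : ∀ v, #(S v) ≤ k)
    (h : ∀ e ∈ B, ∀ v ∈ e, ∃ u ∈ e, u ≠ v ∧ u ∈ S v) : #B ≤ k ^ 2 * Fintype.card V := by
  have hsub : B ⊆ (univ : Finset V).biUnion fun v ↦ (S v).biUnion fun u ↦
      (S u).image fun w ↦ {v, u, w} := by
    intro e he
    suffices hp : ∃ v ∈ e, ∃ u ∈ e, ∃ w ∈ e, v ≠ u ∧ v ≠ w ∧ u ≠ w ∧ u ∈ S v ∧ w ∈ S u by
      obtain ⟨v, hv, u, hu, w, hw, hvu, hvw, huw, hus, hws⟩ := hp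
      simp only [mem_biUnion, mem_univ, true_and, mem_image]
      refine ⟨v, u, hus, w, hws, eq_of_subset_of_card_le ?_ ?_⟩
      · simp [insert_subset_iff, hv, hu, hw]
      · rw [hB e he, card_eq_three.2 ⟨v, u, w, hvu, hvw, huw, rfl⟩]
    obtain ⟨x, y, z, hxy, hxz, hyz, rfl⟩ := card_eq_three.1 (hB e he)
    have hx := h _ he x (by simp)
    have hy := h _ he y (by simp)
    have hz := h _ he z (by simp)
    simp only [mem_insert, mem_singleton, exists_eq_or_imp, exists_eq_left] at hx hy hz ⊢
    grind
  calc #B ≤ _ := card_le_card hsub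
    _ ≤ ∑ v : V, ∑ u ∈ S v, #(S u) :=
      card_biUnion_le.trans (sum_le_sum fun v _ ↦ card_biUnion_le.trans
        (sum_le_sum fun u _ ↦ card_image_le))
    _ ≤ ∑ v : V, k ^ 2 := by
      refine sum_le_sum fun v _ ↦ ?_
      calc ∑ u ∈ S v, #(S u) ≤ #(S v) * k := sum_le_card_nsmul _ _ _ fun u _ ↦ hS u
        _ ≤ k ^ 2 := by
          rw [sq]
          exact Nat.mul_le_mul_right k (hS v)
    _ = k ^ 2 * Fintype.card V := by simp [mul_comm]

/-- A double count of the incidences between pairs and edges, weighted by inverse codegrees. -/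
lemma card_not_isRich_le [Fintype V] (t : ℕ) (H G : Finset (Finset V)) (hGH : G ⊆ H)
    (hG : ∀ e ∈ G, ¬ IsRich t H e) : #G ≤ t * (Fintype.card V).choose 2 := by
  let d : Finset V → ℕ := fun p ↦ #{f ∈ H | p ⊆ f}
  have hpos : ∀ e ∈ G, ∀ p ⊆ e, 0 < d p := fun e he p hp ↦
    card_pos.2 ⟨e, mem_filter.2 ⟨hGH he, hp⟩⟩
  have hlow : ∀ e ∈ G, (1 : ℚ) ≤ t * ∑ p ∈ powersetCard 2 e, (1 : ℚ) / d p := by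
    intro e he
    have hr := hG e he
    simp only [IsRich, not_forall, not_exists, not_and, not_lt] at hr
    obtain ⟨P, hP, hne, hle⟩ := hr
    have hPpos : (0 : ℚ) < #P := by exact_mod_cast hne.card_pos
    have hdpos : ∀ p ∈ P, (0 : ℚ) < d p := fun p hp ↦ by
      exact_mod_cast hpos e he p (mem_powersetCard.1 (hP hp)).1
    calc (1 : ℚ) = ∑ p ∈ P, 1 / (#P : ℚ) := by
          rw [sum_const, nsmul_eq_mul]
          field_simp
      _ ≤ ∑ p ∈ P, t * ((1 : ℚ) / d p) := by
          refine sum_le_sum fun p hp ↦ ?_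
          rw [mul_one_div, div_le_div_iff₀ hPpos (hdpos p hp), one_mul, mul_comm]
          exact_mod_cast hle p hp
      _ = t * ∑ p ∈ P, (1 : ℚ) / d p := by rw [mul_sum]
      _ ≤ _ := by
          refine mul_le_mul_of_nonneg_left ?_ (Nat.cast_nonneg t)
          exact sum_le_sum_of_subset_of_nonneg hP fun _ _ _ ↦ by positivity
  have hup : ∑ e ∈ G, ∑ p ∈ powersetCard 2 e, (1 : ℚ) / d p ≤ (Fintype.card V).choose 2 := by
    calc ∑ e ∈ G, ∑ p ∈ powersetCard 2 e, (1 : ℚ) / d p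
        = ∑ p ∈ powersetCard 2 univ, ∑ e ∈ G with p ⊆ e, (1 : ℚ) / d p := by
          refine sum_comm' fun e p ↦ ?_
          simp only [mem_powersetCard, mem_filter, subset_univ, true_and]
          tauto
      _ ≤ ∑ p ∈ powersetCard 2 (univ : Finset V), (1 : ℚ) := by
          refine sum_le_sum fun p _ ↦ ?_
          rw [sum_const, nsmul_eq_mul, mul_one_div]
          refine div_le_one_of_le₀ ?_ (Nat.cast_nonneg _)
          exact_mod_cast card_le_card (filter_subset_filter _ hGH)
      _ = (Fintype.card V).choose 2 := by simp [card_powersetCard]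
  have : (#G : ℚ) ≤ t * (Fintype.card V).choose 2 := by
    calc (#G : ℚ) = ∑ e ∈ G, (1 : ℚ) := by simp
      _ ≤ ∑ e ∈ G, t * ∑ p ∈ powersetCard 2 e, (1 : ℚ) / d p := sum_le_sum hlow
      _ = t * ∑ e ∈ G, ∑ p ∈ powersetCard 2 e, (1 : ℚ) / d p := by rw [mul_sum]
      _ ≤ _ := mul_le_mul_of_nonneg_left hup (Nat.cast_nonneg t)
  exact_mod_cast this

end

theorem fan_expansion_free_upper_bound (t : ℕ) (ht : 1 < t) :
    ∃ C : ℕ, ∀ n : ℕ, ∀ H : Finset (Finset (Fin n)),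
      (∀ e ∈ H, e.card = 3) → ¬ ContainsFanExp t H →
      H.card ≤ t * n.choose 2 + C * n := by
  classical
  refine ⟨(2 * ((2 * (9 * t) + 1) * t)) ^ 2, fun n H hH hF ↦ ?_⟩
  choose S hS hcov using exists_cover_of_not_containsFanExp hH hF
  have hgood := card_not_isRich_le t H {e ∈ H | ¬ IsRich t H e} (Finset.filter_subset _ _)
    fun e he ↦ (Finset.mem_filter.1 he).2
  have hbad := card_le_of_cover (B := {e ∈ H | IsRich t H e})
    (fun e he ↦ hH e (Finset.mem_filter.1 he).1) S _ hS
    (fun e he v hv ↦ hcov v e (Finset.mem_filter.1 he).1 (Finset.mem_filter.1 he).2 hv)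
  rw [Fintype.card_fin] at hgood hbad
  have : Finset.card {e ∈ H | IsRich t H e} + Finset.card {e ∈ H | ¬ IsRich t H e} = H.card :=
    Finset.card_filter_add_card_filter_not _
  omega
end

section
/- For every integer t > 1 there exists a constant C such that for all n, |ex_3(n, F_t^3(t)) − t·C(n,2)| ≤ Cn. -/
/-- `H` contains a copy of `F_t^3(i)`, the 3-expansion of the `t`-fan together with
`i` of the `t` triangles of the core fan added as hyperedges. -/
def ContainsFanExpTri {V : Type*} [DecidableEq V] (t i : ℕ) (H : Finset (Finset V)) : Prop :=
  ∃ f : Unit ⊕ Fin 5 × Fin t → V, Function.Injective f ∧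
    (∀ j : Fin t,
      ({f (Sum.inl ()), f (Sum.inr (0, j)), f (Sum.inr (2, j))} : Finset V) ∈ H ∧
      ({f (Sum.inl ()), f (Sum.inr (1, j)), f (Sum.inr (3, j))} : Finset V) ∈ H ∧
      ({f (Sum.inr (0, j)), f (Sum.inr (1, j)), f (Sum.inr (4, j))} : Finset V) ∈ H) ∧
    (∀ j : Fin t, (j : ℕ) < i →
      ({f (Sum.inl ()), f (Sum.inr (0, j)), f (Sum.inr (1, j))} : Finset V) ∈ H)

/-- The Turán number `ex_3(n, F_t^3(i))`. -/
noncomputable def exFan3Tri (t i n : ℕ) : ℕ :=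
  sSup {m | ∃ H : Finset (Finset (Fin n)),
    (∀ e ∈ H, e.card = 3) ∧ ¬ ContainsFanExpTri t i H ∧ H.card = m}

open Finset in
/-- In a finite digraph of out-degree at most `D`, every set of `(2 * D + 1) * t` vertices contains
`t` pairwise non-adjacent ones. -/
theorem exists_independent_of_outdegree_le {α : Type*} [DecidableEq α] (r : α → α → Prop)
    [DecidableRel r] (D t : ℕ) (S : Finset α) (hout : ∀ x ∈ S, #{y ∈ S | r x y} ≤ D)
    (hS : (2 * D + 1) * t ≤ #S) :
    ∃ T ⊆ S, #T = t ∧ ∀ x ∈ T, ∀ y ∈ T, x ≠ y → ¬ r x y := by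
  induction t generalizing S with
  | zero => exact ⟨∅, by simp, by simp, by simp⟩
  | succ t ih =>
    have hpos : 0 < #S := lt_of_lt_of_le (by positivity) hS
    obtain ⟨v, hv, hin⟩ : ∃ v ∈ S, #{x ∈ S | r x v} ≤ D := by
      by_contra! h
      have h1 : ∑ v ∈ S, (D + 1) ≤ ∑ v ∈ S, #{x ∈ S | r x v} := sum_le_sum h
      have h2 : ∑ x ∈ S, #{y ∈ S | r x y} ≤ ∑ x ∈ S, D := sum_le_sum hout
      have h3 : ∑ x ∈ S, #{y ∈ S | r x y} = ∑ v ∈ S, #{x ∈ S | r x v} :=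
        sum_card_bipartiteAbove_eq_sum_card_bipartiteBelow r
      simp only [sum_const, smul_eq_mul] at h1 h2
      nlinarith
    set R : Finset α := insert v ({y ∈ S | r v y} ∪ {x ∈ S | r x v}) with hR
    have hRcard : #R ≤ 2 * D + 1 := by
      have h1 := card_insert_le v ({y ∈ S | r v y} ∪ {x ∈ S | r x v})
      have h2 := card_union_le {y ∈ S | r v y} {x ∈ S | r x v}
      have h3 := hout v hv
      rw [hR]
      omega
    obtain ⟨T, hTS, hT, hind⟩ := ih (S \ R)
      (fun x hx => (card_le_card (filter_subset_filter _ sdiff_subset)).trans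
        (hout x (mem_sdiff.1 hx).1))
      (by
        have := le_card_sdiff R S
        rw [mul_add, mul_one] at hS
        omega)
    have hnot : ∀ y ∈ T, y ≠ v ∧ ¬ r v y ∧ ¬ r y v := by
      intro y hy
      have h := mem_sdiff.1 (hTS hy)
      simp only [hR, mem_insert, mem_union, mem_filter] at h
      tauto
    refine ⟨insert v T, insert_subset hv (hTS.trans sdiff_subset), ?_, ?_⟩
    · rw [card_insert_of_notMem (fun h => (hnot v h).1 rfl), hT]
    · intro x hx y hy hxy
      rcases mem_insert.1 hx with rfl | hxT <;> rcases mem_insert.1 hy with rfl | hyT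
      · exact absurd rfl hxy
      · exact (hnot y hyT).2.1
      · exact (hnot x hxT).2.2
      · exact hind x hxT y hyT hxy

namespace FanExpansion

open Finset

variable {V : Type*} [DecidableEq V]

/-- The number of hyperedges containing a given set of vertices. -/
def codeg (H : Finset (Finset V)) (p : Finset V) : ℕ := #{e ∈ H | p ⊆ e}

/-- A hyperedge is rich if the reciprocals of the codegrees of its pairs add up to less than
`1 / t`. -/
def IsRich (t : ℕ) (H : Finset (Finset V)) (e : Finset V) : Prop :=
  (t : ℚ) * ∑ p ∈ e.powersetCard 2, (codeg H p : ℚ)⁻¹ < 1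

open Classical in
theorem card_le_add_card_rich [Fintype V] (t : ℕ) (H : Finset (Finset V)) :
    #H ≤ t * (Fintype.card V).choose 2 + #{e ∈ H | IsRich t H e} := by
  have hsum : ∑ e ∈ H, ∑ p ∈ e.powersetCard 2, (codeg H p : ℚ)⁻¹
      ≤ (Fintype.card V).choose 2 := by
    rw [sum_comm' (s' := fun p => {e ∈ H | p ⊆ e}) (t' := (univ : Finset V).powersetCard 2)
      (by intro e p; simp only [mem_powersetCard, mem_filter, subset_univ, true_and]; tauto)]
    calc ∑ p ∈ (univ : Finset V).powersetCard 2, ∑ e ∈ H with p ⊆ e, (codeg H p : ℚ)⁻¹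
        ≤ ∑ p ∈ (univ : Finset V).powersetCard 2, 1 := by
          refine sum_le_sum fun p _ => ?_
          rw [sum_const, nsmul_eq_mul]
          exact mul_inv_le_one
      _ = _ := by simp
  have hpoor : (#{e ∈ H | ¬ IsRich t H e} : ℚ) ≤ t * (Fintype.card V).choose 2 := by
    calc (#{e ∈ H | ¬ IsRich t H e} : ℚ)
        = ∑ e ∈ H with ¬ IsRich t H e, (1 : ℚ) := by simp
      _ ≤ ∑ e ∈ H with ¬ IsRich t H e,
            (t : ℚ) * ∑ p ∈ e.powersetCard 2, (codeg H p : ℚ)⁻¹ :=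
          sum_le_sum fun e he => not_lt.1 (mem_filter.1 he).2
      _ ≤ ∑ e ∈ H, (t : ℚ) * ∑ p ∈ e.powersetCard 2, (codeg H p : ℚ)⁻¹ :=
          sum_le_sum_of_subset_of_nonneg (filter_subset _ _) fun e _ _ => by positivity
      _ ≤ _ := by rw [← mul_sum]; gcongr
  have hpoor' : #{e ∈ H | ¬ IsRich t H e} ≤ t * (Fintype.card V).choose 2 := by
    exact_mod_cast hpoor
  have : #{e ∈ H | IsRich t H e} + #{e ∈ H | ¬ IsRich t H e} = #H :=
    card_filter_add_card_filter_not _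
  omega

theorem IsRich.exists_lt_codeg {t : ℕ} (ht : 0 < t) {H : Finset (Finset V)} {e : Finset V}
    (he : e ∈ H) (hrich : IsRich t H e) {Q : Finset (Finset V)} (hQ : Q ⊆ e.powersetCard 2)
    (hne : Q.Nonempty) : ∃ p ∈ Q, #Q * t < codeg H p := by
  by_contra! h
  have hk : (0 : ℚ) < #Q := by exact_mod_cast hne.card_pos
  have ht' : (0 : ℚ) < t := by exact_mod_cast ht
  have hle : ∑ p ∈ Q, ((#Q : ℚ) * t)⁻¹ ≤ ∑ p ∈ e.powersetCard 2, (codeg H p : ℚ)⁻¹ := by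
    refine (sum_le_sum fun p hp => ?_).trans
      (sum_le_sum_of_subset_of_nonneg hQ fun p _ _ => by positivity)
    have hpos : 0 < codeg H p :=
      card_pos.2 ⟨e, mem_filter.2 ⟨he, (mem_powersetCard.1 (hQ hp)).1⟩⟩
    have h1 : (codeg H p : ℚ) ≤ #Q * t := by exact_mod_cast h p hp
    have h2 : (0 : ℚ) < codeg H p := by exact_mod_cast hpos
    gcongr
  rw [sum_const, nsmul_eq_mul] at hle
  have h1 : (#Q : ℚ) * ((#Q : ℚ) * t)⁻¹ = (t : ℚ)⁻¹ := by field_simp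
  rw [h1] at hle
  have h2 : (t : ℚ) * (t : ℚ)⁻¹ = 1 := by field_simp
  have h3 := mul_le_mul_of_nonneg_left hle ht'.le
  unfold IsRich at hrich
  linarith

/-- The vertices outside `e` which form a hyperedge together with `p`. -/
def outerNeighbors [Fintype V] (H : Finset (Finset V)) (e p : Finset V) : Finset V :=
  {v | v ∉ e ∧ insert v p ∈ H}

theorem codeg_le_card_outerNeighbors_add_one [Fintype V] {H : Finset (Finset V)}
    (hH : ∀ e ∈ H, #e = 3) {e p : Finset V} (he : e ∈ H) (hp : p ∈ e.powersetCard 2) :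
    codeg H p ≤ #(outerNeighbors H e p) + 1 := by
  obtain ⟨hpe, hp2⟩ := mem_powersetCard.1 hp
  have hsub : ({e' ∈ H | p ⊆ e'} : Finset (Finset V)) ⊆
      insert e ((outerNeighbors H e p).image fun v => insert v p) := by
    intro e' he'
    obtain ⟨he'H, hpe'⟩ := mem_filter.1 he'
    by_cases hee : e' = e
    · simp [hee]
    obtain ⟨v, hv⟩ : ∃ v, e' \ p = {v} := by
      rw [← card_eq_one, card_sdiff_of_subset hpe', hH e' he'H, hp2]
    have hins : insert v p = e' := by
      rw [insert_eq, ← hv, sdiff_union_of_subset hpe']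
    refine mem_insert_of_mem (mem_image.2 ⟨v, ?_, hins⟩)
    simp only [outerNeighbors, mem_filter, mem_univ, true_and]
    refine ⟨fun hve => hee ?_, hins ▸ he'H⟩
    refine eq_of_subset_of_card_le ?_ (by rw [hH e he, hH e' he'H])
    rw [← hins]
    exact insert_subset hve hpe
  calc codeg H p ≤ _ := card_le_card hsub
    _ ≤ _ := card_insert_le _ _
    _ ≤ _ := Nat.add_le_add_right card_image_le 1

theorem containsFanExpTri_of_vertices {t : ℕ} {H : Finset (Finset V)} {c : V} {a b : Fin t → V}
    {g : Fin 3 × Fin t → V} (hac : ∀ j, a j ≠ c) (hbc : ∀ j, b j ≠ c)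
    (haa : Function.Injective a) (hbb : Function.Injective b) (hab : ∀ i j, a i ≠ b j)
    (hg : Function.Injective g) (hgc : ∀ i, g i ≠ c) (hga : ∀ i j, g i ≠ a j)
    (hgb : ∀ i j, g i ≠ b j) (h0 : ∀ j, {c, a j, b j} ∈ H) (h1 : ∀ j, {c, a j, g (0, j)} ∈ H)
    (h2 : ∀ j, {c, b j, g (1, j)} ∈ H) (h3 : ∀ j, {a j, b j, g (2, j)} ∈ H) :
    ContainsFanExpTri t t H := by
  refine ⟨Sum.elim (fun _ => c)
    (fun q => ![a q.2, b q.2, g (0, q.2), g (1, q.2), g (2, q.2)] q.1), ?_, ?_, ?_⟩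
  · rintro (u | ⟨k, i⟩) (u' | ⟨k', i'⟩) h
    · rfl
    · exfalso
      fin_cases k' <;> simp at h
      exacts [hac _ h.symm, hbc _ h.symm, hgc _ h.symm, hgc _ h.symm, hgc _ h.symm]
    · exfalso
      fin_cases k <;> simp at h
      exacts [hac _ h, hbc _ h, hgc _ h, hgc _ h, hgc _ h]
    · fin_cases k <;> fin_cases k' <;>
        simp [haa.eq_iff, hbb.eq_iff, hg.eq_iff, hab, hga, hgb, fun i j => (hab i j).symm,
          fun i j => (hga i j).symm, fun i j => (hgb i j).symm] at h ⊢ <;> exact h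
  · exact fun j => ⟨h1 j, h2 j, h3 j⟩
  · exact fun j _ => h0 j

/-- Hall's condition for the pairs of a collection of rich hyperedges. -/
theorem exists_injective_of_rich {t : ℕ} (ht : 0 < t) {H : Finset (Finset V)}
    {e : Fin t → Finset V} (he : ∀ j, e j ∈ H) (hrich : ∀ j, IsRich t H (e j))
    {p : Fin 3 → Fin t → Finset V} (hp : ∀ k j, p k j ∈ (e j).powersetCard 2)
    (hinj : ∀ j, Function.Injective fun k => p k j) {B : Finset V → Finset V → Finset V}
    (hB : ∀ k j, min (codeg H (p k j)) (3 * t + 1) ≤ #(B (e j) (p k j)) + 1) :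
    ∃ g : Fin 3 × Fin t → V, Function.Injective g ∧ ∀ q, g q ∈ B (e q.2) (p q.1 q.2) := by
  refine (all_card_le_biUnion_card_iff_exists_injective
    (fun q : Fin 3 × Fin t => B (e q.2) (p q.1 q.2))).1 fun T => ?_
  rcases T.eq_empty_or_nonempty with rfl | hT
  · simp
  obtain ⟨j, -, hj⟩ := exists_max_image univ
    (fun j => #{k : Fin 3 | (k, j) ∈ T}) ⟨(⟨0, ht⟩ : Fin t), mem_univ _⟩
  set F : Finset (Fin 3) := {k : Fin 3 | (k, j) ∈ T} with hF
  have hcard : #T ≤ #F * t := by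
    have h1 : #T = ∑ i : Fin t, #{q ∈ T | q.2 = i} :=
      card_eq_sum_card_fiberwise fun q _ => mem_univ q.2
    have h2 : ∀ i : Fin t, #{q ∈ T | q.2 = i} ≤ #F := fun i => by
      refine le_trans ?_ (hj i (mem_univ i))
      refine card_le_card_of_injOn Prod.fst ?_ ?_
      · rintro ⟨k, i'⟩ hq
        simp only [coe_filter, Set.mem_ofPred_eq] at hq
        obtain ⟨hq, rfl⟩ := hq
        simpa using hq
      · rintro ⟨k, i₁⟩ hq ⟨k', i₂⟩ hq' h
        simp only [coe_filter, Set.mem_ofPred_eq] at hq hq' h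
        rw [Prod.mk.injEq]
        exact ⟨h, hq.2.trans hq'.2.symm⟩
    rw [h1]
    calc ∑ i : Fin t, #{q ∈ T | q.2 = i} ≤ ∑ i : Fin t, #F := sum_le_sum fun i _ => h2 i
      _ = #F * t := by simp [mul_comm]
  have hFne : F.Nonempty := by
    rw [← card_pos]
    by_contra! h
    have := hT.card_pos
    nlinarith
  obtain ⟨P, hP, hlt⟩ := (hrich j).exists_lt_codeg ht (he j) (Q := F.image fun k => p k j)
    (image_subset_iff.2 fun k _ => hp k j) (hFne.image _)
  obtain ⟨k, hk, rfl⟩ := mem_image.1 hP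
  rw [card_image_of_injective _ (hinj j)] at hlt
  have hF3 : #F ≤ 3 := by simpa using card_le_univ F
  have hF3t : #F * t ≤ 3 * t := Nat.mul_le_mul_right t hF3
  have hBk := hB k j
  have hsub : B (e j) (p k j) ⊆ T.biUnion fun q => B (e q.2) (p q.1 q.2) :=
    subset_biUnion_of_mem (fun q : Fin 3 × Fin t => B (e q.2) (p q.1 q.2))
      (mem_filter.1 hk).2
  have := card_le_card hsub
  omega

theorem card_lt_of_sunflower [Fintype V] {t : ℕ} (ht : 0 < t) {H : Finset (Finset V)}
    (hH : ∀ e ∈ H, #e = 3) (hfree : ¬ ContainsFanExpTri t t H) {c : V} {P : Finset (Finset V)}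
    (hP : ∀ e ∈ P, e ∈ H ∧ IsRich t H e ∧ c ∈ e)
    (hdisj : ∀ e ∈ P, ∀ e' ∈ P, e ≠ e' → e ∩ e' = {c}) :
    #P < (18 * t + 1) * t := by
  by_contra! hcard
  apply hfree
  have hBex : ∀ e p : Finset V, ∃ B ⊆ outerNeighbors H e p,
      #B = min #(outerNeighbors H e p) (3 * t) :=
    fun e p => exists_subset_card_eq (min_le_left _ _)
  choose B hBsub hBcard using hBex
  obtain ⟨T, hTP, hTcard, hind⟩ := exists_independent_of_outdegree_le
    (fun e e' : Finset V => ∃ v ∈ (e.powersetCard 2).biUnion (B e), v ∈ e') (9 * t) t P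
    (by
      intro e he
      have hU : #((e.powersetCard 2).biUnion (B e)) ≤ 9 * t := by
        calc _ ≤ #(e.powersetCard 2) * (3 * t) :=
              card_biUnion_le_card_mul _ _ _ fun p _ => by rw [hBcard]; exact min_le_right _ _
          _ = 9 * t := by
              rw [card_powersetCard, hH e (hP e he).1]
              simp only [Nat.choose]
              ring
      have hcU : c ∉ (e.powersetCard 2).biUnion (B e) := by
        intro hc
        obtain ⟨p, -, hcp⟩ := mem_biUnion.1 hc
        exact (mem_filter.1 (hBsub e p hcp)).2.1 (hP e he).2.2
      refine le_trans ?_ hU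
      refine card_le_card_of_forall_subsingleton (fun e' v => v ∈ e') ?_ ?_
      · intro e' he'
        exact (mem_filter.1 he').2
      · intro v hv e₁ h₁ e₂ h₂
        by_contra hne
        have hv' := mem_inter.2 ⟨h₁.2, h₂.2⟩
        rw [hdisj e₁ (mem_filter.1 h₁.1).1 e₂ (mem_filter.1 h₂.1).1 hne, mem_singleton] at hv'
        exact hcU (hv' ▸ hv))
    (by
      refine le_trans (le_of_eq ?_) hcard
      ring)
  let enum := (T.equivFinOfCardEq hTcard).symm
  let e : Fin t → Finset V := fun j => (enum j : Finset V)
  have heT : ∀ j, e j ∈ T := fun j => (enum j).2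
  have heinj : Function.Injective e := Subtype.val_injective.comp enum.injective
  have hePr : ∀ j, e j ∈ H ∧ IsRich t H (e j) ∧ c ∈ e j := fun j => hP _ (hTP (heT j))
  have habex : ∀ j, ∃ a b : V, a ≠ b ∧ (e j).erase c = {a, b} := fun j => by
    rw [← card_eq_two, card_erase_of_mem (hePr j).2.2, hH _ (hePr j).1]
  choose a b hab hera using habex
  have heq : ∀ j, e j = {c, a j, b j} := fun j => by
    rw [← hera j, insert_erase (hePr j).2.2]
  have ha : ∀ j, a j ≠ c ∧ a j ∈ e j := fun j => by
    rw [← mem_erase, hera j]; simp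
  have hb : ∀ j, b j ≠ c ∧ b j ∈ e j := fun j => by
    rw [← mem_erase, hera j]; simp
  have huniq : ∀ i j v, v ≠ c → v ∈ e i → v ∈ e j → i = j := by
    intro i j v hvc hi hj
    by_contra hne
    have hv := mem_inter.2 ⟨hi, hj⟩
    rw [hdisj _ (hTP (heT i)) _ (hTP (heT j)) (heinj.ne hne), mem_singleton] at hv
    exact hvc hv
  have hca : ∀ j, c ≠ a j := fun j => (ha j).1.symm
  have hcb : ∀ j, c ≠ b j := fun j => (hb j).1.symm
  let p : Fin 3 → Fin t → Finset V := fun k j => ![{c, a j}, {c, b j}, {a j, b j}] k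
  have hp : ∀ k j, p k j ∈ (e j).powersetCard 2 := by
    intro k j
    rw [mem_powersetCard, heq j]
    fin_cases k
    · exact ⟨by intro v; simp [p]; tauto, card_pair (hca j)⟩
    · exact ⟨by intro v; simp [p]; tauto, card_pair (hcb j)⟩
    · exact ⟨by intro v; simp [p]; tauto, card_pair (hab j)⟩
  have hpinj : ∀ j, Function.Injective fun k => p k j := by
    intro j k k' h
    have h1 := fun v => (Finset.ext_iff.1 h) v
    have h2 := h1 c
    have h3 := h1 (a j)
    have h4 := h1 (b j)
    fin_cases k <;> fin_cases k' <;>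
      simp [p, hca j, hcb j, hab j, (hca j).symm, (hcb j).symm, (hab j).symm] at h2 h3 h4 ⊢
  obtain ⟨g, hginj, hg⟩ := exists_injective_of_rich ht (fun j => (hePr j).1)
    (fun j => (hePr j).2.1) hp hpinj (B := B) (by
      intro k j
      have := codeg_le_card_outerNeighbors_add_one hH (hePr j).1 (hp k j)
      rw [hBcard]
      omega)
  have hgN : ∀ k j, g (k, j) ∉ e j ∧ insert (g (k, j)) (p k j) ∈ H := fun k j =>
    (mem_filter.1 (hBsub _ _ (hg (k, j)))).2
  have hge : ∀ q j, g q ∉ e j := by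
    rintro ⟨k, i⟩ j
    rcases eq_or_ne i j with rfl | hij
    · exact (hgN k i).1
    · intro hmem
      exact hind _ (heT i) _ (heT j) (heinj.ne hij)
        ⟨g (k, i), mem_biUnion.2 ⟨p k i, hp k i, hg (k, i)⟩, hmem⟩
  refine containsFanExpTri_of_vertices (c := c) (a := a) (b := b) (g := g)
    (fun j => (ha j).1) (fun j => (hb j).1)
    (fun i j h => huniq i j (a i) (ha i).1 (ha i).2 (h ▸ (ha j).2))
    (fun i j h => huniq i j (b i) (hb i).1 (hb i).2 (h ▸ (hb j).2)) ?_ hginj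
    (fun q h => hge q q.2 (h ▸ (hePr q.2).2.2)) (fun q j h => hge q j (h ▸ (ha j).2))
    (fun q j h => hge q j (h ▸ (hb j).2)) (fun j => heq j ▸ (hePr j).1) ?_ ?_ ?_
  · intro i j h
    have hij := huniq i j (a i) (ha i).1 (ha i).2 (h ▸ (hb j).2)
    subst hij
    exact hab i h
  · intro j
    convert (hgN 0 j).2 using 1
    ext v; simp [p]; tauto
  · intro j
    convert (hgN 1 j).2 using 1
    ext v; simp [p]; tauto
  · intro j
    convert (hgN 2 j).2 using 1
    ext v; simp [p]; tauto

theorem exists_cover_of_rich [Fintype V] {t : ℕ} (ht : 0 < t) {H : Finset (Finset V)}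
    (hH : ∀ e ∈ H, #e = 3) (hfree : ¬ ContainsFanExpTri t t H) (c : V) :
    ∃ W : Finset V, #W ≤ 2 * ((18 * t + 1) * t) ∧
      ∀ e ∈ H, IsRich t H e → c ∈ e → ∃ w ∈ W, w ∈ e ∧ w ≠ c := by
  classical
  let sunflowers : Finset (Finset (Finset V)) :=
    {P ∈ H.powerset | (∀ e ∈ P, e ∈ H ∧ IsRich t H e ∧ c ∈ e) ∧
      ∀ e ∈ P, ∀ e' ∈ P, e ≠ e' → e ∩ e' = {c}}
  obtain ⟨P, hP, hmax⟩ := exists_max_image sunflowers card ⟨∅, by simp [sunflowers]⟩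
  obtain ⟨-, hPr, hPd⟩ := mem_filter.1 hP
  refine ⟨P.biUnion fun e => e.erase c, ?_, ?_⟩
  · calc _ ≤ #P * 2 := card_biUnion_le_card_mul _ _ _ fun e he => by
          rw [card_erase_of_mem (hPr e he).2.2, hH e (hPr e he).1]
      _ ≤ _ := by
          have := card_lt_of_sunflower ht hH hfree hPr hPd
          omega
  · intro e he hrich hce
    by_contra! hno
    have hinter : ∀ e' ∈ P, e ∩ e' = {c} := by
      intro e' he'
      ext v
      simp only [mem_inter, mem_singleton]
      refine ⟨fun hv => ?_, ?_⟩
      · by_contra hvc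
        exact hvc (hno v (mem_biUnion.2 ⟨e', he', mem_erase.2 ⟨hvc, hv.2⟩⟩) hv.1)
      · rintro rfl
        exact ⟨hce, (hPr e' he').2.2⟩
    have heP : e ∉ P := by
      intro heP
      have h := hinter e heP
      rw [inter_self] at h
      have h3 := hH e he
      rw [h, card_singleton] at h3
      omega
    have hins : insert e P ∈ sunflowers := by
      refine mem_filter.2 ⟨mem_powerset.2
        (insert_subset he fun e' he' => (hPr e' he').1), ?_, ?_⟩
      · intro e' he'
        rcases mem_insert.1 he' with rfl | he'
        · exact ⟨he, hrich, hce⟩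
        · exact hPr e' he'
      · intro e₁ h₁ e₂ h₂ hne
        rcases mem_insert.1 h₁ with rfl | h₁P <;> rcases mem_insert.1 h₂ with rfl | h₂P
        · exact absurd rfl hne
        · exact hinter e₂ h₂P
        · rw [inter_comm]
          exact hinter e₁ h₁P
        · exact hPd e₁ h₁P e₂ h₂P hne
    have := hmax _ hins
    rw [card_insert_of_notMem heP] at this
    omega

/-- A family of triples in which every vertex of a triple has an out-neighbour inside the triple
with respect to a digraph of out-degree at most `M` is of linear size. -/
theorem card_le_of_outneighbors [Fintype V] {G : Finset (Finset V)} (hG : ∀ e ∈ G, #e = 3)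
    {W : V → Finset V} {M : ℕ} (hW : ∀ v, #(W v) ≤ M)
    (hcov : ∀ e ∈ G, ∀ v ∈ e, ∃ w ∈ W v, w ∈ e ∧ w ≠ v) :
    #G ≤ Fintype.card V * (M * M) := by
  have hsub : G ⊆ (univ : Finset V).biUnion fun v => (W v).biUnion fun w =>
      (W w).image fun u => {v, w, u} := by
    intro e he
    suffices h : ∃ v w u, w ∈ W v ∧ u ∈ W w ∧ ({v, w, u} : Finset V) = e by
      obtain ⟨v, w, u, hw, hu, rfl⟩ := h
      simp only [mem_biUnion, mem_image, mem_univ, true_and]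
      exact ⟨v, w, hw, u, hu, rfl⟩
    obtain ⟨x, y, z, hxy, hxz, hyz, rfl⟩ := card_eq_three.1 (hG e he)
    have hstep := hcov _ he
    have hx : y ∈ W x ∨ z ∈ W x := by
      obtain ⟨w, hw, hwe, hne⟩ := hstep x (by simp)
      simp only [mem_insert, mem_singleton] at hwe
      rcases hwe with rfl | rfl | rfl <;> tauto
    have hy : x ∈ W y ∨ z ∈ W y := by
      obtain ⟨w, hw, hwe, hne⟩ := hstep y (by simp)
      simp only [mem_insert, mem_singleton] at hwe
      rcases hwe with rfl | rfl | rfl <;> tauto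
    have hz : x ∈ W z ∨ y ∈ W z := by
      obtain ⟨w, hw, hwe, hne⟩ := hstep z (by simp)
      simp only [mem_insert, mem_singleton] at hwe
      rcases hwe with rfl | rfl | rfl <;> tauto
    have e1 : ({x, z, y} : Finset V) = {x, y, z} := by ext; simp; tauto
    have e2 : ({y, x, z} : Finset V) = {x, y, z} := by ext; simp; tauto
    have e3 : ({y, z, x} : Finset V) = {x, y, z} := by ext; simp; tauto
    have e4 : ({z, x, y} : Finset V) = {x, y, z} := by ext; simp; tauto
    have e5 : ({z, y, x} : Finset V) = {x, y, z} := by ext; simp; tauto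
    rcases hx with hx | hx <;> rcases hy with hy | hy <;> rcases hz with hz | hz
    · exact ⟨z, x, y, hz, hx, e4⟩
    · exact ⟨z, y, x, hz, hy, e5⟩
    · exact ⟨x, y, z, hx, hy, rfl⟩
    · exact ⟨x, y, z, hx, hy, rfl⟩
    · exact ⟨y, x, z, hy, hx, e2⟩
    · exact ⟨x, z, y, hx, hz, e1⟩
    · exact ⟨y, z, x, hy, hz, e3⟩
    · exact ⟨x, z, y, hx, hz, e1⟩
  calc #G ≤ _ := card_le_card hsub
    _ ≤ #(univ : Finset V) * (M * M) := card_biUnion_le_card_mul _ _ _ fun v _ =>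
        (card_biUnion_le_card_mul _ _ M fun w _ => card_image_le.trans (hW w)).trans
          (Nat.mul_le_mul_right M (hW v))

theorem card_le_of_not_containsFanExpTri [Fintype V] {t : ℕ} (ht : 0 < t)
    {H : Finset (Finset V)} (hH : ∀ e ∈ H, #e = 3) (hfree : ¬ ContainsFanExpTri t t H) :
    #H ≤ t * (Fintype.card V).choose 2 +
      Fintype.card V * (2 * ((18 * t + 1) * t) * (2 * ((18 * t + 1) * t))) := by
  classical
  choose W hW hcov using exists_cover_of_rich ht hH hfree
  refine (card_le_add_card_rich t H).trans (Nat.add_le_add_left ?_ _)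
  refine card_le_of_outneighbors (W := W) (fun e he => hH e (mem_filter.1 he).1) hW ?_
  intro e he v hv
  exact hcov v e (mem_filter.1 he).1 (mem_filter.1 he).2 hv

/-- The triples meeting a given vertex set in exactly one vertex. -/
def crosscutTriples [Fintype V] (S : Finset V) : Finset (Finset V) :=
  {e | #e = 3 ∧ #(e ∩ S) = 1}

theorem card_inter_triple {S : Finset V} {u v w : V}
    (huv : u ≠ v) (huw : u ≠ w) (hvw : v ≠ w) :
    #({u, v, w} ∩ S) =
      (if u ∈ S then 1 else 0) + (if v ∈ S then 1 else 0) + (if w ∈ S then 1 else 0) := by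
  by_cases hu : u ∈ S <;> by_cases hv : v ∈ S <;> by_cases hw : w ∈ S <;>
    simp [insert_inter_of_mem, insert_inter_of_notMem, singleton_inter_of_mem,
      singleton_inter_of_notMem, hu, hv, hw, huv, huw, hvw]

theorem not_containsFanExpTri_crosscutTriples [Fintype V] {t : ℕ} (ht : 1 < t) {S : Finset V}
    (hS : #S ≤ t) : ¬ ContainsFanExpTri t t (crosscutTriples S) := by
  rintro ⟨f, hf, hexp, hcore⟩
  have key : ∀ i j k, i ≠ j → i ≠ k → j ≠ k →
      ({f i, f j, f k} : Finset V) ∈ crosscutTriples S →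
      (if f i ∈ S then 1 else 0) + (if f j ∈ S then 1 else 0) + (if f k ∈ S then 1 else 0) = 1 := by
    intro i j k hij hik hjk h
    rw [← card_inter_triple (hf.ne hij) (hf.ne hik) (hf.ne hjk)]
    exact (mem_filter.1 h).2.2
  have h1 := fun j => key _ _ _ (by simp) (by simp) (by simp) (hexp j).1
  have h2 := fun j => key _ _ _ (by simp) (by simp) (by simp) (hexp j).2.1
  have h3 := fun j => key _ _ _ (by simp) (by simp) (by simp) (hexp j).2.2
  have h4 := fun j => key _ _ _ (by simp) (by simp) (by simp) (hcore j j.2)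
  have hbound : ∀ {ι : Type} [Fintype ι] (φ : ι → Unit ⊕ Fin 5 × Fin t),
      Function.Injective φ → (∀ i, f (φ i) ∈ S) → Fintype.card ι ≤ t := by
    intro ι _ φ hφ hmem
    refine le_trans ?_ hS
    rw [← card_univ]
    exact card_le_card_of_injOn (fun i => f (φ i)) (fun i _ => hmem i) (hf.comp hφ).injOn
  by_cases hc : f (Sum.inl ()) ∈ S
  · have := hbound (ι := Option (Fin t))
      (fun o => o.elim (Sum.inl ()) fun j => Sum.inr (4, j))
      (by
        rintro (_ | i) (_ | j) h
        · rfl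
        · simp at h
        · simp at h
        · simpa using h)
      (by
        rintro (_ | j)
        · exact hc
        · have h1 := h1 j
          have h2 := h2 j
          have h3 := h3 j
          simp only [hc, if_true] at h1 h2
          by_contra h
          simp only [Option.elim] at h
          simp only [h, if_false] at h3
          omega)
    rw [Fintype.card_option, Fintype.card_fin] at this
    omega
  · have htwo : ∀ j, ∃ k k' : Fin 5, k ≠ k' ∧
        f (Sum.inr (k, j)) ∈ S ∧ f (Sum.inr (k', j)) ∈ S := by
      intro j
      have h1 := h1 j
      have h2 := h2 j
      have h4 := h4 j
      simp only [hc, if_false] at h1 h2 h4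
      by_cases ha : f (Sum.inr (0, j)) ∈ S
      · refine ⟨0, 3, by decide, ha, ?_⟩
        by_contra h
        simp only [ha, h, if_true, if_false] at h2 h4
        omega
      · refine ⟨1, 2, by decide, ?_, ?_⟩
        · by_contra h
          simp only [ha, h, if_false] at h4
          omega
        · by_contra h
          simp only [ha, h, if_false] at h1
          omega
    choose k k' hne hk hk' using htwo
    have := hbound (ι := Bool × Fin t)
      (fun q => Sum.inr (if q.1 then k q.2 else k' q.2, q.2))
      (by
        rintro ⟨x, i⟩ ⟨y, j⟩ h
        simp only [Sum.inr.injEq, Prod.mk.injEq] at h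
        obtain ⟨h, rfl⟩ := h
        cases x <;> cases y <;> simp [hne i, (hne i).symm] at h ⊢)
      (by
        rintro ⟨x, j⟩
        cases x
        · exact hk' j
        · exact hk j)
    rw [Fintype.card_prod, Fintype.card_bool, Fintype.card_fin] at this
    omega

theorem card_mul_choose_le_card_crosscutTriples [Fintype V] (S : Finset V) :
    #S * (Fintype.card V - #S).choose 2 ≤ #(crosscutTriples S) := by
  rw [← card_compl, ← card_powersetCard, ← card_product]
  have hinter : ∀ q ∈ S ×ˢ powersetCard 2 Sᶜ, insert q.1 q.2 ∩ S = {q.1} := by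
    rintro ⟨s, p⟩ hq
    obtain ⟨hs, hp⟩ := mem_product.1 hq
    have hdisj : p ∩ S = ∅ :=
      disjoint_iff_inter_eq_empty.1 (disjoint_compl_left.mono_left (mem_powersetCard.1 hp).1)
    dsimp only
    rw [insert_inter_of_mem hs, hdisj, insert_empty_eq]
  have hnot : ∀ q ∈ S ×ˢ powersetCard 2 Sᶜ, q.1 ∉ q.2 := by
    rintro ⟨s, p⟩ hq h
    obtain ⟨hs, hp⟩ := mem_product.1 hq
    exact mem_compl.1 ((mem_powersetCard.1 hp).1 h) hs
  refine card_le_card_of_injOn (fun q => insert q.1 q.2) ?_ ?_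
  · intro q hq
    simp only [crosscutTriples, coe_filter, mem_univ, true_and, Set.mem_ofPred_eq]
    rw [hinter q hq, card_singleton, card_insert_of_notMem (hnot q hq),
      (mem_powersetCard.1 (mem_product.1 hq).2).2]
    exact ⟨rfl, rfl⟩
  · intro q hq q' hq' h
    dsimp only at h
    have h1 : q.1 = q'.1 := by
      rw [← singleton_inj, ← hinter q hq, ← hinter q' hq', h]
    refine Prod.ext h1 ?_
    rw [← erase_insert (hnot q hq), ← erase_insert (hnot q' hq'), h, h1]

theorem choose_two_le_choose_sub_two_add (n t : ℕ) :
    n.choose 2 ≤ (n - t).choose 2 + t * n := by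
  induction t with
  | zero => simp
  | succ t ih =>
    have h : (n - t).choose 2 ≤ (n - (t + 1)).choose 2 + n := by
      rcases Nat.eq_zero_or_pos (n - t) with h0 | hpos
      · simp [h0]
      · obtain ⟨m, hm⟩ := Nat.exists_eq_succ_of_ne_zero hpos.ne'
        have hm' : n - (t + 1) = m := by omega
        have hsucc : (m + 1).choose 2 = m + m.choose 2 := by
          rw [Nat.choose_succ_succ' m 1, Nat.choose_one_right]
        rw [hm, hm', Nat.succ_eq_add_one, hsucc]
        omega
    rw [Nat.succ_mul]
    omega

theorem bddAbove_card_free (t n : ℕ) : BddAbove {m | ∃ H : Finset (Finset (Fin n)),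
    (∀ e ∈ H, e.card = 3) ∧ ¬ ContainsFanExpTri t t H ∧ H.card = m} := by
  refine ⟨Fintype.card (Finset (Fin n)), ?_⟩
  rintro m ⟨H, -, -, rfl⟩
  exact card_le_univ H

theorem exFan3Tri_le {t : ℕ} (ht : 0 < t) (n : ℕ) :
    exFan3Tri t t n ≤ t * n.choose 2 + n * (2 * ((18 * t + 1) * t) * (2 * ((18 * t + 1) * t))) := by
  refine csSup_le' ?_
  rintro m ⟨H, hH, hfree, rfl⟩
  simpa using card_le_of_not_containsFanExpTri ht hH hfree

theorem le_exFan3Tri_add {t : ℕ} (ht : 1 < t) (n : ℕ) :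
    t * n.choose 2 ≤ exFan3Tri t t n + t * t * n := by
  have hchoose := Nat.mul_le_mul_left t (choose_two_le_choose_sub_two_add n t)
  rcases le_or_gt t n with htn | hnt
  · obtain ⟨S, -, hS⟩ := exists_subset_card_eq (s := (univ : Finset (Fin n))) (n := t) (by simpa)
    have hle : #(crosscutTriples S) ≤ exFan3Tri t t n :=
      le_csSup (bddAbove_card_free t n) ⟨_, fun e he => (mem_filter.1 he).2.1,
        not_containsFanExpTri_crosscutTriples ht hS.le, rfl⟩
    have hcard := card_mul_choose_le_card_crosscutTriples S
    rw [hS, Fintype.card_fin] at hcard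
    nlinarith
  · rw [Nat.sub_eq_zero_of_le hnt.le] at hchoose
    simp only [Nat.choose_zero_succ, zero_add] at hchoose
    nlinarith

end FanExpansion

theorem turan_fan_expansion_all_triangles (t : ℕ) (ht : 1 < t) :
    ∃ C : ℕ, ∀ n : ℕ,
      |(exFan3Tri t t n : ℤ) - t * n.choose 2| ≤ C * n := by
  refine ⟨2 * ((18 * t + 1) * t) * (2 * ((18 * t + 1) * t)) + t * t, fun n => ?_⟩
  have hupper := FanExpansion.exFan3Tri_le (by omega : 0 < t) n
  have hlower := FanExpansion.le_exFan3Tri_add ht n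
  zify at hupper hlower
  push_cast
  rw [abs_le]
  constructor <;> nlinarith [show (0 : ℤ) ≤ n * (t * t) by positivity,
    show (0 : ℤ) ≤ n * (2 * ((18 * t + 1) * t) * (2 * ((18 * t + 1) * t))) by positivity]
end

section
/- For every integer t > 1 there exist a constant c > 0 and N such that for all n ≥ N the following holds: if H is an n-vertex F_t^3-free 3-graph and there is no t-element vertex set U such that every hyperedge of H intersects U, then H has at most t·C(n,2) − cn hyperedges. -/
namespace FanExp

/-! ### Selecting systems of distinct representatives -/

section Selection

variable {V : Type*} [DecidableEq V]

theorem hall {ι : Type*} [DecidableEq ι] [Nonempty V] (I : Finset ι) (S : ι → Finset V)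
    (h : ∀ J ⊆ I, J.Nonempty → J.card ≤ (J.biUnion S).card) :
    ∃ f : ι → V, (∀ i ∈ I, f i ∈ S i) ∧ Set.InjOn f I := by
  classical
  have key := (Finset.all_card_le_biUnion_card_iff_exists_injective
    (fun i : I => S i)).1 (by
      intro s
      rcases s.eq_empty_or_nonempty with rfl | hs
      · simp
      have := h (s.map (Function.Embedding.subtype _)) (by
        intro i hi
        simp only [Finset.mem_map, Function.Embedding.coe_subtype] at hi
        obtain ⟨a, -, rfl⟩ := hi
        exact a.2) (hs.map)
      rw [Finset.card_map] at this
      refine this.trans (Finset.card_le_card ?_)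
      intro v hv
      simp only [Finset.mem_biUnion, Finset.mem_map, Function.Embedding.coe_subtype] at hv ⊢
      obtain ⟨_, ⟨a, ha, rfl⟩, hv⟩ := hv
      exact ⟨a, ha, hv⟩)
  obtain ⟨f, hf, hfS⟩ := key
  refine ⟨fun i => if hi : i ∈ I then f ⟨i, hi⟩ else Classical.arbitrary V, ?_, ?_⟩
  · intro i hi
    simpa [hi] using hfS ⟨i, hi⟩
  · intro i hi j hj hij
    have hi' : i ∈ I := hi
    have hj' : j ∈ I := hj
    simp only [hi', hj', dif_pos] at hij
    simpa using hf hij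

theorem greedy {ι : Type*} [DecidableEq ι] [Nonempty V] (I : Finset ι) (S : ι → Finset V)
    (X : Finset V) (h : ∀ i ∈ I, X.card + I.card ≤ (S i).card) :
    ∃ f : ι → V, (∀ i ∈ I, f i ∈ S i ∧ f i ∉ X) ∧ Set.InjOn f I := by
  obtain ⟨f, hf, hinj⟩ := hall I (fun i => S i \ X) (by
    rintro J hJ ⟨j, hj⟩
    have h1 := h j (hJ hj)
    have h2 := Finset.le_card_sdiff X (S j)
    have h3 := Finset.card_le_card hJ
    have h4 := Finset.card_le_card (Finset.subset_biUnion_of_mem (fun i => S i \ X) hj)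
    omega)
  exact ⟨f, fun i hi => by simpa using hf i hi, hinj⟩

/-- Sets that are one element short of a greedy choice still have distinct representatives,
unless they all coincide. -/
theorem hall_of_ne {ι : Type*} [DecidableEq ι] [Nonempty V] (I : Finset ι) (S : ι → Finset V)
    (h : ∀ i ∈ I, I.card ≤ (S i).card + 1) {a b : ι} (ha : a ∈ I) (hb : b ∈ I)
    (hab : S a ≠ S b) :
    ∃ f : ι → V, (∀ i ∈ I, f i ∈ S i) ∧ Set.InjOn f I := by
  refine hall I S ?_
  rintro J hJ ⟨j, hj⟩
  have h1 := h j (hJ hj)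
  have h4 := Finset.card_le_card (Finset.subset_biUnion_of_mem S hj)
  rcases hJ.eq_or_ssubset with rfl | hlt
  · by_contra hcon
    have eq : ∀ i ∈ J, S i = J.biUnion S := by
      intro i hi
      refine Finset.eq_of_subset_of_card_le (Finset.subset_biUnion_of_mem S hi) ?_
      have := h i hi
      omega
    exact hab ((eq a ha).trans (eq b hb).symm)
  · have := Finset.card_lt_card hlt
    omega

/-- Hall's condition for families indexed by `Q × Fin 3`, checked within each fibre. -/
theorem hall_fibres {ι : Type*} [DecidableEq ι] [Nonempty V] (Q : Finset ι)
    (S : ι × Fin 3 → Finset V)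
    (h : ∀ p ∈ Q, ∀ K : Finset (Fin 3), K.Nonempty → ∃ k ∈ K, K.card * Q.card ≤ (S (p, k)).card) :
    ∃ f : ι × Fin 3 → V, (∀ i ∈ Q ×ˢ (Finset.univ : Finset (Fin 3)), f i ∈ S i) ∧
      Set.InjOn f (Q ×ˢ (Finset.univ : Finset (Fin 3)) : Finset (ι × Fin 3)) := by
  refine hall _ S ?_
  intro J hJ hne
  have hmaps : ∀ x ∈ J, x.1 ∈ Q := fun x hx => (Finset.mem_product.1 (hJ hx)).1
  have hcard := Finset.card_eq_sum_card_fiberwise hmaps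
  have hQ : Q.Nonempty := by
    obtain ⟨x, hx⟩ := hne
    exact ⟨_, hmaps x hx⟩
  obtain ⟨p, hp, hmax⟩ := Finset.exists_max_image Q
    (fun p => (J.filter (fun x => x.1 = p)).card) hQ
  have hle : J.card ≤ (J.filter (fun x => x.1 = p)).card * Q.card := by
    rw [hcard, mul_comm]
    exact Finset.sum_le_card_nsmul _ _ _ hmax
  set K := (J.filter (fun x => x.1 = p)).image Prod.snd with hK
  have hKc : K.card = (J.filter (fun x => x.1 = p)).card := by
    rw [hK, Finset.card_image_of_injOn]
    rintro ⟨a, k⟩ ha ⟨b, l⟩ hb hkl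
    simp only [Finset.coe_filter, Set.mem_ofPred_eq] at ha hb hkl
    rw [ha.2, hb.2, hkl]
  have hpos : 0 < J.card := hne.card_pos
  have hKne : K.Nonempty := by
    rw [← Finset.card_pos, hKc]
    by_contra h0
    simp only [not_lt, Nat.le_zero] at h0
    rw [h0] at hle
    omega
  obtain ⟨k, hk, hS⟩ := h p hp K hKne
  rw [hKc] at hS
  refine hle.trans (hS.trans (Finset.card_le_card ?_))
  rw [hK] at hk
  simp only [Finset.mem_image, Finset.mem_filter] at hk
  obtain ⟨⟨a, l⟩, ⟨haJ, hap⟩, hal⟩ := hk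
  simp only at hap hal
  subst hap hal
  exact Finset.subset_biUnion_of_mem S haJ

/-! ### Matchings, covers and conflict-free matchings -/

/-- The pairs `p` and `q` share no entry. -/
def Sep (p q : V × V) : Prop := p.1 ≠ q.1 ∧ p.1 ≠ q.2 ∧ p.2 ≠ q.1 ∧ p.2 ≠ q.2

theorem Sep.symm {V : Type*} {p q : V × V} (h : Sep p q) : Sep q p :=
  ⟨h.1.symm, h.2.2.1.symm, h.2.1.symm, h.2.2.2.symm⟩

/-- Few members of a matching meet a given set. -/
theorem exists_pool_avoiding {Q : Finset (V × V)} (hsep : ∀ p ∈ Q, ∀ q ∈ Q, p ≠ q → Sep p q)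
    {X : Finset V} {r : ℕ} (h : X.card + r ≤ Q.card) :
    ∃ P ⊆ Q, P.card = r ∧ ∀ p ∈ P, p.1 ∉ X ∧ p.2 ∉ X := by
  have h1 : (Q.filter fun p => p.1 ∈ X ∨ p.2 ∈ X).card ≤ X.card := by
    refine Finset.card_le_card_of_injOn (fun p => if p.1 ∈ X then p.1 else p.2) ?_ ?_
    · intro p hp
      have hp' := (Finset.mem_filter.1 hp).2
      simp only
      split_ifs with hX
      · exact hX
      · exact hp'.resolve_left hX
    · intro p hp q hq heq
      have hp' := (Finset.mem_filter.1 hp).1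
      have hq' := (Finset.mem_filter.1 hq).1
      by_contra hne
      obtain ⟨s1, s2, s3, s4⟩ := hsep p hp' q hq' hne
      simp only at heq
      split_ifs at heq
      exacts [s1 heq, s2 heq, s3 heq, s4 heq]
  have h2 := Finset.card_filter_add_card_filter_not (s := Q) (fun p => p.1 ∈ X ∨ p.2 ∈ X)
  obtain ⟨P, hP, hPc⟩ := Finset.exists_subset_card_eq
    (s := Q.filter fun p => ¬ (p.1 ∈ X ∨ p.2 ∈ X)) (n := r) (by omega)
  refine ⟨P, hP.trans (Finset.filter_subset _ _), hPc, fun p hp => ?_⟩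
  have := (Finset.mem_filter.1 (hP hp)).2
  tauto

theorem matching_or_cover (L : V → V → Prop) (m : ℕ) :
    (∃ Q : Finset (V × V), Q.card = m ∧ (∀ p ∈ Q, L p.1 p.2) ∧
      ∀ p ∈ Q, ∀ q ∈ Q, p ≠ q → Sep p q) ∨
    ∃ C : Finset V, C.card ≤ 2 * m ∧ ∀ x y, L x y → x ∈ C ∨ y ∈ C := by
  induction m with
  | zero => exact Or.inl ⟨∅, by simp⟩
  | succ m ih =>
    rcases ih with ⟨Q, hQ, hL, hsep⟩ | ⟨C, hC, hcov⟩
    · by_cases hex : ∃ x y, L x y ∧ x ∉ Q.image Prod.fst ∪ Q.image Prod.snd ∧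
          y ∉ Q.image Prod.fst ∪ Q.image Prod.snd
      · left
        obtain ⟨x, y, hxy, hx, hy⟩ := hex
        have hx1 : ∀ q ∈ Q, x ≠ q.1 ∧ x ≠ q.2 := by
          intro q hq
          constructor <;> rintro rfl <;> apply hx <;> rw [Finset.mem_union]
          · exact Or.inl (Finset.mem_image_of_mem _ hq)
          · exact Or.inr (Finset.mem_image_of_mem _ hq)
        have hy1 : ∀ q ∈ Q, y ≠ q.1 ∧ y ≠ q.2 := by
          intro q hq
          constructor <;> rintro rfl <;> apply hy <;> rw [Finset.mem_union]
          · exact Or.inl (Finset.mem_image_of_mem _ hq)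
          · exact Or.inr (Finset.mem_image_of_mem _ hq)
        refine ⟨insert (x, y) Q, ?_, ?_, ?_⟩
        · rw [Finset.card_insert_of_notMem, hQ]
          intro h
          exact (hx1 _ h).1 rfl
        · intro p hp
          rcases Finset.mem_insert.1 hp with rfl | hp
          exacts [hxy, hL p hp]
        · intro p hp q hq hpq
          rcases Finset.mem_insert.1 hp with rfl | hp <;>
            rcases Finset.mem_insert.1 hq with rfl | hq
          · exact absurd rfl hpq
          · exact ⟨(hx1 q hq).1, (hx1 q hq).2, (hy1 q hq).1, (hy1 q hq).2⟩
          · exact ⟨(hx1 p hp).1.symm, (hy1 p hp).1.symm, (hx1 p hp).2.symm, (hy1 p hp).2.symm⟩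
          · exact hsep p hp q hq hpq
      · right
        refine ⟨Q.image Prod.fst ∪ Q.image Prod.snd, ?_, ?_⟩
        · have h1 := Finset.card_union_le (Q.image Prod.fst) (Q.image Prod.snd)
          have h2 : (Q.image Prod.fst).card ≤ Q.card := Finset.card_image_le
          have h3 : (Q.image Prod.snd).card ≤ Q.card := Finset.card_image_le
          omega
        · intro x y hxy
          by_contra hcon
          rw [not_or] at hcon
          exact hex ⟨x, y, hxy, hcon⟩
    · exact Or.inr ⟨C, by omega, hcov⟩

theorem exists_independent {ι : Type*} [DecidableEq ι] (R : ι → ι → Prop) (b r : ℕ)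
    (s : Finset ι) (hs : r * (2 * b + 1) ≤ s.card)
    (hb : ∀ i ∈ s, ∃ N : Finset ι, N.card ≤ b ∧ ∀ j ∈ s, j ≠ i → R i j → j ∈ N) :
    ∃ I ⊆ s, I.card = r ∧ ∀ i ∈ I, ∀ j ∈ I, i ≠ j → ¬ R i j := by
  classical
  induction r generalizing s with
  | zero => exact ⟨∅, by simp⟩
  | succ r ih =>
    have hspos : 0 < s.card := by
      have : 0 < (r + 1) * (2 * b + 1) := by positivity
      omega
    have hb' : ∀ i ∈ s, (s.filter (fun j => j ≠ i ∧ R i j)).card ≤ b := by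
      intro i hi
      obtain ⟨N, hN, hsub⟩ := hb i hi
      refine (Finset.card_le_card ?_).trans hN
      intro j hj
      rw [Finset.mem_filter] at hj
      exact hsub j hj.1 hj.2.1 hj.2.2
    have hdc : ∑ i ∈ s, (s.filter (fun j => i ≠ j ∧ R j i)).card =
        ∑ i ∈ s, (s.filter (fun j => j ≠ i ∧ R i j)).card := by
      simp only [Finset.card_filter]
      exact Finset.sum_comm
    obtain ⟨i, hi, hin⟩ : ∃ i ∈ s, (s.filter (fun j => i ≠ j ∧ R j i)).card ≤ b := by
      by_contra hcon
      push Not at hcon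
      have h1 : ∑ i ∈ s, (s.filter (fun j => j ≠ i ∧ R i j)).card ≤ s.card * b :=
        Finset.sum_le_card_nsmul _ _ _ hb'
      have h2 : s.card * (b + 1) ≤ ∑ i ∈ s, (s.filter (fun j => i ≠ j ∧ R j i)).card := by
        rw [← smul_eq_mul]
        exact Finset.card_nsmul_le_sum _ _ _ (fun i hi => hcon i hi)
      rw [hdc] at h2
      nlinarith
    set D := insert i (s.filter (fun j => i ≠ j ∧ R j i) ∪
      s.filter (fun j => j ≠ i ∧ R i j)) with hD
    have hDc : D.card ≤ 2 * b + 1 := by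
      have h1 := Finset.card_insert_le i (s.filter (fun j => i ≠ j ∧ R j i) ∪
        s.filter (fun j => j ≠ i ∧ R i j))
      have h2 := Finset.card_union_le (s.filter (fun j => i ≠ j ∧ R j i))
        (s.filter (fun j => j ≠ i ∧ R i j))
      have h3 := hb' i hi
      rw [← hD] at h1
      omega
    obtain ⟨I, hI, hIc, hind⟩ := ih (s \ D) (by
      have := Finset.le_card_sdiff D s
      have e : (r + 1) * (2 * b + 1) = r * (2 * b + 1) + (2 * b + 1) := by ring
      omega) (by
      intro j hj
      obtain ⟨N, hN, hsub⟩ := hb j (Finset.mem_sdiff.1 hj).1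
      exact ⟨N, hN, fun k hk => hsub k (Finset.mem_sdiff.1 hk).1⟩)
    have hiI : i ∉ I := by
      intro h
      have := (Finset.mem_sdiff.1 (hI h)).2
      exact this (Finset.mem_insert_self _ _)
    refine ⟨insert i I, ?_, by rw [Finset.card_insert_of_notMem hiI, hIc], ?_⟩
    · intro j hj
      rcases Finset.mem_insert.1 hj with rfl | hj
      exacts [hi, (Finset.mem_sdiff.1 (hI hj)).1]
    · have hout : ∀ j ∈ I, ¬ R i j ∧ ¬ R j i := by
        intro j hj
        have hjs := Finset.mem_sdiff.1 (hI hj)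
        have hne : j ≠ i := by rintro rfl; exact hiI hj
        refine ⟨fun h => hjs.2 ?_, fun h => hjs.2 ?_⟩ <;>
          simp [hD, hjs.1, hne, h, hne.symm]
      intro a ha c hc hac
      rcases Finset.mem_insert.1 ha with rfl | ha' <;>
        rcases Finset.mem_insert.1 hc with rfl | hc'
      · exact absurd rfl hac
      · exact (hout c hc').1
      · exact (hout a ha').2
      · exact hind a ha' c hc' hac

/-- A relation with no conflict-free matching of size `r` has a small vertex cover. -/
theorem exists_pool_or_cover (L : V → V → Prop) (W : V × V → Finset V) (b r : ℕ)
    (hW : ∀ x y, L x y → (W (x, y)).card ≤ b) :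
    (∃ Q : Finset (V × V), Q.card = r ∧ (∀ p ∈ Q, L p.1 p.2) ∧
      (∀ p ∈ Q, ∀ q ∈ Q, p ≠ q → Sep p q) ∧
      ∀ p ∈ Q, ∀ q ∈ Q, p ≠ q → q.1 ∉ W p ∧ q.2 ∉ W p) ∨
    ∃ C : Finset V, C.card ≤ 2 * (r * (2 * b + 1)) ∧ ∀ x y, L x y → x ∈ C ∨ y ∈ C := by
  classical
  rcases matching_or_cover L (r * (2 * b + 1)) with ⟨Q, hQ, hL, hsep⟩ | h
  · left
    obtain ⟨I, hI, hIc, hind⟩ := exists_independent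
      (fun p q : V × V => q.1 ∈ W p ∨ q.2 ∈ W p) b r Q hQ.ge (by
        intro p hp
        have hch : ∀ v : V, ∃ q : V × V, ∀ q' ∈ Q, (q'.1 = v ∨ q'.2 = v) → q' = q := by
          intro v
          by_cases hv : ∃ q ∈ Q, q.1 = v ∨ q.2 = v
          · obtain ⟨q, hq, hqv⟩ := hv
            refine ⟨q, fun q' hq' hv' => ?_⟩
            by_contra hne
            obtain ⟨h1, h2, h3, h4⟩ := hsep q' hq' q hq hne
            rcases hqv with rfl | rfl <;> rcases hv' with h | h <;> contradiction
          · refine ⟨p, fun q' hq' hv' => absurd ⟨q', hq', hv'⟩ hv⟩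
        choose g hg using hch
        refine ⟨(W p).image g, Finset.card_image_le.trans (hW _ _ (hL p hp)), ?_⟩
        rintro q hq - (h | h)
        · rw [hg _ q hq (Or.inl rfl)]
          exact Finset.mem_image_of_mem _ h
        · rw [hg _ q hq (Or.inr rfl)]
          exact Finset.mem_image_of_mem _ h)
    refine ⟨I, hIc, fun p hp => hL p (hI hp), fun p hp q hq => hsep p (hI hp) q (hI hq), ?_⟩
    intro p hp q hq hpq
    exact not_or.1 (hind p hp q hq hpq)
  · exact Or.inr h

end Selection

/-! ### Codegrees and embeddings of expanded fans -/

section Embedding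

variable {V : Type*} [DecidableEq V]

/-- The triple `{x, y, z}` is a hyperedge. -/
def Tri (H : Finset (Finset V)) (x y z : V) : Prop := ({x, y, z} : Finset V) ∈ H

variable {H : Finset (Finset V)}

theorem Tri.swap {x y z : V} (h : Tri H x y z) : Tri H y x z := by
  unfold Tri at *
  rwa [Finset.insert_comm]

theorem Tri.swap' {x y z : V} (h : Tri H x y z) : Tri H x z y := by
  unfold Tri at *
  rwa [Finset.pair_comm]

theorem Tri.ne (h3 : ∀ e ∈ H, e.card = 3) {x y z : V} (h : Tri H x y z) :
    x ≠ y ∧ x ≠ z ∧ y ≠ z := by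
  have hc := h3 _ h
  refine ⟨?_, ?_, ?_⟩ <;> rintro rfl
  · have := Finset.card_le_two (a := x) (b := z)
    simp at hc
    omega
  · rw [Finset.insert_comm] at hc
    have := Finset.card_le_two (a := y) (b := x)
    simp at hc
    omega
  · have := Finset.card_le_two (a := x) (b := y)
    simp at hc
    omega

variable [Fintype V]

/-- The common neighbourhood of a pair. -/
def nb (H : Finset (Finset V)) (x y : V) : Finset V :=
  Finset.univ.filter (fun z => ({x, y, z} : Finset V) ∈ H)

theorem mem_nb {x y z : V} : z ∈ nb H x y ↔ Tri H x y z := by simp [nb, Tri]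

theorem nb_comm (x y : V) : nb H x y = nb H y x := by
  ext z
  simp only [mem_nb]
  exact ⟨Tri.swap, Tri.swap⟩

/-- The possible expansion vertices of the three pairs of the triangle `u, p.1, p.2`. -/
def link (H : Finset (Finset V)) (u : V) (p : V × V) (k : Fin 3) : Finset V :=
  ![nb H u p.1, nb H u p.2, nb H p.1 p.2] k

/-- As `link`, with the third vertex of the triangle removed. -/
def slot (H : Finset (Finset V)) (u : V) (p : V × V) (k : Fin 3) : Finset V :=
  (link H u p k).erase (![p.2, p.1, u] k)

theorem card_slot {u : V} {p : V × V} (h : Tri H u p.1 p.2) (k : Fin 3) :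
    (slot H u p k).card + 1 = (link H u p k).card := by
  refine Finset.card_erase_add_one ?_
  fin_cases k
  · exact mem_nb.2 h
  · exact mem_nb.2 h.swap'
  · exact mem_nb.2 h.swap.swap'

theorem card_slot_ge (u : V) (p : V × V) (k : Fin 3) :
    (link H u p k).card ≤ (slot H u p k).card + 1 :=
  (Nat.sub_le_iff_le_add).1 Finset.pred_card_le_card_erase

theorem fan_of_rep (h3 : ∀ e ∈ H, e.card = 3) {t : ℕ} {u : V} {Q : Finset (V × V)}
    (hQ : Q.card = t) (hsep : ∀ p ∈ Q, ∀ q ∈ Q, p ≠ q → Sep p q) {f : (V × V) × Fin 3 → V}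
    (hinj : Set.InjOn f (Q ×ˢ (Finset.univ : Finset (Fin 3)) : Finset ((V × V) × Fin 3)))
    (hmem : ∀ p ∈ Q, ∀ k, f (p, k) ∈ slot H u p k)
    (hav : ∀ p ∈ Q, ∀ q ∈ Q, p ≠ q → ∀ k, f (p, k) ≠ q.1 ∧ f (p, k) ≠ q.2) :
    ContainsFanExp t H := by
  have h0 : ∀ p ∈ Q, f (p, 0) ≠ p.2 ∧ Tri H u p.1 (f (p, 0)) := fun p hp => by
    simpa [slot, link, mem_nb] using hmem p hp 0
  have h1 : ∀ p ∈ Q, f (p, 1) ≠ p.1 ∧ Tri H u p.2 (f (p, 1)) := fun p hp => by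
    simpa [slot, link, mem_nb] using hmem p hp 1
  have h2 : ∀ p ∈ Q, f (p, 2) ≠ u ∧ Tri H p.1 p.2 (f (p, 2)) := fun p hp => by
    simpa [slot, link, mem_nb] using hmem p hp 2
  have hu : ∀ p ∈ Q, u ≠ p.1 ∧ u ≠ p.2 := fun p hp =>
    ⟨((h0 p hp).2.ne h3).1, ((h1 p hp).2.ne h3).1⟩
  have hpp : ∀ p ∈ Q, ∀ q ∈ Q, p.1 ≠ q.2 := by
    intro p hp q hq
    by_cases h : p = q
    · subst h
      exact ((h2 p hp).2.ne h3).1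
    · exact (hsep p hp q hq h).2.1
  have h11 : ∀ p ∈ Q, ∀ q ∈ Q, p.1 = q.1 → p = q := fun p hp q hq h => by
    by_contra hne
    exact (hsep p hp q hq hne).1 h
  have h22 : ∀ p ∈ Q, ∀ q ∈ Q, p.2 = q.2 → p = q := fun p hp q hq h => by
    by_contra hne
    exact (hsep p hp q hq hne).2.2.2 h
  have hfu : ∀ p ∈ Q, ∀ k, u ≠ f (p, k) := by
    intro p hp k
    fin_cases k
    · exact ((h0 p hp).2.ne h3).2.1
    · exact ((h1 p hp).2.ne h3).2.1
    · exact (h2 p hp).1.symm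
  have hfv : ∀ p ∈ Q, ∀ q ∈ Q, ∀ k, f (p, k) ≠ q.1 ∧ f (p, k) ≠ q.2 := by
    intro p hp q hq k
    by_cases h : p = q
    · subst h
      fin_cases k
      · exact ⟨((h0 p hp).2.ne h3).2.2.symm, (h0 p hp).1⟩
      · exact ⟨(h1 p hp).1, ((h1 p hp).2.ne h3).2.2.symm⟩
      · exact ⟨((h2 p hp).2.ne h3).2.1.symm, ((h2 p hp).2.ne h3).2.2.symm⟩
    · exact hav p hp q hq h k
  have hff : ∀ p ∈ Q, ∀ q ∈ Q, ∀ k l, f (p, k) = f (q, l) → p = q ∧ k = l := by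
    intro p hp q hq k l h
    have := hinj (by simpa using hp) (by simpa using hq) h
    simpa using this
  let e : Fin t ≃ Q := (Q.equivFinOfCardEq hQ).symm
  let g : Fin 5 × Fin t → V := fun i =>
    ![(e i.2).1.1, (e i.2).1.2, f ((e i.2).1, 0), f ((e i.2).1, 1), f ((e i.2).1, 2)] i.1
  have heq : ∀ i j : Fin t, (e i).1 = (e j).1 → i = j := fun i j h =>
    e.injective (Subtype.ext h)
  have hg : Function.Injective g := by
    rintro ⟨a, i⟩ ⟨b, j⟩ h
    have hi := (e i).2
    have hj := (e j).2
    fin_cases a <;> fin_cases b <;> simp only [g] at h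
    · rw [heq i j (h11 _ hi _ hj h)]
    · exact absurd h (hpp _ hi _ hj)
    · exact absurd h.symm (hfv _ hj _ hi 0).1
    · exact absurd h.symm (hfv _ hj _ hi 1).1
    · exact absurd h.symm (hfv _ hj _ hi 2).1
    · exact absurd h.symm (hpp _ hj _ hi)
    · rw [heq i j (h22 _ hi _ hj h)]
    · exact absurd h.symm (hfv _ hj _ hi 0).2
    · exact absurd h.symm (hfv _ hj _ hi 1).2
    · exact absurd h.symm (hfv _ hj _ hi 2).2
    · exact absurd h (hfv _ hi _ hj 0).1
    · exact absurd h (hfv _ hi _ hj 0).2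
    · rw [heq i j (hff _ hi _ hj 0 0 h).1]
    · exact absurd (hff _ hi _ hj 0 1 h).2 (by decide)
    · exact absurd (hff _ hi _ hj 0 2 h).2 (by decide)
    · exact absurd h (hfv _ hi _ hj 1).1
    · exact absurd h (hfv _ hi _ hj 1).2
    · exact absurd (hff _ hi _ hj 1 0 h).2 (by decide)
    · rw [heq i j (hff _ hi _ hj 1 1 h).1]
    · exact absurd (hff _ hi _ hj 1 2 h).2 (by decide)
    · exact absurd h (hfv _ hi _ hj 2).1
    · exact absurd h (hfv _ hi _ hj 2).2
    · exact absurd (hff _ hi _ hj 2 0 h).2 (by decide)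
    · exact absurd (hff _ hi _ hj 2 1 h).2 (by decide)
    · rw [heq i j (hff _ hi _ hj 2 2 h).1]
  refine ⟨Sum.elim (fun _ => u) g, ?_, ?_⟩
  · refine Function.Injective.sumElim (fun _ _ _ => rfl) hg ?_
    rintro - ⟨a, i⟩
    have hi := (e i).2
    fin_cases a
    · exact (hu _ hi).1
    · exact (hu _ hi).2
    · exact hfu _ hi 0
    · exact hfu _ hi 1
    · exact hfu _ hi 2
  · intro i
    have hi := (e i).2
    exact ⟨(h0 _ hi).2, (h1 _ hi).2, (h2 _ hi).2⟩

/-- It suffices to choose the expansion vertices of some of the three types: the other ones can be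
chosen greedily when the codegrees are large. -/
theorem fan_of_partial_rep (h3 : ∀ e ∈ H, e.card = 3) {t : ℕ} {u : V} {Q : Finset (V × V)}
    (hQ : Q.card = t) (hsep : ∀ p ∈ Q, ∀ q ∈ Q, p ≠ q → Sep p q) (K : Finset (Fin 3))
    {f : (V × V) × Fin 3 → V}
    (hinj : Set.InjOn f (Q ×ˢ K : Finset ((V × V) × Fin 3)))
    (hmem : ∀ p ∈ Q, ∀ k ∈ K, f (p, k) ∈ slot H u p k)
    (hav : ∀ p ∈ Q, ∀ q ∈ Q, p ≠ q → ∀ k ∈ K, f (p, k) ≠ q.1 ∧ f (p, k) ≠ q.2)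
    (hbig : ∀ p ∈ Q, ∀ k ∉ K, 5 * t + 1 ≤ (link H u p k).card) :
    ContainsFanExp t H := by
  have : Nonempty V := ⟨u⟩
  set X : Finset V := (Q.image Prod.fst ∪ Q.image Prod.snd) ∪ (Q ×ˢ K).image f with hX
  have hXc : X.card ≤ 2 * t + t * K.card := by
    have h1 := Finset.card_union_le (Q.image Prod.fst ∪ Q.image Prod.snd) ((Q ×ˢ K).image f)
    have h2 := Finset.card_union_le (Q.image Prod.fst) (Q.image Prod.snd)
    have h4 : (Q.image Prod.fst).card ≤ Q.card := Finset.card_image_le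
    have h5 : (Q.image Prod.snd).card ≤ Q.card := Finset.card_image_le
    have h6 : ((Q ×ˢ K).image f).card ≤ (Q ×ˢ K).card := Finset.card_image_le
    rw [← hX] at h1
    rw [Finset.card_product, hQ] at h6
    omega
  have hKK : K.card + Kᶜ.card = 3 := by simp
  have hIc : (Q ×ˢ Kᶜ).card = t * Kᶜ.card := by rw [Finset.card_product, hQ]
  obtain ⟨g, hg, hginj⟩ := greedy (Q ×ˢ Kᶜ) (fun i => slot H u i.1 i.2) X (by
    rintro ⟨p, k⟩ hi
    simp only [Finset.mem_product, Finset.mem_compl] at hi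
    have h1 := hbig p hi.1 k hi.2
    have h2 := card_slot_ge (H := H) u p k
    have h4 : t * K.card + t * Kᶜ.card = 3 * t := by rw [← mul_add, hKK, mul_comm]
    rw [hIc]
    simp only
    omega)
  have hgm : ∀ p ∈ Q, ∀ k ∉ K, g (p, k) ∈ slot H u p k ∧ g (p, k) ∉ X := fun p hp k hk =>
    hg (p, k) (by simp [hp, hk])
  refine fan_of_rep h3 (u := u) hQ hsep (f := fun i => if i.2 ∈ K then f i else g i) ?_ ?_ ?_
  · rintro ⟨p, k⟩ hp ⟨q, l⟩ hq h
    have hp' : p ∈ Q := by simpa using hp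
    have hq' : q ∈ Q := by simpa using hq
    have hfX : ∀ p ∈ Q, ∀ k ∈ K, f (p, k) ∈ X := fun p hp k hk => by
      rw [hX, Finset.mem_union]
      exact Or.inr (Finset.mem_image_of_mem _ (by simp [hp, hk]))
    by_cases hk : k ∈ K <;> by_cases hl : l ∈ K <;> simp only [hk, hl, if_true, if_false] at h
    · exact hinj (by simp [hp', hk]) (by simp [hq', hl]) h
    · exact absurd (h ▸ hfX p hp' k hk) (hgm q hq' l hl).2
    · exact absurd (h ▸ hfX q hq' l hl) (hgm p hp' k hk).2
    · exact hginj (by simp [hp', hk]) (by simp [hq', hl]) h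
  · intro p hp k
    by_cases hk : k ∈ K
    · simpa [hk] using hmem p hp k hk
    · simp [hk, (hgm p hp k hk).1]
  · intro p hp q hq hpq k
    by_cases hk : k ∈ K
    · simpa [hk] using hav p hp q hq hpq k hk
    · simp only [hk, if_false]
      have hn := (hgm p hp k hk).2
      rw [hX, Finset.mem_union, Finset.mem_union, not_or, not_or] at hn
      refine ⟨fun h => hn.1.1 ?_, fun h => hn.1.2 ?_⟩ <;> rw [h]
      exacts [Finset.mem_image_of_mem _ hq, Finset.mem_image_of_mem _ hq]

end Embedding

/-! ### Counting ordered pairs and triples -/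

section Counting

variable {V : Type*} [Fintype V]

open Classical in
/-- The number of ordered pairs satisfying `P`. -/
noncomputable def cnt2 (P : V → V → Prop) : ℕ :=
  (Finset.univ.filter fun q : V × V => P q.1 q.2).card

open Classical in
/-- The number of ordered triples satisfying `P`. -/
noncomputable def cnt3 (P : V → V → V → Prop) : ℕ :=
  (Finset.univ.filter fun q : V × V × V => P q.1 q.2.1 q.2.2).card

theorem cnt2_mono {P Q : V → V → Prop} (h : ∀ x y, P x y → Q x y) : cnt2 P ≤ cnt2 Q :=
  Finset.card_le_card fun q => by simpa using h q.1 q.2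

theorem cnt3_mono {P Q : V → V → V → Prop} (h : ∀ x y z, P x y z → Q x y z) :
    cnt3 P ≤ cnt3 Q :=
  Finset.card_le_card fun q => by simpa using h q.1 q.2.1 q.2.2

theorem cnt2_or (P Q : V → V → Prop) :
    cnt2 (fun x y => P x y ∨ Q x y) ≤ cnt2 P + cnt2 Q := by
  classical
  refine le_trans (Finset.card_le_card fun q hq => ?_) (Finset.card_union_le _ _)
  simpa using hq

theorem cnt3_or (P Q : V → V → V → Prop) :
    cnt3 (fun x y z => P x y z ∨ Q x y z) ≤ cnt3 P + cnt3 Q := by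
  classical
  refine le_trans (Finset.card_le_card fun q hq => ?_) (Finset.card_union_le _ _)
  simpa using hq

theorem cnt2_swap (P : V → V → Prop) : cnt2 (fun x y => P y x) = cnt2 P := by
  classical
  refine Finset.card_bij (fun q _ => (q.2, q.1)) ?_ ?_ ?_
  · simp
  · rintro ⟨a, b⟩ _ ⟨c, d⟩ _ h
    simpa [and_comm] using h
  · rintro ⟨a, b⟩ h
    exact ⟨(b, a), by simpa using h, rfl⟩

theorem cnt3_swap (P : V → V → V → Prop) : cnt3 (fun x y z => P y x z) = cnt3 P := by
  classical
  refine Finset.card_bij (fun q _ => (q.2.1, q.1, q.2.2)) ?_ ?_ ?_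
  · simp
  · rintro ⟨a, b, e⟩ _ ⟨c, d, f⟩ _ h
    simp only [Prod.mk.injEq] at h ⊢
    tauto
  · rintro ⟨a, b, c⟩ h
    exact ⟨(b, a, c), by simpa using h, rfl⟩

theorem cnt3_swap' (P : V → V → V → Prop) : cnt3 (fun x y z => P x z y) = cnt3 P := by
  classical
  refine Finset.card_bij (fun q _ => (q.1, q.2.2, q.2.1)) ?_ ?_ ?_
  · simp
  · rintro ⟨a, b, e⟩ _ ⟨c, d, f⟩ _ h
    simp only [Prod.mk.injEq] at h ⊢
    tauto
  · rintro ⟨a, b, c⟩ h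
    exact ⟨(a, c, b), by simpa using h, rfl⟩

theorem cnt2_eq_sum (P : V → V → Prop) [∀ x, DecidablePred (P x)] :
    cnt2 P = ∑ x, (Finset.univ.filter (P x)).card := by
  classical
  unfold cnt2
  simp_rw [Finset.card_filter]
  rw [Fintype.sum_prod_type]
  refine Finset.sum_congr rfl fun x _ => Finset.sum_congr rfl fun y _ => ?_
  congr

theorem cnt3_eq_sum (P : V → V → V → Prop) : cnt3 P = ∑ x, cnt2 (P x) := by
  classical
  unfold cnt3 cnt2
  simp_rw [Finset.card_filter]
  rw [Fintype.sum_prod_type]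

theorem cnt3_eq_sum_pairs (P : V → V → V → Prop) [∀ x y, DecidablePred (P x y)] :
    cnt3 P = ∑ x, ∑ y, (Finset.univ.filter (P x y)).card := by
  rw [cnt3_eq_sum]
  exact Finset.sum_congr rfl fun x _ => cnt2_eq_sum _

theorem cnt3_mem_le (A : V → Finset V) (B : V → V → Finset V) {a b : ℕ}
    (hA : ∀ x, (A x).card ≤ a) (hB : ∀ x y, (B x y).card ≤ b) :
    cnt3 (fun x y z => y ∈ A x ∧ z ∈ B x y) ≤ Fintype.card V * (a * b) := by
  classical
  rw [cnt3_eq_sum_pairs]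
  refine (Finset.sum_le_card_nsmul _ _ (a * b) fun x _ => ?_).trans (by simp)
  calc ∑ y, (Finset.univ.filter fun z => y ∈ A x ∧ z ∈ B x y).card
      ≤ ∑ y, if y ∈ A x then b else 0 := by
        refine Finset.sum_le_sum fun y _ => ?_
        split_ifs with h
        · simpa [h] using hB x y
        · simp [h]
    _ ≤ a * b := by
        rw [← Finset.sum_filter, Finset.sum_const, smul_eq_mul]
        exact Nat.mul_le_mul_right _ (by simpa using hA x)

open Classical in
theorem cnt3_cast (P : V → V → V → Prop) :
    (cnt3 P : ℝ) = ∑ x : V, ∑ y : V, ∑ z : V, (if P x y z then (1 : ℝ) else 0) := by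
  rw [cnt3_eq_sum_pairs]
  push_cast
  refine Finset.sum_congr rfl fun x _ => Finset.sum_congr rfl fun y _ => ?_
  simp

theorem cnt2_exists_le (P : V → V → V → Prop) :
    cnt2 (fun x y => ∃ z, P x y z) ≤ cnt3 P := by
  classical
  rw [cnt2_eq_sum, cnt3_eq_sum_pairs]
  refine Finset.sum_le_sum fun x _ => ?_
  rw [Finset.card_filter]
  refine Finset.sum_le_sum fun y _ => ?_
  split_ifs with h
  · obtain ⟨z, hz⟩ := h
    exact Finset.card_pos.2 ⟨z, by simpa using hz⟩
  · exact Nat.zero_le _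

theorem cnt2_not_add (P : V → V → Prop) :
    cnt2 P + cnt2 (fun x y => ¬ P x y) = Fintype.card V * Fintype.card V := by
  classical
  unfold cnt2
  rw [← Fintype.card_prod, ← Finset.card_univ]
  convert Finset.card_filter_add_card_filter_not (s := (Finset.univ : Finset (V × V)))
    (fun q : V × V => P q.1 q.2)

/-- If the links of a symmetric ternary relation have bounded covers, it has linearly many
triples. -/
theorem cnt3_le_of_cover {E : V → V → V → Prop} (hs : ∀ x y z, E x y z → E y x z)
    (hs' : ∀ x y z, E x y z → E x z y) {c : ℕ}
    (hc : ∀ x, ∃ C : Finset V, C.card ≤ c ∧ ∀ y z, E x y z → y ∈ C ∨ z ∈ C) :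
    cnt3 E ≤ 6 * (c * c) * Fintype.card V := by
  choose C hCc hC using hc
  set G : V → V → V → Prop := fun x y z => y ∈ C x ∧ z ∈ C y with hG
  have hGc : cnt3 G ≤ Fintype.card V * (c * c) := cnt3_mem_le C (fun _ y => C y) hCc fun _ => hCc
  have h1 : cnt3 E ≤ cnt3 (fun x y z => G x y z ∨ G x z y ∨ G y x z ∨ G y z x ∨ G z x y ∨
      G z y x) := by
    refine cnt3_mono fun x y z h => ?_
    have e1 := hC x y z h
    have e2 := hC y x z (hs _ _ _ h)
    have e3 := hC z x y (hs _ _ _ (hs' _ _ _ h))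
    simp only [hG]
    tauto
  have e2 : cnt3 (fun x y z => G x z y) = cnt3 G := cnt3_swap' G
  have e3 : cnt3 (fun x y z => G y x z) = cnt3 G := cnt3_swap G
  have e4 : cnt3 (fun x y z => G y z x) = cnt3 G :=
    (cnt3_swap (fun x y z => G x z y)).trans e2
  have e5 : cnt3 (fun x y z => G z x y) = cnt3 G :=
    (cnt3_swap' (fun x y z => G y x z)).trans e3
  have e6 : cnt3 (fun x y z => G z y x) = cnt3 G :=
    (cnt3_swap (fun x y z => G z x y)).trans e5
  have a1 := cnt3_or G (fun x y z => G x z y ∨ G y x z ∨ G y z x ∨ G z x y ∨ G z y x)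
  have a2 := cnt3_or (fun x y z => G x z y) (fun x y z => G y x z ∨ G y z x ∨ G z x y ∨ G z y x)
  have a3 := cnt3_or (fun x y z => G y x z) (fun x y z => G y z x ∨ G z x y ∨ G z y x)
  have a4 := cnt3_or (fun x y z => G y z x) (fun x y z => G z x y ∨ G z y x)
  have a5 := cnt3_or (fun x y z => G z x y) (fun x y z => G z y x)
  have : 6 * (c * c) * Fintype.card V = 6 * (Fintype.card V * (c * c)) := by ring
  omega

variable [DecidableEq V] {H : Finset (Finset V)}

/-- As `cnt3_le_of_cover`, for relations whose codegrees at the centre are bounded. -/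
theorem cnt3_le_of_centre_cover {R : V → V → V → Prop} {c K : ℕ}
    (hR : ∀ x y z, R x y z → Tri H x y z ∧ (nb H x y).card ≤ K ∧ (nb H x z).card ≤ K)
    (hc : ∀ x, ∃ C : Finset V, C.card ≤ c ∧ ∀ y z, R x y z → y ∈ C ∨ z ∈ C) :
    cnt3 R ≤ 2 * (c * K) * Fintype.card V := by
  choose C hCc hC using hc
  set B : V → V → Finset V := fun x y => if (nb H x y).card ≤ K then nb H x y else ∅ with hB
  have hBc : ∀ x y, (B x y).card ≤ K := fun x y => by
    simp only [hB]
    split_ifs with h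
    · exact h
    · simp
  set G : V → V → V → Prop := fun x y z => y ∈ C x ∧ z ∈ B x y with hG
  have hGc : cnt3 G ≤ Fintype.card V * (c * K) := cnt3_mem_le C B hCc hBc
  have h1 : cnt3 R ≤ cnt3 (fun x y z => G x y z ∨ G x z y) := by
    refine cnt3_mono fun x y z h => ?_
    obtain ⟨h2, h3, h4⟩ := hR x y z h
    rcases hC x y z h with e | e
    · exact Or.inl ⟨e, by simpa [hB, h3, mem_nb] using h2⟩
    · exact Or.inr ⟨e, by simpa [hB, h4, mem_nb] using h2.swap'⟩
  have e2 : cnt3 (fun x y z => G x z y) = cnt3 G := cnt3_swap' G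
  have a1 := cnt3_or G (fun x y z => G x z y)
  have : 2 * (c * K) * Fintype.card V = 2 * (Fintype.card V * (c * K)) := by ring
  omega

theorem cnt3_le_charge {R Q : V → V → V → Prop} {K : ℕ}
    (hR : ∀ x y z, R x y z → Tri H x y z ∧ (nb H x y).card ≤ K ∧ ∃ w, Q x y w) :
    cnt3 R ≤ K * cnt3 Q := by
  classical
  rw [cnt3_eq_sum_pairs, cnt3_eq_sum_pairs, Finset.mul_sum]
  refine Finset.sum_le_sum fun x _ => ?_
  rw [Finset.mul_sum]
  refine Finset.sum_le_sum fun y _ => ?_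
  rcases (Finset.univ.filter (R x y)).eq_empty_or_nonempty with h | ⟨z, hz⟩
  · simp [h]
  · obtain ⟨h1, h2, w, hw⟩ := hR x y z (by simpa using hz)
    have h3 : 0 < (Finset.univ.filter (Q x y)).card := Finset.card_pos.2 ⟨w, by simpa using hw⟩
    have h4 : (Finset.univ.filter (R x y)).card ≤ (nb H x y).card :=
      Finset.card_le_card fun v hv => mem_nb.2 (hR x y v (by simpa using hv)).1
    calc (Finset.univ.filter (R x y)).card ≤ K := h4.trans h2
      _ = K * 1 := (mul_one _).symm
      _ ≤ _ := Nat.mul_le_mul_left _ h3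

/-- Each hyperedge gives six ordered triples. -/
theorem six_mul_card_le (h3 : ∀ e ∈ H, e.card = 3) : 6 * H.card ≤ cnt3 (Tri H) := by
  classical
  unfold cnt3
  have hm : ∀ q ∈ Finset.univ.filter (fun q : V × V × V => Tri H q.1 q.2.1 q.2.2),
      ({q.1, q.2.1, q.2.2} : Finset V) ∈ H := fun q hq => (Finset.mem_filter.1 hq).2
  rw [Finset.card_eq_sum_card_fiberwise hm, mul_comm, ← smul_eq_mul]
  refine Finset.card_nsmul_le_sum _ _ _ fun e he => ?_
  obtain ⟨x, y, z, hxy, hxz, hyz, rfl⟩ := Finset.card_eq_three.1 (h3 e he)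
  have h6 : ({(x, y, z), (x, z, y), (y, x, z), (y, z, x), (z, x, y), (z, y, x)} :
      Finset (V × V × V)).card = 6 := by
    simp [hxy, hxz, hyz, hxy.symm, hxz.symm, hyz.symm]
  rw [← h6]
  have hT : Tri H x y z := he
  have e1 : ({x, z, y} : Finset V) = {x, y, z} := by rw [Finset.pair_comm]
  have e2 : ({y, x, z} : Finset V) = {x, y, z} := Finset.insert_comm _ _ _
  have e3 : ({y, z, x} : Finset V) = {x, y, z} := by rw [Finset.pair_comm z x, e2]
  have e4 : ({z, x, y} : Finset V) = {x, y, z} := by rw [Finset.insert_comm, e1]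
  have e5 : ({z, y, x} : Finset V) = {x, y, z} := by rw [Finset.pair_comm y x, e4]
  refine Finset.card_le_card fun q hq => ?_
  simp only [Finset.mem_insert, Finset.mem_singleton] at hq
  refine Finset.mem_filter.2 ⟨Finset.mem_filter.2 ⟨Finset.mem_univ _, ?_⟩, ?_⟩
  · rcases hq with rfl | rfl | rfl | rfl | rfl | rfl
    exacts [hT, hT.swap', hT.swap, hT.swap.swap', hT.swap'.swap, hT.swap.swap'.swap]
  · rcases hq with rfl | rfl | rfl | rfl | rfl | rfl
    exacts [rfl, e1, e2, e3, e4, e5]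

end Counting

/-! ### Triples with exceptional codegrees -/

section Types

variable {V : Type*} [Fintype V] [DecidableEq V]

/-- The codegree of a pair. -/
def cd (H : Finset (Finset V)) (x y : V) : ℕ := (nb H x y).card

/-- The hyperedges whose codegrees satisfy a Hall-type condition with room to spare. -/
def Rich (t : ℕ) (H : Finset (Finset V)) (x y z : V) : Prop :=
  Tri H x y z ∧ (t < cd H x y ∧ t < cd H x z ∧ t < cd H y z) ∧
    (2 * t < cd H x y ∨ 2 * t < cd H x z) ∧ (2 * t < cd H x y ∨ 2 * t < cd H y z) ∧
    (2 * t < cd H x z ∨ 2 * t < cd H y z) ∧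
    (3 * t < cd H x y ∨ 3 * t < cd H x z ∨ 3 * t < cd H y z)

/-- Codegrees `t, > B, > B`. -/
def Type1 (t B : ℕ) (H : Finset (Finset V)) (x y z : V) : Prop :=
  Tri H x y z ∧ cd H x y = t ∧ B < cd H x z ∧ B < cd H y z

/-- Codegrees `2t, 2t, > B`. -/
def Type2 (t B : ℕ) (H : Finset (Finset V)) (x y z : V) : Prop :=
  Tri H x y z ∧ cd H x y = 2 * t ∧ cd H x z = 2 * t ∧ B < cd H y z

/-- Codegrees `3t, 3t, 3t`. -/
def Type3 (t : ℕ) (H : Finset (Finset V)) (x y z : V) : Prop :=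
  Tri H x y z ∧ cd H x y = 3 * t ∧ cd H x z = 3 * t ∧ cd H y z = 3 * t

/-- Some other extension of the pair `x, y` makes a light pair with `x`. -/
def Priv (B : ℕ) (H : Finset (Finset V)) (x y z : V) : Prop :=
  ∃ w ∈ nb H x y, w ≠ z ∧ cd H x w ≤ B

variable {H : Finset (Finset V)} {t B : ℕ}

theorem cd_comm (x y : V) : cd H x y = cd H y x := by rw [cd, cd, nb_comm]

theorem Rich.swap {x y z : V} (h : Rich t H x y z) : Rich t H y x z := by
  obtain ⟨h1, h2⟩ := h
  refine ⟨h1.swap, ?_⟩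
  rw [cd_comm y x]
  tauto

theorem Rich.swap' {x y z : V} (h : Rich t H x y z) : Rich t H x z y := by
  obtain ⟨h1, h2⟩ := h
  refine ⟨h1.swap', ?_⟩
  rw [cd_comm z y]
  tauto

theorem Rich.exists_link {x y z : V} (h : Rich t H x y z) (K : Finset (Fin 3))
    (hK : K.Nonempty) : ∃ k ∈ K, K.card * t < (link H x (y, z) k).card := by
  have hc : K.card = (if 0 ∈ K then 1 else 0) + (if 1 ∈ K then 1 else 0) +
      (if 2 ∈ K then 1 else 0) := by
    rw [← Fin.sum_univ_three (fun k => if k ∈ K then 1 else 0)]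
    simp
  have e0 : (link H x (y, z) 0).card = cd H x y := rfl
  have e1 : (link H x (y, z) 1).card = cd H x z := rfl
  have e2 : (link H x (y, z) 2).card = cd H y z := rfl
  have hne : 0 < K.card := hK.card_pos
  obtain ⟨-, h1, h2, h3, h4, h5⟩ := h
  by_contra! hcon
  have f0 := hcon 0
  have f1 := hcon 1
  have f2 := hcon 2
  rw [e0] at f0
  rw [e1] at f1
  rw [e2] at f2
  by_cases k0 : 0 ∈ K <;> by_cases k1 : 1 ∈ K <;> by_cases k2 : 2 ∈ K <;>
    simp only [k0, k1, k2, if_true, if_false, true_implies] at hc f0 f1 f2 <;>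
    rw [hc] at f0 f1 f2 hne <;> omega

theorem cnt3_rich_le (h3 : ∀ e ∈ H, e.card = 3) (hF : ¬ ContainsFanExp t H) :
    cnt3 (Rich t H) ≤ 6 * ((2 * (t * (2 * (9 * t) + 1))) * (2 * (t * (2 * (9 * t) + 1)))) *
      Fintype.card V := by
  refine cnt3_le_of_cover (fun _ _ _ h => h.swap) (fun _ _ _ h => h.swap') fun u => ?_
  have hS : ∀ i : (V × V) × Fin 3, ∃ S ⊆ slot H u i.1 i.2,
      S.card = min (3 * t) (slot H u i.1 i.2).card := fun i =>
    Finset.exists_subset_card_eq (min_le_right _ _)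
  choose S hS hSc using hS
  rcases exists_pool_or_cover (Rich t H u) (fun p => S (p, 0) ∪ S (p, 1) ∪ S (p, 2)) (9 * t) t
    (by
      intro x y _
      have a1 := Finset.card_union_le (S ((x, y), 0) ∪ S ((x, y), 1)) (S ((x, y), 2))
      have a2 := Finset.card_union_le (S ((x, y), 0)) (S ((x, y), 1))
      have b0 := hSc ((x, y), 0)
      have b1 := hSc ((x, y), 1)
      have b2 := hSc ((x, y), 2)
      omega) with ⟨Q, hQ, hR, hsep, hav⟩ | h
  · exfalso
    have : Nonempty V := ⟨u⟩
    obtain ⟨f, hf, hinj⟩ := hall_fibres Q S (by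
      intro p hp K hK
      obtain ⟨k, hk, hlt⟩ := (hR p hp).exists_link K hK
      have hlt : K.card * t < (link H u p k).card := hlt
      refine ⟨k, hk, ?_⟩
      have h1 := card_slot_ge (H := H) u p k
      have h2 : K.card ≤ 3 := by simpa using Finset.card_le_univ K
      have h4 := hSc (p, k)
      have h5 : K.card * t ≤ 3 * t := Nat.mul_le_mul_right _ h2
      rw [hQ, h4]
      simp only at *
      omega)
    have hf' : ∀ p ∈ Q, ∀ k, f (p, k) ∈ S (p, k) := fun p hp k =>
      hf (p, k) (Finset.mem_product.2 ⟨hp, Finset.mem_univ _⟩)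
    have hm : ∀ p ∈ Q, ∀ k, f (p, k) ∈ slot H u p k := fun p hp k => hS (p, k) (hf' p hp k)
    refine hF (fan_of_rep h3 hQ hsep hinj hm ?_)
    intro p hp q hq hpq k
    have hk : f (p, k) ∈ S (p, 0) ∪ S (p, 1) ∪ S (p, 2) := by
      have := hf' p hp k
      simp only [Finset.mem_union]
      fin_cases k
      exacts [Or.inl (Or.inl this), Or.inl (Or.inr this), Or.inr this]
    obtain ⟨g1, g2⟩ := hav p hp q hq hpq
    exact ⟨fun h => g1 (h ▸ hk), fun h => g2 (h ▸ hk)⟩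
  · exact h

/-- Triples with a private light neighbour that are tight for the set `K` of kinds of pairs. -/
def PrivTight (t B : ℕ) (H : Finset (Finset V)) (K : Finset (Fin 3)) (x y z : V) : Prop :=
  Tri H x y z ∧ (∀ k ∈ K, (link H x (y, z) k).card = K.card * t) ∧
    (∀ k ∉ K, 5 * t + 1 ≤ (link H x (y, z) k).card) ∧ Priv B H x y z

theorem privTight_cover (h3 : ∀ e ∈ H, e.card = 3) (hF : ¬ ContainsFanExp t H) (ht : 1 < t)
    {K : Finset (Fin 3)} (hK : 0 ∈ K) (u : V) :
    ∃ C : Finset V, C.card ≤ 2 * (t * (2 * (9 * t + B) + 1)) ∧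
      ∀ y z, PrivTight t B H K u y z → y ∈ C ∨ z ∈ C := by
  have hw : ∀ p : V × V, ∃ w, PrivTight t B H K u p.1 p.2 →
      w ∈ nb H u p.1 ∧ w ≠ p.2 ∧ cd H u w ≤ B := by
    intro p
    by_cases h : PrivTight t B H K u p.1 p.2
    · obtain ⟨w, hw⟩ := h.2.2.2
      exact ⟨w, fun _ => hw⟩
    · exact ⟨u, fun h' => absurd h' h⟩
  choose w hw using hw
  have hK3 : K.card ≤ 3 := by simpa using Finset.card_le_univ K
  have hslot : ∀ p : V × V, PrivTight t B H K u p.1 p.2 → ∀ k ∈ K,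
      (slot H u p k).card + 1 = K.card * t := by
    intro p hp k hk
    rw [card_slot hp.1 k]
    exact hp.2.1 k hk
  rcases exists_pool_or_cover (PrivTight t B H K u)
    (fun p => K.biUnion (slot H u p) ∪ nb H u (w p)) (9 * t + B) t (by
      intro x y h
      have a1 := Finset.card_union_le (K.biUnion (slot H u (x, y))) (nb H u (w (x, y)))
      have a2 := Finset.card_biUnion_le_card_mul K (slot H u (x, y)) (3 * t) (by
        intro k hk
        have b1 := hslot (x, y) h k hk
        have b2 : K.card * t ≤ 3 * t := Nat.mul_le_mul_right _ hK3
        omega)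
      have a3 : K.card * (3 * t) ≤ 3 * (3 * t) := Nat.mul_le_mul_right _ hK3
      have a4 := (hw (x, y) h).2.2
      unfold cd at a4
      omega) with ⟨Q, hQ, hR, hsep, hav⟩ | h
  · exfalso
    have : Nonempty V := ⟨u⟩
    obtain ⟨p, hp, q, hq, hpq⟩ := Finset.one_lt_card.1 (hQ ▸ ht)
    obtain ⟨f, hf, hinj⟩ := hall_of_ne (Q ×ˢ K) (fun i => slot H u i.1 i.2) (by
      rintro ⟨p, k⟩ hi
      simp only [Finset.mem_product] at hi
      have := hslot p (hR p hi.1) k hi.2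
      rw [Finset.card_product, hQ, mul_comm]
      exact this.ge) (a := (p, 0)) (b := (q, 0)) (by simp [hp, hK]) (by simp [hq, hK]) (by
      intro heq
      obtain ⟨w1, w2, -⟩ := hw p (hR p hp)
      have h1 : w p ∈ slot H u p 0 := by simpa [slot, link, w2] using w1
      have h2 : w p ∈ slot H u q 0 := heq ▸ h1
      have h4 : Tri H u q.1 (w p) := by
        have : w p ≠ q.2 ∧ w p ∈ nb H u q.1 := by simpa [slot, link] using h2
        exact mem_nb.1 this.2
      exact (hav p hp q hq hpq).1 (Finset.mem_union_right _ (mem_nb.2 h4.swap')))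
    refine hF (fan_of_partial_rep h3 hQ hsep K hinj
      (fun p hp k hk => hf (p, k) (by simp [hp, hk])) ?_ fun p hp k hk => (hR p hp).2.2.1 k hk)
    intro p hp q hq hpq k hk
    have hm : f (p, k) ∈ K.biUnion (slot H u p) ∪ nb H u (w p) :=
      Finset.mem_union_left _ (Finset.mem_biUnion.2 ⟨k, hk, hf (p, k) (by simp [hp, hk])⟩)
    obtain ⟨g1, g2⟩ := hav p hp q hq hpq
    exact ⟨fun h => g1 (h ▸ hm), fun h => g2 (h ▸ hm)⟩
  · exact h

theorem cnt3_privTight_le (h3 : ∀ e ∈ H, e.card = 3) (hF : ¬ ContainsFanExp t H) (ht : 1 < t)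
    {K : Finset (Fin 3)} (hK : 0 ∈ K) (hK' : 1 ∈ K) :
    cnt3 (PrivTight t B H K) ≤
      2 * (2 * (t * (2 * (9 * t + B) + 1)) * (3 * t)) * Fintype.card V := by
  have hK3 : K.card * t ≤ 3 * t :=
    Nat.mul_le_mul_right _ (by simpa using Finset.card_le_univ K)
  exact cnt3_le_of_centre_cover (fun x y z h =>
    ⟨h.1, (h.2.1 0 hK).le.trans hK3, (h.2.1 1 hK').le.trans hK3⟩)
    fun u => privTight_cover h3 hF ht hK u

theorem privTight_of_type2 (hB : 5 * t ≤ B) {x y z : V} (h : Type2 t B H x y z)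
    (hp : Priv B H x y z) : PrivTight t B H {0, 1} x y z := by
  obtain ⟨h1, h2, h4, h5⟩ := h
  refine ⟨h1, ?_, ?_, hp⟩
  · intro k hk
    fin_cases k
    · exact h2
    · exact h4
    · exact absurd hk (by decide)
  · intro k hk
    fin_cases k
    · exact absurd hk (by decide)
    · exact absurd hk (by decide)
    · exact (by omega : 5 * t + 1 ≤ cd H y z)

theorem privTight_of_type3 {x y z : V} (h : Type3 t H x y z)
    (hp : Priv B H x y z) : PrivTight t B H Finset.univ x y z := by
  obtain ⟨h1, h2, h4, h5⟩ := h
  refine ⟨h1, ?_, by simp, hp⟩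
  intro k hk
  fin_cases k
  exacts [h2, h4, h5]

/-- The bound of `cnt3_privTight_le`, per vertex. -/
def privBound (t B : ℕ) : ℕ := 2 * (2 * (t * (2 * (9 * t + B) + 1)) * (3 * t))

theorem cnt3_type3_le (h3 : ∀ e ∈ H, e.card = 3) (hF : ¬ ContainsFanExp t H) (ht : 1 < t)
    (hB : 5 * t ≤ B) :
    cnt3 (Type3 t H) ≤ 2 * (privBound t B * Fintype.card V) + 3 * t * cnt3 (Rich t H) := by
  have hp : cnt3 (PrivTight t B H Finset.univ) ≤ privBound t B * Fintype.card V :=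
    cnt3_privTight_le h3 hF ht (Finset.mem_univ _) (Finset.mem_univ _)
  set R : V → V → V → Prop := fun x y z => Type3 t H x y z ∧ ¬ Priv B H x y z ∧
    ¬ Priv B H y x z with hR
  have h1 : cnt3 R ≤ 3 * t * cnt3 (Rich t H) := by
    refine cnt3_le_charge (H := H) fun x y z h => ?_
    obtain ⟨⟨e1, e2, e4, e5⟩, e6, e7⟩ := h
    refine ⟨e1, e2.le, ?_⟩
    obtain ⟨w, hw, hwz⟩ := Finset.exists_mem_ne (s := nb H x y)
      (by have : (nb H x y).card = 3 * t := e2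
          omega) z
    refine ⟨w, mem_nb.1 hw, ?_⟩
    have g1 : B < cd H x w := by
      by_contra! hle
      exact e6 ⟨w, hw, hwz, hle⟩
    have g2 : B < cd H y w := by
      by_contra! hle
      exact e7 ⟨w, by rwa [nb_comm], hwz, hle⟩
    omega
  have h2 : cnt3 (Type3 t H) ≤ cnt3 (fun x y z => PrivTight t B H Finset.univ x y z ∨
      PrivTight t B H Finset.univ y x z ∨ R x y z) := by
    refine cnt3_mono fun x y z h => ?_
    by_cases g1 : Priv B H x y z
    · exact Or.inl (privTight_of_type3 h g1)
    by_cases g2 : Priv B H y x z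
    · refine Or.inr (Or.inl (privTight_of_type3 ?_ g2))
      exact ⟨h.1.swap, (cd_comm _ _).trans h.2.1, h.2.2.2, h.2.2.1⟩
    · exact Or.inr (Or.inr ⟨h, g1, g2⟩)
  have a1 := cnt3_or (PrivTight t B H Finset.univ)
    (fun x y z => PrivTight t B H Finset.univ y x z ∨ R x y z)
  have a2 := cnt3_or (fun x y z => PrivTight t B H Finset.univ y x z) R
  have a3 : cnt3 (fun x y z => PrivTight t B H Finset.univ y x z) = _ := cnt3_swap _
  omega

/-- The classification of the triples outside an exceptional relation `E`. -/
def Classified (t B : ℕ) (H : Finset (Finset V)) (E : V → V → V → Prop) : Prop :=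
  ∀ x y z, Tri H x y z → ¬ E x y z →
    (Type1 t B H x y z ∨ Type1 t B H x z y ∨ Type1 t B H y z x) ∨
    (Type2 t B H x y z ∨ Type2 t B H y x z ∨ Type2 t B H z x y) ∨ Type3 t H x y z

theorem cnt3_type2_le (h3 : ∀ e ∈ H, e.card = 3) (hF : ¬ ContainsFanExp t H) (ht : 1 < t)
    (hB : 5 * t ≤ B) {E : V → V → V → Prop} (hE : Classified t B H E) :
    cnt3 (Type2 t B H) ≤ privBound t B * Fintype.card V +
      2 * t * (cnt3 E + privBound t B * Fintype.card V) := by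
  have hp : cnt3 (PrivTight t B H {0, 1}) ≤ privBound t B * Fintype.card V :=
    cnt3_privTight_le h3 hF ht (by simp) (by simp)
  set R : V → V → V → Prop := fun x y z => Type2 t B H x y z ∧ ¬ Priv B H x y z with hR
  set Q : V → V → V → Prop := fun x y w => E x y w ∨ PrivTight t B H {0, 1} y x w with hQ
  have hQc : cnt3 Q ≤ cnt3 E + privBound t B * Fintype.card V := by
    refine (cnt3_or E (fun x y w => PrivTight t B H {0, 1} y x w)).trans ?_
    have a3 : cnt3 (fun x y z => PrivTight t B H {0, 1} y x z) = _ := cnt3_swap _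
    omega
  have h1 : cnt3 R ≤ 2 * t * cnt3 Q := by
    refine cnt3_le_charge (H := H) fun x y z h => ?_
    obtain ⟨⟨e1, e2, e4, e5⟩, e6⟩ := h
    refine ⟨e1, e2.le, ?_⟩
    have hcard : 1 < ((nb H x y).erase z).card := by
      have h1 : (nb H x y).card = 2 * t := e2
      have h2 := Finset.card_erase_of_mem (mem_nb.2 e1 : z ∈ nb H x y)
      omega
    obtain ⟨w, hw, w', hw', hne⟩ := Finset.one_lt_card.1 hcard
    have key : ∀ v ∈ (nb H x y).erase z, ¬ E x y v → Type2 t B H y x v := by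
      intro v hv hEv
      rw [Finset.mem_erase] at hv
      have g1 : B < cd H x v := by
        by_contra! hle
        exact e6 ⟨v, hv.2, hv.1, hle⟩
      have hxv := cd_comm (H := H) v x
      have hxy := cd_comm (H := H) y x
      rcases hE x y v (mem_nb.1 hv.2) hEv with (g | g | g) | (g | g | g) | g <;>
        obtain ⟨g0, g2, g3, g4⟩ := g
      · omega
      · omega
      · omega
      · omega
      · exact ⟨g0, g2, g3, g4⟩
      · omega
      · omega
    by_cases hE1 : E x y w
    · exact ⟨w, Or.inl hE1⟩
    by_cases hE2 : E x y w'
    · exact ⟨w', Or.inl hE2⟩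
    refine ⟨w, Or.inr (privTight_of_type2 hB (key w hw hE1) ⟨w', ?_, hne.symm, ?_⟩)⟩
    · rw [nb_comm]
      exact Finset.mem_of_mem_erase hw'
    · have := (key w' hw' hE2).2.2.1
      omega
  have h2 : cnt3 (Type2 t B H) ≤ cnt3 (fun x y z => PrivTight t B H {0, 1} x y z ∨ R x y z) := by
    refine cnt3_mono fun x y z h => ?_
    by_cases g1 : Priv B H x y z
    · exact Or.inl (privTight_of_type2 hB h g1)
    · exact Or.inr ⟨h, g1⟩
  have a1 := cnt3_or (PrivTight t B H {0, 1}) R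
  have a2 := Nat.mul_le_mul_left (2 * t) hQc
  omega

theorem cnt3_not_type1_le (h3 : ∀ e ∈ H, e.card = 3) (hF : ¬ ContainsFanExp t H) (ht : 1 < t)
    (hB : 5 * t ≤ B) {E : V → V → V → Prop} (hE : Classified t B H E)
    (hRE : ∀ x y z, Rich t H x y z → E x y z) :
    cnt3 (fun x y z => Tri H x y z ∧
      ¬ (Type1 t B H x y z ∨ Type1 t B H x z y ∨ Type1 t B H y z x)) ≤
    (1 + 9 * t) * cnt3 E + (5 + 6 * t) * (privBound t B * Fintype.card V) := by
  have h2 := cnt3_type2_le h3 hF ht hB hE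
  have h4 := cnt3_type3_le h3 hF ht hB
  have h5 : 3 * t * cnt3 (Rich t H) ≤ 3 * t * cnt3 E := Nat.mul_le_mul_left _ (cnt3_mono hRE)
  set G : V → V → V → Prop := Type2 t B H with hG
  have e3 : cnt3 (fun x y z => G y x z) = cnt3 G := cnt3_swap G
  have e5 : cnt3 (fun x y z => G z x y) = cnt3 G :=
    (cnt3_swap' (fun x y z => G y x z)).trans e3
  have a0 : cnt3 (fun x y z => Tri H x y z ∧
      ¬ (Type1 t B H x y z ∨ Type1 t B H x z y ∨ Type1 t B H y z x)) ≤
      cnt3 (fun x y z => E x y z ∨ G x y z ∨ G y x z ∨ G z x y ∨ Type3 t H x y z) := by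
    refine cnt3_mono fun x y z h => ?_
    have := hE x y z h.1
    tauto
  have a1 := cnt3_or E (fun x y z => G x y z ∨ G y x z ∨ G z x y ∨ Type3 t H x y z)
  have a2 := cnt3_or G (fun x y z => G y x z ∨ G z x y ∨ Type3 t H x y z)
  have a3 := cnt3_or (fun x y z => G y x z) (fun x y z => G z x y ∨ Type3 t H x y z)
  have a4 := cnt3_or (fun x y z => G z x y) (Type3 t H)
  generalize privBound t B * Fintype.card V = P at *
  nlinarith

end Types

/-! ### Almost all pairs have codegree `t` -/

section Weights

theorem inv_ge_of_le {a s : ℕ} (ha : 0 < a) (h : a ≤ s) : (1 : ℝ) / s ≤ 1 / a :=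
  one_div_le_one_div_of_le (by exact_mod_cast ha) (by exact_mod_cast h)

theorem inv_ge_of_lt {a s : ℕ} (ha : 0 < a) (h : a < s) :
    (1 : ℝ) / s + (1 / s) ^ 2 ≤ 1 / a := by
  have h1 : (0 : ℝ) < a := by exact_mod_cast ha
  have h2 : (a : ℝ) + 1 ≤ s := by exact_mod_cast h
  have h4 : (0 : ℝ) < s := by linarith
  rw [div_pow, one_pow, div_add_div _ _ h4.ne' (by positivity), div_le_div_iff₀ (by positivity) h1]
  nlinarith [mul_pos h4 h4, mul_pos h4 h1]

/-- The weight of a triple with codegrees `a, b, c`. -/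
noncomputable def wt (a b c : ℕ) : ℝ := 1 / a + 1 / b + 1 / c

theorem wt_ge {t a b c : ℕ} (ha : 0 < a) (hb : 0 < b) (hc : 0 < c)
    (h : ¬ ((t < a ∧ t < b ∧ t < c) ∧ (2 * t < a ∨ 2 * t < b) ∧ (2 * t < a ∨ 2 * t < c) ∧
      (2 * t < b ∨ 2 * t < c) ∧ (3 * t < a ∨ 3 * t < b ∨ 3 * t < c))) :
    (1 : ℝ) / t ≤ wt a b c := by
  have pa : (0 : ℝ) < 1 / a := by positivity
  have pb : (0 : ℝ) < 1 / b := by positivity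
  have pc : (0 : ℝ) < 1 / c := by positivity
  have e2 : (1 : ℝ) / (2 * t : ℕ) = 1 / t / 2 := by push_cast; rw [div_div, mul_comm]
  have e3 : (1 : ℝ) / (3 * t : ℕ) = 1 / t / 3 := by push_cast; rw [div_div, mul_comm]
  unfold wt
  have cases : a ≤ t ∨ b ≤ t ∨ c ≤ t ∨ (a ≤ 2 * t ∧ b ≤ 2 * t) ∨ (a ≤ 2 * t ∧ c ≤ 2 * t) ∨
      (b ≤ 2 * t ∧ c ≤ 2 * t) ∨ (a ≤ 3 * t ∧ b ≤ 3 * t ∧ c ≤ 3 * t) := by omega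
  rcases cases with g | g | g | ⟨g, g'⟩ | ⟨g, g'⟩ | ⟨g, g'⟩ | ⟨g, g', g''⟩
  · linarith [inv_ge_of_le ha g]
  · linarith [inv_ge_of_le hb g]
  · linarith [inv_ge_of_le hc g]
  · linarith [inv_ge_of_le ha g, inv_ge_of_le hb g']
  · linarith [inv_ge_of_le ha g, inv_ge_of_le hc g']
  · linarith [inv_ge_of_le hb g, inv_ge_of_le hc g']
  · linarith [inv_ge_of_le ha g, inv_ge_of_le hb g', inv_ge_of_le hc g'']

theorem tight_of_wt_lt {t a b c : ℕ} (ht : 0 < t) (ha : 0 < a) (hb : 0 < b) (hc : 0 < c)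
    (h : ¬ ((t < a ∧ t < b ∧ t < c) ∧ (2 * t < a ∨ 2 * t < b) ∧ (2 * t < a ∨ 2 * t < c) ∧
      (2 * t < b ∨ 2 * t < c) ∧ (3 * t < a ∨ 3 * t < b ∨ 3 * t < c)))
    (hw : wt a b c < 1 / t + 1 / (9 * t ^ 2 : ℕ)) :
    ((a = t ∧ 9 * t ^ 2 < b ∧ 9 * t ^ 2 < c) ∨ (b = t ∧ 9 * t ^ 2 < a ∧ 9 * t ^ 2 < c) ∨
      (c = t ∧ 9 * t ^ 2 < a ∧ 9 * t ^ 2 < b)) ∨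
    ((a = 2 * t ∧ b = 2 * t ∧ 9 * t ^ 2 < c) ∨ (a = 2 * t ∧ c = 2 * t ∧ 9 * t ^ 2 < b) ∨
      (b = 2 * t ∧ c = 2 * t ∧ 9 * t ^ 2 < a)) ∨
    (a = 3 * t ∧ b = 3 * t ∧ c = 3 * t) := by
  have pa : (0 : ℝ) < 1 / a := by positivity
  have pb : (0 : ℝ) < 1 / b := by positivity
  have pc : (0 : ℝ) < 1 / c := by positivity
  have pu : (0 : ℝ) < (1 / t) ^ 2 := by positivity
  have e2 : (1 : ℝ) / (2 * t : ℕ) = 1 / t / 2 := by push_cast; rw [div_div, mul_comm]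
  have e3 : (1 : ℝ) / (3 * t : ℕ) = 1 / t / 3 := by push_cast; rw [div_div, mul_comm]
  have e9 : (1 : ℝ) / (9 * t ^ 2 : ℕ) = (1 / t) ^ 2 / 9 := by
    push_cast
    rw [div_pow, one_pow, div_div, mul_comm]
  unfold wt at hw
  rw [e9] at hw
  have big : ∀ {d : ℕ}, 0 < d → d ≤ 9 * t ^ 2 → (1 / t : ℝ) ^ 2 / 9 ≤ 1 / d := fun h1 h2 =>
    e9 ▸ inv_ge_of_le h1 h2
  have lt1 : ∀ {d : ℕ}, 0 < d → d < t → (1 / t : ℝ) + (1 / t) ^ 2 ≤ 1 / d := inv_ge_of_lt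
  have lt2 : ∀ {d : ℕ}, 0 < d → d < 2 * t → (1 / t : ℝ) / 2 + (1 / t) ^ 2 / 4 ≤ 1 / d := by
    intro d h1 h2
    have := inv_ge_of_lt h1 h2
    rw [e2] at this
    linarith
  have lt3 : ∀ {d : ℕ}, 0 < d → d < 3 * t → (1 / t : ℝ) / 3 + (1 / t) ^ 2 / 9 ≤ 1 / d := by
    intro d h1 h2
    have := inv_ge_of_lt h1 h2
    rw [e3] at this
    linarith
  have le1 : ∀ {d : ℕ}, 0 < d → d ≤ t → (1 / t : ℝ) ≤ 1 / d := inv_ge_of_le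
  have le2 : ∀ {d : ℕ}, 0 < d → d ≤ 2 * t → (1 / t : ℝ) / 2 ≤ 1 / d := fun h1 h2 =>
    e2 ▸ inv_ge_of_le h1 h2
  have le3 : ∀ {d : ℕ}, 0 < d → d ≤ 3 * t → (1 / t : ℝ) / 3 ≤ 1 / d := fun h1 h2 =>
    e3 ▸ inv_ge_of_le h1 h2
  have one : ∀ {x y z : ℕ}, 0 < x → 0 < y → 0 < z → x ≤ t →
      (1 / x + 1 / y + 1 / z : ℝ) < 1 / t + (1 / t) ^ 2 / 9 →
      x = t ∧ 9 * t ^ 2 < y ∧ 9 * t ^ 2 < z := by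
    intro x y z hx hy hz hxt hlt
    have px : (0 : ℝ) < 1 / x := by positivity
    have py : (0 : ℝ) < 1 / y := by positivity
    have pz : (0 : ℝ) < 1 / z := by positivity
    refine ⟨?_, ?_, ?_⟩
    · by_contra hne
      linarith [lt1 hx (lt_of_le_of_ne hxt hne)]
    · by_contra! hle
      linarith [le1 hx hxt, big hy hle]
    · by_contra! hle
      linarith [le1 hx hxt, big hz hle]
  have two : ∀ {x y z : ℕ}, 0 < x → 0 < y → 0 < z → x ≤ 2 * t → y ≤ 2 * t →
      (1 / x + 1 / y + 1 / z : ℝ) < 1 / t + (1 / t) ^ 2 / 9 →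
      x = 2 * t ∧ y = 2 * t ∧ 9 * t ^ 2 < z := by
    intro x y z hx hy hz hxt hyt hlt
    have pz : (0 : ℝ) < 1 / z := by positivity
    refine ⟨?_, ?_, ?_⟩
    · by_contra hne
      linarith [lt2 hx (lt_of_le_of_ne hxt hne), le2 hy hyt]
    · by_contra hne
      linarith [lt2 hy (lt_of_le_of_ne hyt hne), le2 hx hxt]
    · by_contra! hle
      linarith [le2 hx hxt, le2 hy hyt, big hz hle]
  have cases : a ≤ t ∨ b ≤ t ∨ c ≤ t ∨ (a ≤ 2 * t ∧ b ≤ 2 * t) ∨ (a ≤ 2 * t ∧ c ≤ 2 * t) ∨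
      (b ≤ 2 * t ∧ c ≤ 2 * t) ∨ (a ≤ 3 * t ∧ b ≤ 3 * t ∧ c ≤ 3 * t) := by omega
  rcases cases with g | g | g | ⟨g, g'⟩ | ⟨g, g'⟩ | ⟨g, g'⟩ | ⟨g, g', g''⟩
  · exact Or.inl (Or.inl (one ha hb hc g (by linarith)))
  · exact Or.inl (Or.inr (Or.inl (one hb ha hc g (by linarith))))
  · exact Or.inl (Or.inr (Or.inr (one hc ha hb g (by linarith))))
  · exact Or.inr (Or.inl (Or.inl (two ha hb hc g g' (by linarith))))
  · exact Or.inr (Or.inl (Or.inr (Or.inl (two ha hc hb g g' (by linarith)))))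
  · exact Or.inr (Or.inl (Or.inr (Or.inr (two hb hc ha g g' (by linarith)))))
  · refine Or.inr (Or.inr ⟨?_, ?_, ?_⟩)
    · by_contra hne
      linarith [lt3 ha (lt_of_le_of_ne g hne), le3 hb g', le3 hc g'']
    · by_contra hne
      linarith [lt3 hb (lt_of_le_of_ne g' hne), le3 ha g, le3 hc g'']
    · by_contra hne
      linarith [lt3 hc (lt_of_le_of_ne g'' hne), le3 ha g, le3 hb g']

variable {V : Type*} [Fintype V] [DecidableEq V] {H : Finset (Finset V)} {t : ℕ}

theorem Tri.cd_pos {x y z : V} (h : Tri H x y z) :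
    0 < cd H x y ∧ 0 < cd H x z ∧ 0 < cd H y z :=
  ⟨Finset.card_pos.2 ⟨z, mem_nb.2 h⟩, Finset.card_pos.2 ⟨y, mem_nb.2 h.swap'⟩,
    Finset.card_pos.2 ⟨x, mem_nb.2 h.swap.swap'⟩⟩

theorem cd_self (h3 : ∀ e ∈ H, e.card = 3) (x : V) : cd H x x = 0 := by
  refine Finset.card_eq_zero.2 (Finset.eq_empty_of_forall_notMem fun z hz => ?_)
  exact ((mem_nb.1 hz).ne h3).1 rfl

open Classical in
theorem sum_inv_cd_le (h3 : ∀ e ∈ H, e.card = 3) :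
    ∑ x : V, ∑ y : V, ∑ z : V, (if Tri H x y z then (1 : ℝ) / cd H x y else 0) ≤
      Fintype.card V * (Fintype.card V - 1) := by
  have h1 : ∀ x y : V, ∑ z : V, (if Tri H x y z then (1 : ℝ) / cd H x y else 0) ≤
      if y = x then 0 else 1 := by
    intro x y
    rw [← Finset.sum_filter, Finset.sum_const]
    have : (Finset.univ.filter fun z => Tri H x y z) = nb H x y := by
      ext z
      simp [mem_nb]
    rw [this, nsmul_eq_mul]
    change (cd H x y : ℝ) * _ ≤ _
    split_ifs with h
    · rw [h, cd_self h3]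
      simp
    · rw [mul_one_div]
      exact div_self_le_one _
  calc _ ≤ ∑ x : V, ∑ y : V, (if y = x then (0 : ℝ) else 1) :=
        Finset.sum_le_sum fun x _ => Finset.sum_le_sum fun y _ => h1 x y
    _ = ∑ x : V, ∑ y : V, ((1 : ℝ) - if y = x then 1 else 0) := by
        refine Finset.sum_congr rfl fun x _ => Finset.sum_congr rfl fun y _ => ?_
        split_ifs <;> simp
    _ = _ := by simp [Finset.sum_sub_distrib, mul_sub]

open Classical in
theorem sum_wt_le (h3 : ∀ e ∈ H, e.card = 3) :
    ∑ x : V, ∑ y : V, ∑ z : V,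
      (if Tri H x y z then wt (cd H x y) (cd H x z) (cd H y z) else 0) ≤
      3 * (Fintype.card V * (Fintype.card V - 1)) := by
  have h1 := sum_inv_cd_le h3
  have h2 : ∑ x : V, ∑ y : V, ∑ z : V, (if Tri H x y z then (1 : ℝ) / cd H x z else 0) =
      ∑ x : V, ∑ y : V, ∑ z : V, (if Tri H x y z then (1 : ℝ) / cd H x y else 0) := by
    refine Finset.sum_congr rfl fun x _ => ?_
    rw [Finset.sum_comm]
    refine Finset.sum_congr rfl fun y _ => Finset.sum_congr rfl fun z _ => ?_
    have : Tri H x z y ↔ Tri H x y z := ⟨Tri.swap', Tri.swap'⟩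
    simp only [this]
  have h4 : ∑ x : V, ∑ y : V, ∑ z : V, (if Tri H x y z then (1 : ℝ) / cd H y z else 0) =
      ∑ x : V, ∑ y : V, ∑ z : V, (if Tri H x y z then (1 : ℝ) / cd H x z else 0) := by
    rw [Finset.sum_comm]
    refine Finset.sum_congr rfl fun x _ => Finset.sum_congr rfl fun y _ =>
      Finset.sum_congr rfl fun z _ => ?_
    have : Tri H y x z ↔ Tri H x y z := ⟨Tri.swap, Tri.swap⟩
    simp only [this]
  have h5 : ∀ x y z : V, (if Tri H x y z then wt (cd H x y) (cd H x z) (cd H y z) else 0) =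
      (if Tri H x y z then (1 : ℝ) / cd H x y else 0) +
      (if Tri H x y z then (1 : ℝ) / cd H x z else 0) +
      (if Tri H x y z then (1 : ℝ) / cd H y z else 0) := by
    intro x y z
    unfold wt
    split_ifs <;> simp
  simp only [h5, Finset.sum_add_distrib]
  linarith

/-- The triples that are heavier than necessary. -/
def Bad (t : ℕ) (H : Finset (Finset V)) (x y z : V) : Prop :=
  Tri H x y z ∧ ¬ Rich t H x y z ∧
    (1 : ℝ) / t + 1 / (9 * t ^ 2 : ℕ) ≤ wt (cd H x y) (cd H x z) (cd H y z)

theorem cnt3_bad_le (h3 : ∀ e ∈ H, e.card = 3) (ht : 0 < t)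
    (hH : 3 * t * (Fintype.card V * (Fintype.card V - 1)) ≤ 6 * H.card + 3 * Fintype.card V) :
    cnt3 (Bad t H) ≤ 9 * t * (3 * Fintype.card V + cnt3 (Rich t H)) := by
  classical
  have h1 := sum_wt_le h3
  have h2 : (1 / t : ℝ) * cnt3 (Tri H) - 1 / t * cnt3 (Rich t H) +
      1 / (9 * t ^ 2 : ℕ) * cnt3 (Bad t H) ≤ ∑ x : V, ∑ y : V, ∑ z : V,
      (if Tri H x y z then wt (cd H x y) (cd H x z) (cd H y z) else 0) := by
    rw [cnt3_cast, cnt3_cast, cnt3_cast]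
    simp only [Finset.mul_sum, ← Finset.sum_add_distrib, ← Finset.sum_sub_distrib]
    refine Finset.sum_le_sum fun x _ => Finset.sum_le_sum fun y _ =>
      Finset.sum_le_sum fun z _ => ?_
    by_cases hT : Tri H x y z
    · obtain ⟨pa, pb, pc⟩ := hT.cd_pos
      by_cases hR : Rich t H x y z
      · have hb : ¬ Bad t H x y z := fun h => h.2.1 hR
        have : (0 : ℝ) ≤ wt (cd H x y) (cd H x z) (cd H y z) := by
          unfold wt
          positivity
        simp only [hT, hR, hb, if_true, if_false]
        linarith
      · by_cases hb : Bad t H x y z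
        · simp only [hT, hR, hb, if_true, if_false]
          linarith [hb.2.2]
        · have := wt_ge (t := t) pa pb pc fun h => hR ⟨hT, h⟩
          simp only [hT, hR, hb, if_true, if_false]
          linarith
    · have hR : ¬ Rich t H x y z := fun h => hT h.1
      have hb : ¬ Bad t H x y z := fun h => hT h.1
      simp [hT, hR, hb]
  have h4 : 3 * t * (Fintype.card V * (Fintype.card V - 1)) ≤
      cnt3 (Tri H) + 3 * Fintype.card V := hH.trans (by
    have := six_mul_card_le h3
    omega)
  have h5 : 3 * (t : ℝ) * (Fintype.card V * (Fintype.card V - 1)) ≤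
      cnt3 (Tri H) + 3 * Fintype.card V := by
    rcases Nat.eq_zero_or_pos (Fintype.card V) with h | h
    · rw [h]
      simp
    · have h6 : ((Fintype.card V - 1 : ℕ) : ℝ) = Fintype.card V - 1 := by
        rw [Nat.cast_sub h, Nat.cast_one]
      rw [← h6]
      exact_mod_cast h4
  have h7 := h2.trans h1
  have ht' : (0 : ℝ) < t := by exact_mod_cast ht
  push_cast at h7
  have h8 : (1 / t : ℝ) * cnt3 (Tri H) - 1 / t * cnt3 (Rich t H) +
      1 / (9 * t ^ 2) * cnt3 (Bad t H) =
      (9 * t * cnt3 (Tri H) - 9 * t * cnt3 (Rich t H) + cnt3 (Bad t H)) / (9 * t ^ 2) := by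
    field_simp
  rw [h8, div_le_iff₀ (by positivity)] at h7
  have h9 : (cnt3 (Bad t H) : ℝ) ≤ 9 * t * (3 * Fintype.card V + cnt3 (Rich t H)) := by
    nlinarith
  exact_mod_cast h9

theorem classified_bad (ht : 0 < t) :
    Classified t (9 * t ^ 2) H (fun x y z => Rich t H x y z ∨ Bad t H x y z) := by
  intro x y z hT hE
  rw [not_or] at hE
  obtain ⟨pa, pb, pc⟩ := hT.cd_pos
  have hw : wt (cd H x y) (cd H x z) (cd H y z) < 1 / t + 1 / (9 * t ^ 2 : ℕ) := by
    by_contra! h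
    exact hE.2 ⟨hT, hE.1, h⟩
  have hyx := cd_comm (H := H) y x
  have hzx := cd_comm (H := H) z x
  have hzy := cd_comm (H := H) z y
  rcases tight_of_wt_lt ht pa pb pc (fun h => hE.1 ⟨hT, h⟩) hw with
    (⟨g1, g2, g3⟩ | ⟨g1, g2, g3⟩ | ⟨g1, g2, g3⟩) |
    (⟨g1, g2, g3⟩ | ⟨g1, g2, g3⟩ | ⟨g1, g2, g3⟩) | ⟨g1, g2, g3⟩
  · exact Or.inl (Or.inl ⟨hT, g1, g2, g3⟩)
  · exact Or.inl (Or.inr (Or.inl ⟨hT.swap', g1, g2, hzy ▸ g3⟩))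
  · exact Or.inl (Or.inr (Or.inr ⟨hT.swap.swap', g1, hyx ▸ g2, hzx ▸ g3⟩))
  · exact Or.inr (Or.inl (Or.inl ⟨hT, g1, g2, g3⟩))
  · exact Or.inr (Or.inl (Or.inr (Or.inl ⟨hT.swap, hyx.trans g1, g2, g3⟩)))
  · exact Or.inr (Or.inl (Or.inr (Or.inr ⟨hT.swap'.swap, hzx.trans g1, hzy.trans g2, g3⟩)))
  · exact Or.inr (Or.inr ⟨hT, g1, g2, g3⟩)

/-- Pairs of codegree `t` all of whose extensions are heavy. -/
def Good (t B : ℕ) (H : Finset (Finset V)) (x y : V) : Prop :=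
  cd H x y = t ∧ ∀ z ∈ nb H x y, B < cd H x z ∧ B < cd H y z

theorem cnt3_type1_le (B : ℕ) :
    cnt3 (Type1 t B H) ≤ t * cnt2 (fun x y => cd H x y = t) := by
  classical
  rw [cnt3_eq_sum_pairs, cnt2_eq_sum, Finset.mul_sum]
  refine Finset.sum_le_sum fun x _ => ?_
  rw [Finset.card_filter, Finset.mul_sum]
  refine Finset.sum_le_sum fun y _ => ?_
  split_ifs with h
  · rw [mul_one, ← h]
    exact Finset.card_le_card fun z hz => mem_nb.2 (by simpa using hz : Type1 _ _ _ _ _ _).1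
  · simp [Type1, h]

theorem exists_cnt2_not_good_le (t : ℕ) (ht : 1 < t) : ∃ c : ℕ, ∀ (V : Type) [Fintype V]
    [DecidableEq V] (H : Finset (Finset V)), (∀ e ∈ H, e.card = 3) → ¬ ContainsFanExp t H →
    3 * t * (Fintype.card V * (Fintype.card V - 1)) ≤ 6 * H.card + 3 * Fintype.card V →
    cnt2 (fun x y => ¬ Good t (9 * t ^ 2) H x y) ≤ c * Fintype.card V := by
  set r := 6 * ((2 * (t * (2 * (9 * t) + 1))) * (2 * (t * (2 * (9 * t) + 1)))) with hr
  set e := r + 9 * t * (3 + r) with he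
  set m := (1 + 9 * t) * e + (5 + 6 * t) * privBound t (9 * t ^ 2) with hm
  refine ⟨3 * t + 3 + 2 * m, fun V _ _ H h3 hF hH => ?_⟩
  have hR : cnt3 (Rich t H) ≤ r * Fintype.card V := cnt3_rich_le h3 hF
  have hb := cnt3_bad_le h3 (by omega) hH
  have hE : cnt3 (fun x y z => Rich t H x y z ∨ Bad t H x y z) ≤ e * Fintype.card V := by
    refine (cnt3_or _ _).trans ?_
    have : 9 * t * (3 * Fintype.card V + cnt3 (Rich t H)) ≤
        9 * t * (3 * Fintype.card V + r * Fintype.card V) := by gcongr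
    rw [he]
    linarith
  have hB : 5 * t ≤ 9 * t ^ 2 := by nlinarith
  have hN := cnt3_not_type1_le h3 hF ht hB (classified_bad (H := H) (by omega : 0 < t))
    fun x y z h => Or.inl h
  set N : V → V → V → Prop := fun x y z => Tri H x y z ∧
    ¬ (Type1 t (9 * t ^ 2) H x y z ∨ Type1 t (9 * t ^ 2) H x z y ∨
      Type1 t (9 * t ^ 2) H y z x) with hNdef
  have hNm : cnt3 N ≤ m * Fintype.card V := by
    calc _ ≤ (1 + 9 * t) * (e * Fintype.card V) +
          (5 + 6 * t) * (privBound t (9 * t ^ 2) * Fintype.card V) :=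
        hN.trans (Nat.add_le_add_right (Nat.mul_le_mul_left _ hE) _)
      _ = m * Fintype.card V := by rw [hm]; ring
  have hT : cnt3 (Tri H) ≤ cnt3 N + 3 * (t * cnt2 (fun x y => cd H x y = t)) := by
    set G : V → V → V → Prop := Type1 t (9 * t ^ 2) H with hG
    have e2 : cnt3 (fun x y z => G x z y) = cnt3 G := cnt3_swap' G
    have e4 : cnt3 (fun x y z => G y z x) = cnt3 G :=
      (cnt3_swap (fun x y z => G x z y)).trans e2
    have a0 : cnt3 (Tri H) ≤ cnt3 (fun x y z => N x y z ∨ G x y z ∨ G x z y ∨ G y z x) :=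
      cnt3_mono fun x y z h => by
        simp only [hNdef]
        tauto
    have a1 := cnt3_or N (fun x y z => G x y z ∨ G x z y ∨ G y z x)
    have a2 := cnt3_or G (fun x y z => G x z y ∨ G y z x)
    have a3 := cnt3_or (fun x y z => G x z y) (fun x y z => G y z x)
    have a4 : cnt3 G ≤ _ := cnt3_type1_le _
    omega
  have h6 := six_mul_card_le h3
  have hadd := cnt2_not_add (fun x y => cd H x y = t)
  have hne : cnt2 (fun x y => ¬ cd H x y = t) ≤ (3 * t + 3 + m) * Fintype.card V := by
    have h7 : 3 * t * (Fintype.card V * Fintype.card V) =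
        3 * t * (Fintype.card V * (Fintype.card V - 1)) + 3 * t * Fintype.card V := by
      rcases Nat.eq_zero_or_pos (Fintype.card V) with h | h
      · simp [h]
      · obtain ⟨k, hk⟩ := Nat.exists_eq_add_of_lt h
        rw [hk]
        simp only [Nat.add_sub_cancel]
        ring
    have h8 : cnt2 (fun x y => ¬ cd H x y = t) ≤ 3 * t * cnt2 (fun x y => ¬ cd H x y = t) :=
      Nat.le_mul_of_pos_left _ (by omega)
    have h9 : 3 * t * cnt2 (fun x y => cd H x y = t) +
        3 * t * cnt2 (fun x y => ¬ cd H x y = t) =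
        3 * t * (Fintype.card V * Fintype.card V) := by rw [← mul_add, hadd]
    nlinarith
  have hgood : cnt2 (fun x y => ¬ Good t (9 * t ^ 2) H x y) ≤
      cnt2 (fun x y => ¬ cd H x y = t ∨ ∃ z, N x y z) := by
    refine cnt2_mono fun x y h => ?_
    by_cases hc : cd H x y = t
    · right
      unfold Good at h
      push Not at h
      obtain ⟨z, hz, hzB⟩ := h hc
      refine ⟨z, mem_nb.1 hz, ?_⟩
      have hx := cd_comm (H := H) y x
      rintro (⟨g0, g1, g2, g4⟩ | ⟨g0, g1, g2, g4⟩ | ⟨g0, g1, g2, g4⟩)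
      · have := hzB g2
        omega
      · omega
      · omega
    · exact Or.inl hc
  have := cnt2_or (fun x y => ¬ cd H x y = t) (fun x y => ∃ z, N x y z)
  have := cnt2_exists_le N
  linarith

end Weights

/-! ### Cores -/

section Cores

variable {V : Type*} [Fintype V] [DecidableEq V]

/-- The standing assumptions on the hypergraph and the parameters. -/
structure Admissible (t B : ℕ) (H : Finset (Finset V)) : Prop where
  card_eq : ∀ e ∈ H, e.card = 3
  fan_free : ¬ ContainsFanExp t H
  one_lt : 1 < t
  le_bound : 5 * t ≤ B

/-- A pair of large codegree. -/
def Heavy (B : ℕ) (H : Finset (Finset V)) (x y : V) : Prop := B < cd H x y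

open Classical in
/-- The vertices that do not form a good pair with `v`. -/
noncomputable def notGood (t B : ℕ) (H : Finset (Finset V)) (v : V) : Finset V :=
  Finset.univ.filter fun y => ¬ Good t B H v y

/-- A set that is the common neighbourhood of `m` disjoint good pairs. -/
def Core (t B : ℕ) (H : Finset (Finset V)) (m : ℕ) (U : Finset V) : Prop :=
  ∃ Q : Finset (V × V), Q.card = m ∧ (∀ p ∈ Q, ∀ q ∈ Q, p ≠ q → Sep p q) ∧
    ∀ p ∈ Q, Good t B H p.1 p.2 ∧ nb H p.1 p.2 = U

variable {H : Finset (Finset V)} {t B m : ℕ}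

theorem Heavy.symm {x y : V} (h : Heavy B H x y) : Heavy B H y x := by
  rwa [Heavy, cd_comm]

theorem Good.symm {x y : V} (h : Good t B H x y) : Good t B H y x :=
  ⟨(cd_comm _ _).trans h.1, fun z hz => (h.2 z (by rwa [nb_comm])).symm⟩

theorem mem_notGood {x y : V} : y ∈ notGood t B H x ↔ ¬ Good t B H x y := by simp [notGood]

theorem sum_card_notGood :
    ∑ x : V, (notGood t B H x).card = cnt2 (fun x y => ¬ Good t B H x y) := by
  classical
  rw [cnt2_eq_sum]
  refine Finset.sum_congr rfl fun x _ => ?_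
  congr 1

theorem Heavy.ne (hA : Admissible t B H) {x y : V} (h : Heavy B H x y) : x ≠ y := by
  rintro rfl
  have := cd_self hA.card_eq x
  unfold Heavy at h
  omega

theorem Heavy.not_good (hA : Admissible t B H) {x y : V} (h : Heavy B H x y) :
    ¬ Good t B H x y := by
  intro hg
  have h1 := hg.1
  have h2 := hA.le_bound
  unfold Heavy at h
  omega

theorem Core.card_eq (hm : 0 < m) {U : Finset V} (h : Core t B H m U) : U.card = t := by
  obtain ⟨Q, hQ, -, hg⟩ := h
  obtain ⟨p, hp⟩ := Finset.card_pos.1 (hQ ▸ hm)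
  rw [← (hg p hp).2]
  exact (hg p hp).1.1

/-- Pairs whose two vertices are heavy to the centre `w` can be completed to a fan as soon as
their expansion vertices are chosen. -/
theorem no_centred_fan (hA : Admissible t B H) {w : V} {Q : Finset (V × V)} (hQ : Q.card = t)
    (hsep : ∀ p ∈ Q, ∀ q ∈ Q, p ≠ q → Sep p q)
    (hw : ∀ p ∈ Q, Heavy B H w p.1 ∧ Heavy B H w p.2) {f : V × V → V}
    (hinj : Set.InjOn f Q) (hmem : ∀ p ∈ Q, f p ∈ nb H p.1 p.2 ∧ f p ≠ w)
    (hav : ∀ p ∈ Q, ∀ q ∈ Q, p ≠ q → f p ≠ q.1 ∧ f p ≠ q.2) : False := by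
  have hB := hA.le_bound
  refine hA.fan_free (fan_of_partial_rep hA.card_eq (u := w) hQ hsep {2}
    (f := fun i => f i.1) ?_ ?_ ?_ ?_)
  · rintro ⟨p, k⟩ hp ⟨q, l⟩ hq h
    simp only [Finset.coe_product, Set.mem_prod, Finset.mem_coe, Finset.mem_singleton] at hp hq
    rw [Prod.mk.injEq]
    exact ⟨hinj hp.1 hq.1 h, hp.2.trans hq.2.symm⟩
  · intro p hp k hk
    rw [Finset.mem_singleton] at hk
    subst hk
    exact Finset.mem_erase.2 ⟨(hmem p hp).2, (hmem p hp).1⟩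
  · intro p hp q hq hpq k _
    exact hav p hp q hq hpq
  · intro p hp k hk
    obtain ⟨h1, h2⟩ := hw p hp
    unfold Heavy at h1 h2
    fin_cases k
    · exact (by omega : 5 * t + 1 ≤ cd H w p.1)
    · exact (by omega : 5 * t + 1 ≤ cd H w p.2)
    · exact absurd hk (by decide)

/-- Disjoint non-conflicting good pairs that are heavy to `w` have the same common neighbourhood,
which contains `w`. -/
theorem nb_eq_of_heavy (hA : Admissible t B H) {w : V} {Q : Finset (V × V)} (hQ : Q.card = t)
    (hsep : ∀ p ∈ Q, ∀ q ∈ Q, p ≠ q → Sep p q)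
    (hw : ∀ p ∈ Q, Heavy B H w p.1 ∧ Heavy B H w p.2)
    (hg : ∀ p ∈ Q, Good t B H p.1 p.2)
    (hav : ∀ p ∈ Q, ∀ q ∈ Q, p ≠ q → q.1 ∉ nb H p.1 p.2 ∧ q.2 ∉ nb H p.1 p.2) :
    (∀ p ∈ Q, w ∈ nb H p.1 p.2) ∧ ∀ p ∈ Q, ∀ q ∈ Q, nb H p.1 p.2 = nb H q.1 q.2 := by
  have : Nonempty V := ⟨w⟩
  set S : V × V → Finset V := fun p => (nb H p.1 p.2).erase w with hS
  have hSc : ∀ p ∈ Q, Q.card ≤ (S p).card + 1 := fun p hp => by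
    have h1 : (nb H p.1 p.2).card - 1 ≤ (S p).card := Finset.pred_card_le_card_erase
    have h2 : (nb H p.1 p.2).card = t := (hg p hp).1
    omega
  have hno : ¬ ∃ f : V × V → V, (∀ p ∈ Q, f p ∈ S p) ∧ Set.InjOn f Q := by
    rintro ⟨f, hf, hinj⟩
    have hf' : ∀ p ∈ Q, f p ∈ nb H p.1 p.2 ∧ f p ≠ w := fun p hp => by
      have := Finset.mem_erase.1 (hf p hp)
      exact ⟨this.2, this.1⟩
    refine no_centred_fan hA hQ hsep hw hinj hf' ?_
    intro p hp q hq hpq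
    obtain ⟨g1, g2⟩ := hav p hp q hq hpq
    exact ⟨fun h => g1 (h ▸ (hf' p hp).1), fun h => g2 (h ▸ (hf' p hp).1)⟩
  have heq : ∀ p ∈ Q, ∀ q ∈ Q, S p = S q := fun p hp q hq => by
    by_contra hne
    exact hno (hall_of_ne Q S hSc hp hq hne)
  have hmem : ∀ p ∈ Q, w ∈ nb H p.1 p.2 := by
    intro p hp
    by_contra hnot
    have h1 : (S p).card = t := by
      rw [hS]
      simp only
      rw [Finset.erase_eq_of_notMem hnot]
      exact (hg p hp).1
    obtain ⟨f, hf, hinj⟩ := greedy Q S ∅ (fun q hq => by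
      rw [← heq p hp q hq, h1, hQ]
      simp)
    exact hno ⟨f, fun q hq => (hf q hq).1, hinj⟩
  refine ⟨hmem, fun p hp q hq => ?_⟩
  rw [← Finset.insert_erase (hmem p hp), ← Finset.insert_erase (hmem q hq)]
  exact congrArg _ (heq p hp q hq)

theorem Core.heavy {U : Finset V} {Q : Finset (V × V)}
    (hg : ∀ p ∈ Q, Good t B H p.1 p.2 ∧ nb H p.1 p.2 = U) {w : V} (hw : w ∈ U) {p : V × V}
    (hp : p ∈ Q) : Heavy B H w p.1 ∧ Heavy B H w p.2 := by
  obtain ⟨h1, h2⟩ := hg p hp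
  obtain ⟨h4, h5⟩ := h1.2 w (h2 ▸ hw)
  exact ⟨Heavy.symm h4, Heavy.symm h5⟩

/-- A good pair that is heavy to some vertex of a core has the core as its neighbourhood. -/
theorem Core.nb_eq (hA : Admissible t B H) (hm : 2 * t + 1 ≤ m) {U : Finset V}
    (hU : Core t B H m U) {w y z : V} (hw : w ∈ U) (hyz : Good t B H y z)
    (hy : Heavy B H w y) (hz : Heavy B H w z) (hyU : y ∉ U) (hzU : z ∉ U) : nb H y z = U := by
  have ht := hA.one_lt
  obtain ⟨Q, hQ, hsep, hg⟩ := hU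
  have hX : (insert y (insert z (nb H y z))).card ≤ t + 2 := by
    have h1 := Finset.card_insert_le y (insert z (nb H y z))
    have h2 := Finset.card_insert_le z (nb H y z)
    have h3 : (nb H y z).card = t := hyz.1
    omega
  obtain ⟨P, hPQ, hPc, hP⟩ := exists_pool_avoiding hsep
    (X := insert y (insert z (nb H y z))) (r := t - 1) (by omega)
  simp only [Finset.mem_insert, not_or] at hP
  have hnot : (y, z) ∉ P := fun h => (hP _ h).1.1 rfl
  have hsepP : ∀ p ∈ P, Sep (y, z) p := fun p hp =>
    ⟨Ne.symm (hP p hp).1.1, Ne.symm (hP p hp).2.1, Ne.symm (hP p hp).1.2.1,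
      Ne.symm (hP p hp).2.2.1⟩
  have hmemU : ∀ p ∈ P, p.1 ∉ U ∧ p.2 ∉ U := fun p hp =>
    ⟨fun h => ((Core.heavy hg h (hPQ hp)).1.ne hA) rfl,
      fun h => ((Core.heavy hg h (hPQ hp)).2.ne hA) rfl⟩
  obtain ⟨-, hall⟩ := nb_eq_of_heavy hA (w := w) (Q := insert (y, z) P)
    (by rw [Finset.card_insert_of_notMem hnot, hPc]; omega)
    (by
      intro p hp q hq hpq
      rcases Finset.mem_insert.1 hp with rfl | hp <;> rcases Finset.mem_insert.1 hq with rfl | hq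
      · exact absurd rfl hpq
      · exact hsepP q hq
      · exact (hsepP p hp).symm
      · exact hsep p (hPQ hp) q (hPQ hq) hpq)
    (by
      intro p hp
      rcases Finset.mem_insert.1 hp with rfl | hp
      · exact ⟨hy, hz⟩
      · exact Core.heavy hg hw (hPQ hp))
    (by
      intro p hp
      rcases Finset.mem_insert.1 hp with rfl | hp
      · exact hyz
      · exact (hg p (hPQ hp)).1)
    (by
      intro p hp q hq hpq
      rcases Finset.mem_insert.1 hp with rfl | hp <;> rcases Finset.mem_insert.1 hq with rfl | hq
      · exact absurd rfl hpq
      · exact ⟨(hP q hq).1.2.2, (hP q hq).2.2.2⟩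
      · rw [(hg p (hPQ hp)).2]
        exact ⟨hyU, hzU⟩
      · rw [(hg p (hPQ hp)).2]
        exact hmemU q hq)
  obtain ⟨p, hp⟩ : P.Nonempty := Finset.card_pos.1 (by omega)
  rw [hall (y, z) (Finset.mem_insert_self _ _) p (Finset.mem_insert_of_mem hp)]
  exact (hg p (hPQ hp)).2

/-- A vertex of a core makes few good pairs. -/
theorem Core.card_notGood_ge (hA : Admissible t B H) {U : Finset V} (hU : Core t B H m U) {w : V}
    (hw : w ∈ U) : m ≤ (notGood t B H w).card := by
  obtain ⟨Q, hQ, hsep, hg⟩ := hU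
  rw [← hQ]
  refine Finset.card_le_card_of_injOn Prod.fst ?_ ?_
  · intro p hp
    exact mem_notGood.2 ((Core.heavy hg hw hp).1.not_good hA)
  · intro p hp q hq h
    by_contra hne
    exact (hsep p hp q hq hne).1 h

/-- Among vertices heavy to `w`, there is a core containing `w` or few good pairs. -/
theorem exists_core_or_cover (hA : Admissible t B H) (hm : t ≤ m) {w : V} {X : Finset V}
    (hX : ∀ x ∈ X, Heavy B H w x) :
    (∃ U, Core t B H m U ∧ w ∈ U ∧ ∃ y ∈ X, ∃ z ∈ X, Good t B H y z ∧ nb H y z = U) ∨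
    ∃ C : Finset V, C.card ≤ 2 * (m * (2 * t + 1)) ∧
      ∀ x ∈ X, ∀ y ∈ X, Good t B H x y → x ∈ C ∨ y ∈ C := by
  have ht := hA.one_lt
  rcases exists_pool_or_cover (fun x y => x ∈ X ∧ y ∈ X ∧ Good t B H x y)
    (fun p => nb H p.1 p.2) t m (fun x y h => h.2.2.1.le) with ⟨Q, hQ, hL, hsep, hav⟩ | ⟨C, h1, h2⟩
  · left
    have key : ∀ P ⊆ Q, P.card = t → (∀ p ∈ P, w ∈ nb H p.1 p.2) ∧
        ∀ p ∈ P, ∀ q ∈ P, nb H p.1 p.2 = nb H q.1 q.2 := fun P hP hPc =>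
      nb_eq_of_heavy hA hPc (fun p hp q hq => hsep p (hP hp) q (hP hq))
        (fun p hp => ⟨hX _ (hL p (hP hp)).1, hX _ (hL p (hP hp)).2.1⟩)
        (fun p hp => (hL p (hP hp)).2.2) (fun p hp q hq => hav p (hP hp) q (hP hq))
    have key2 : ∀ p ∈ Q, ∀ q ∈ Q, w ∈ nb H p.1 p.2 ∧ nb H p.1 p.2 = nb H q.1 q.2 := by
      intro p hp q hq
      obtain ⟨P, hP1, hP2, hPc⟩ := Finset.exists_subsuperset_card_eq (s := {p, q}) (t := Q) (n := t)
        (by intro x hx; simp only [Finset.mem_insert, Finset.mem_singleton] at hx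
            rcases hx with rfl | rfl <;> assumption)
        (Finset.card_le_two.trans ht) (hQ ▸ hm)
      obtain ⟨k1, k2⟩ := key P hP2 hPc
      have hp' : p ∈ P := hP1 (by simp)
      have hq' : q ∈ P := hP1 (by simp)
      exact ⟨k1 p hp', k2 p hp' q hq'⟩
    obtain ⟨p, hp⟩ : Q.Nonempty := Finset.card_pos.1 (by omega)
    refine ⟨nb H p.1 p.2, ⟨Q, hQ, hsep, fun q hq => ⟨(hL q hq).2.2, (key2 q hq p hp).2⟩⟩,
      (key2 p hp p hp).1, p.1, (hL p hp).1, p.2, (hL p hp).2.1, (hL p hp).2.2, rfl⟩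
  · exact Or.inr ⟨C, h1, fun x hx y hy h => h2 x y ⟨hx, hy, h⟩⟩

/-- The size of a set of typical vertices that ensures a core. -/
def coreSize (t m D : ℕ) : ℕ := 2 * (m * (2 * t + 1)) + D + 1

theorem exists_core (hA : Admissible t B H) (hm : t ≤ m) {D : ℕ} {w : V} {X : Finset V}
    (hX : ∀ x ∈ X, Heavy B H w x) (hD : ∀ x ∈ X, (notGood t B H x).card ≤ D)
    (hc : coreSize t m D ≤ X.card) :
    ∃ U, Core t B H m U ∧ w ∈ U ∧ ∃ y ∈ X, ∃ z ∈ X, Good t B H y z ∧ nb H y z = U := by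
  refine (exists_core_or_cover hA hm hX).resolve_right ?_
  rintro ⟨C, hC, hcov⟩
  have h1 := Finset.le_card_sdiff C X
  unfold coreSize at hc
  obtain ⟨x, hx⟩ : (X \ C).Nonempty := Finset.card_pos.1 (by omega)
  rw [Finset.mem_sdiff] at hx
  have h2 : X \ C ⊆ notGood t B H x := by
    intro y hy
    rw [Finset.mem_sdiff] at hy
    refine mem_notGood.2 fun hg => ?_
    rcases hcov x hx.1 y hy.1 hg with h | h
    exacts [hx.2 h, hy.2 h]
  have h4 := Finset.card_le_card h2
  have h5 := hD x hx.1
  omega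

theorem Core.notMem (hA : Admissible t B H) {D : ℕ} (hD : D < m) {U : Finset V}
    (hU : Core t B H m U) {x : V} (hx : (notGood t B H x).card ≤ D) : x ∉ U := fun h => by
  have := hU.card_notGood_ge hA h
  omega

open Classical in
/-- The typical vertices. -/
noncomputable def typical (t B : ℕ) (H : Finset (Finset V)) (D : ℕ) : Finset V :=
  Finset.univ.filter fun x => (notGood t B H x).card ≤ D

theorem mem_typical {D : ℕ} {x : V} :
    x ∈ typical t B H D ↔ (notGood t B H x).card ≤ D := by simp [typical]

/-- A typical vertex forms core pairs with almost all typical vertices. -/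
theorem card_not_core_le (hA : Admissible t B H) {D : ℕ} (hm : 2 * t + 1 ≤ m) (hD : D < m)
    {x : V} (hx : x ∈ typical t B H D) (Z : Finset V) (hZ : Z ⊆ typical t B H D)
    (hZx : ∀ y ∈ Z, ¬ (Good t B H x y ∧ Core t B H m (nb H x y))) :
    Z.card ≤ D + D * coreSize t m D := by
  classical
  have ht := hA.one_lt
  have hxD := mem_typical.1 hx
  have hsub : Z ⊆ notGood t B H x ∪ (notGood t B H x).biUnion (fun w =>
      if (Z.filter fun y => Heavy B H w y).card ≤ coreSize t m D
      then Z.filter fun y => Heavy B H w y else ∅) := by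
    intro y hy
    rw [Finset.mem_union]
    by_cases hg : Good t B H x y
    · right
      have hcore := fun h => hZx y hy ⟨hg, h⟩
      obtain ⟨w, hw⟩ : (nb H x y).Nonempty := Finset.card_pos.1 (by
        have : (nb H x y).card = t := hg.1
        omega)
      have hxw : Heavy B H x w := (hg.2 w hw).1
      have hyw : Heavy B H y w := (hg.2 w hw).2
      refine Finset.mem_biUnion.2 ⟨w, mem_notGood.2 (hxw.not_good hA), ?_⟩
      split_ifs with hle
      · exact Finset.mem_filter.2 ⟨hy, hyw.symm⟩
      · exfalso
        obtain ⟨U, hU, hwU, -⟩ := exists_core hA (m := m) (D := D) (w := w)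
          (X := Z.filter fun y => Heavy B H w y) (by omega)
          (fun z hz => (Finset.mem_filter.1 hz).2)
          (fun z hz => mem_typical.1 (hZ (Finset.mem_filter.1 hz).1)) (by omega)
        have := hU.nb_eq hA hm hwU hg hxw.symm hyw.symm (hU.notMem hA hD hxD)
          (hU.notMem hA hD (mem_typical.1 (hZ hy)))
        exact hcore (this ▸ hU)
    · exact Or.inl (mem_notGood.2 hg)
  refine (Finset.card_le_card hsub).trans ((Finset.card_union_le _ _).trans ?_)
  refine add_le_add hxD ((Finset.card_biUnion_le_card_mul _ _ (coreSize t m D) ?_).trans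
    (Nat.mul_le_mul_right _ hxD))
  intro w _
  split_ifs with h
  · exact h
  · simp

/-- The number of exceptions in `card_nb_ne_le`. -/
def excSize (t m D : ℕ) : ℕ :=
  D + D * coreSize t m D + D * (D + D * coreSize t m D + D * coreSize t m D)

/-- A typical vertex has the same neighbourhood with almost all typical vertices. -/
theorem card_nb_ne_le (hA : Admissible t B H) {D : ℕ} (hm : 2 * t + 1 ≤ m) (hD : D < m)
    {x y₁ : V} (hx : x ∈ typical t B H D) (hy₁ : y₁ ∈ typical t B H D)
    (hg₁ : Good t B H x y₁) (Z : Finset V) (hZ : Z ⊆ typical t B H D)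
    (hZx : ∀ y ∈ Z, ¬ (Good t B H x y ∧ nb H x y = nb H x y₁)) :
    Z.card ≤ excSize t m D := by
  classical
  have ht := hA.one_lt
  have hxD := mem_typical.1 hx
  have hTU : ∀ {U : Finset V}, Core t B H m U → ∀ {v}, v ∈ typical t B H D → v ∉ U :=
    fun hU _ hv => hU.notMem hA hD (mem_typical.1 hv)
  set P : V → Prop := fun y => Good t B H x y ∧ Core t B H m (nb H x y) with hP
  have h1 : (Z.filter fun y => ¬ P y).card ≤ D + D * coreSize t m D :=
    card_not_core_le hA hm hD hx _ ((Finset.filter_subset _ _).trans hZ)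
      fun y hy => (Finset.mem_filter.1 hy).2
  have h2 : (Z.filter P).card ≤ D * (D + D * coreSize t m D + D * coreSize t m D) := by
    have hsub : Z.filter P ⊆ (notGood t B H x).biUnion
        (fun w => (Z.filter P).filter fun y => w ∈ nb H x y) := by
      intro y hy
      have hg := (Finset.mem_filter.1 hy).2.1
      obtain ⟨w, hw⟩ : (nb H x y).Nonempty := Finset.card_pos.1 (by
        have : (nb H x y).card = t := hg.1
        omega)
      exact Finset.mem_biUnion.2 ⟨w, mem_notGood.2 (Heavy.not_good hA (hg.2 w hw).1),
        Finset.mem_filter.2 ⟨hy, hw⟩⟩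
    refine (Finset.card_le_card hsub).trans ((Finset.card_biUnion_le_card_mul _ _ _ ?_).trans
      (Nat.mul_le_mul_right _ hxD))
    intro w _
    set Y := (Z.filter P).filter fun y => w ∈ nb H x y with hY
    have hYm : ∀ y ∈ Y, y ∈ Z ∧ Good t B H x y ∧ Core t B H m (nb H x y) ∧ w ∈ nb H x y := by
      intro y hy
      rw [hY, Finset.mem_filter, Finset.mem_filter] at hy
      exact ⟨hy.1.1, hy.1.2.1, hy.1.2.2, hy.2⟩
    set P₁ : V → Prop := fun y => Good t B H y₁ y ∧ Core t B H m (nb H y₁ y) with hP₁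
    have hYT : Y ⊆ typical t B H D := fun y hy => hZ (hYm y hy).1
    have h4 : (Y.filter fun y => ¬ P₁ y).card ≤ D + D * coreSize t m D :=
      card_not_core_le hA hm hD hy₁ _ ((Finset.filter_subset _ _).trans hYT)
        fun y hy => (Finset.mem_filter.1 hy).2
    have h5 : (Y.filter P₁).card ≤ D * coreSize t m D := by
      have hsub : Y.filter P₁ ⊆ (notGood t B H y₁).biUnion
          (fun w => (Y.filter P₁).filter fun y => w ∈ nb H y₁ y) := by
        intro y hy
        have hg := (Finset.mem_filter.1 hy).2.1
        obtain ⟨w, hw⟩ : (nb H y₁ y).Nonempty := Finset.card_pos.1 (by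
          have : (nb H y₁ y).card = t := hg.1
          omega)
        exact Finset.mem_biUnion.2 ⟨w, mem_notGood.2 (Heavy.not_good hA (hg.2 w hw).1),
          Finset.mem_filter.2 ⟨hy, hw⟩⟩
      refine (Finset.card_le_card hsub).trans ((Finset.card_biUnion_le_card_mul _ _ _ ?_).trans
        (Nat.mul_le_mul_right _ (mem_typical.1 hy₁)))
      intro v _
      by_contra! hlt
      set X := (Y.filter P₁).filter fun y => v ∈ nb H y₁ y with hX
      have hXm : ∀ y ∈ X, y ∈ Y ∧ Good t B H y₁ y ∧ v ∈ nb H y₁ y := by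
        intro y hy
        rw [hX, Finset.mem_filter, Finset.mem_filter] at hy
        exact ⟨hy.1.1, hy.1.2.1, hy.2⟩
      obtain ⟨U, hU, hvU, y, hy, z, hz, hyz, hyzU⟩ := exists_core hA (m := m) (D := D) (w := v)
        (X := X) (by omega)
        (fun z hz => Heavy.symm ((hXm z hz).2.1.2 v (hXm z hz).2.2).2)
        (fun z hz => mem_typical.1 (hYT (hXm z hz).1)) hlt.le
      obtain ⟨hyY, hgy, hvy⟩ := hXm y hy
      obtain ⟨hzY, hgz, hvz⟩ := hXm z hz
      obtain ⟨hyZ, hxy, hcy, hwy⟩ := hYm y hyY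
      obtain ⟨hzZ, hxz, hcz, hwz⟩ := hYm z hzY
      have e1 : nb H y z = nb H x y := hcy.nb_eq hA hm hwy hyz
        (Heavy.symm (hxy.2 w hwy).2) (Heavy.symm (hxz.2 w hwz).2)
        (hTU hcy (hYT hyY)) (hTU hcy (hYT hzY))
      have hvxy : v ∈ nb H x y := by rw [← e1, hyzU]; exact hvU
      have e2 : nb H x y₁ = nb H x y := hcy.nb_eq hA hm hvxy hg₁
        (Heavy.symm (hxy.2 v hvxy).1) (Heavy.symm (hgy.2 v hvy).1)
        (hTU hcy hx) (hTU hcy hy₁)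
      exact hZx y hyZ ⟨hxy, e2.symm⟩
    have h6 := Finset.card_filter_add_card_filter_not (s := Y) P₁
    omega
  have h4 := Finset.card_filter_add_card_filter_not (s := Z) P
  unfold excSize
  omega

theorem card_not_typical_le (D c : ℕ)
    (hc : cnt2 (fun x y => ¬ Good t B H x y) ≤ c * Fintype.card V) :
    (D + 1) * (Finset.univ \ typical t B H D).card ≤ c * Fintype.card V := by
  refine le_trans ?_ hc
  rw [← sum_card_notGood, mul_comm, ← smul_eq_mul]
  refine (Finset.card_nsmul_le_sum _ (fun x => (notGood t B H x).card) _ fun x hx => ?_).trans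
    (Finset.sum_le_sum_of_subset (Finset.subset_univ _))
  have := (Finset.mem_sdiff.1 hx).2
  rw [mem_typical] at this
  omega

open Classical in
/-- The vertices outside `U` that are not heavy to `w`. -/
noncomputable def lightSet (B : ℕ) (H : Finset (Finset V)) (U : Finset V) (w : V) : Finset V :=
  Finset.univ.filter fun v => v ∉ U ∧ ¬ Heavy B H w v

theorem mem_lightSet {U : Finset V} {w v : V} :
    v ∈ lightSet B H U w ↔ v ∉ U ∧ ¬ Heavy B H w v := by simp [lightSet]

theorem card_le_of_mem_lightSet (hA : Admissible t B H) {D : ℕ} (hm : 2 * t + 1 ≤ m) (hD : D < m)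
    {U : Finset V} (hU : Core t B H m U) {T : Finset V} (hT : T ⊆ typical t B H D)
    (hTU : ∀ y ∈ T, ∀ w ∈ U, Heavy B H w y) {w l : V} (hw : w ∈ U) (hl : l ∈ lightSet B H U w) :
    T.card ≤ (1 + coreSize t m D) * (notGood t B H l).card := by
  classical
  obtain ⟨hlU, hlw⟩ := mem_lightSet.1 hl
  have hsub : T ⊆ notGood t B H l ∪ (notGood t B H l).biUnion (fun z =>
      if (T.filter fun y => Heavy B H z y).card ≤ coreSize t m D
      then T.filter fun y => Heavy B H z y else ∅) := by
    intro y hy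
    rw [Finset.mem_union]
    by_cases hg : Good t B H l y
    · right
      have hwn : w ∉ nb H l y := fun h => hlw (Heavy.symm (hg.2 w h).1)
      obtain ⟨z, hz, hzU⟩ : ∃ z ∈ nb H l y, z ∉ U := by
        by_contra! hcon
        have h1 : nb H l y = U := Finset.eq_of_subset_of_card_le hcon (by
          rw [hU.card_eq (by omega)]
          exact hg.1.ge)
        exact hwn (h1 ▸ hw)
      have hlz : Heavy B H l z := (hg.2 z hz).1
      have hyz : Heavy B H y z := (hg.2 z hz).2
      refine Finset.mem_biUnion.2 ⟨z, mem_notGood.2 (hlz.not_good hA), ?_⟩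
      split_ifs with hle
      · exact Finset.mem_filter.2 ⟨hy, hyz.symm⟩
      · exfalso
        obtain ⟨U', hU', hzU', a, ha, b, hb, hab, habU⟩ := exists_core hA (m := m) (D := D) (w := z)
          (X := T.filter fun y => Heavy B H z y) (by omega)
          (fun z hz => (Finset.mem_filter.1 hz).2)
          (fun z hz => mem_typical.1 (hT (Finset.mem_filter.1 hz).1)) (by omega)
        have haT := (Finset.mem_filter.1 ha).1
        have hbT := (Finset.mem_filter.1 hb).1
        have := hU.nb_eq hA hm hw hab (hTU a haT w hw) (hTU b hbT w hw)
          (hU.notMem hA hD (mem_typical.1 (hT haT))) (hU.notMem hA hD (mem_typical.1 (hT hbT)))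
        exact hzU (this ▸ habU ▸ hzU')
    · exact Or.inl (mem_notGood.2 hg)
  refine (Finset.card_le_card hsub).trans ((Finset.card_union_le _ _).trans ?_)
  have := Finset.card_biUnion_le_card_mul (notGood t B H l) (fun z =>
      if (T.filter fun y => Heavy B H z y).card ≤ coreSize t m D
      then T.filter fun y => Heavy B H z y else ∅) (coreSize t m D) (by
    intro w _
    split_ifs with h
    · exact h
    · simp)
  linarith

/-- There is a core to which almost all vertices are heavy. -/
theorem exists_dominating_core (t B c : ℕ) : ∃ N b : ℕ, ∀ (V : Type) [Fintype V] [DecidableEq V]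
    (H : Finset (Finset V)), Admissible t B H → N ≤ Fintype.card V →
    cnt2 (fun x y => ¬ Good t B H x y) ≤ c * Fintype.card V →
    ∃ U, Core t B H (2 * t + 1 + 4 * c) U ∧ ∀ w ∈ U, (lightSet B H U w).card ≤ b := by
  classical
  set D := 4 * c with hDdef
  set m := 2 * t + 1 + 4 * c with hm
  refine ⟨4 * (excSize t m D + D + D * coreSize t m D + 1), 2 * ((1 + coreSize t m D) * c),
    fun V _ _ H hA hN hc => ?_⟩
  have hT := card_not_typical_le (H := H) D c hc
  have hTc : (Finset.univ \ typical t B H D).card + (typical t B H D).card = Fintype.card V := by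
    rw [← Finset.card_univ]
    exact Finset.card_sdiff_add_card_eq_card (Finset.subset_univ _)
  have h4 : 4 * (Finset.univ \ typical t B H D).card ≤ Fintype.card V := by
    rcases Nat.eq_zero_or_pos c with h | h
    · rw [hDdef, h] at hT
      rw [hDdef, h]
      omega
    · refine Nat.le_of_mul_le_mul_left (le_trans ?_ hT) h
      calc c * (4 * (Finset.univ \ typical t B H D).card)
          = D * (Finset.univ \ typical t B H D).card := by rw [hDdef]; ring
        _ ≤ _ := Nat.mul_le_mul_right _ (by omega)
  obtain ⟨x, hx⟩ : (typical t B H D).Nonempty := Finset.card_pos.1 (by omega)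
  obtain ⟨y₁, hy₁, hg, hU⟩ : ∃ y ∈ typical t B H D, Good t B H x y ∧
      Core t B H m (nb H x y) := by
    by_contra! hcon
    have := card_not_core_le hA (m := m) (by omega) (by omega : D < m) hx _ subset_rfl
      fun y hy h => hcon y hy h.1 h.2
    omega
  refine ⟨nb H x y₁, hU, fun w hw => ?_⟩
  set T := (typical t B H D).filter fun y => Good t B H x y ∧ nb H x y = nb H x y₁ with hTdef
  have h5 := card_nb_ne_le hA (m := m) (by omega) (by omega : D < m) hx hy₁ hg
    ((typical t B H D).filter fun y => ¬ (Good t B H x y ∧ nb H x y = nb H x y₁))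
    (Finset.filter_subset _ _) fun y hy => (Finset.mem_filter.1 hy).2
  have h6 := Finset.card_filter_add_card_filter_not (s := typical t B H D)
    (fun y => Good t B H x y ∧ nb H x y = nb H x y₁)
  rw [← hTdef] at h6
  have h7 : Fintype.card V ≤ 2 * T.card := by omega
  have h8 : (lightSet B H (nb H x y₁) w).card * T.card ≤
      (1 + coreSize t m D) * (c * Fintype.card V) := by
    calc (lightSet B H (nb H x y₁) w).card * T.card
        ≤ ∑ l ∈ lightSet B H (nb H x y₁) w, (1 + coreSize t m D) * (notGood t B H l).card := by
          rw [← smul_eq_mul]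
          refine Finset.card_nsmul_le_sum _ _ _ fun l hl => ?_
          refine card_le_of_mem_lightSet hA (by omega) (by omega : D < m) hU
            (Finset.filter_subset _ _) ?_ hw hl
          intro y hy v hv
          obtain ⟨-, k1, k2⟩ := Finset.mem_filter.1 hy
          exact Heavy.symm (k1.2 v (k2 ▸ hv)).2
      _ ≤ ∑ l : V, (1 + coreSize t m D) * (notGood t B H l).card :=
          Finset.sum_le_sum_of_subset (Finset.subset_univ _)
      _ ≤ _ := by
          rw [← Finset.mul_sum, sum_card_notGood]
          exact Nat.mul_le_mul_left _ hc
  refine Nat.le_of_mul_le_mul_right (c := Fintype.card V) ?_ (by omega)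
  nlinarith

end Cores

/-! ### Counting hyperedges around a core -/

section Counting

variable {V : Type*} [DecidableEq V] {H : Finset (Finset V)} {t B m : ℕ}

open Classical in
/-- The neighbours of the pair `l, v` in `L`. -/
noncomputable def nbIn (H : Finset (Finset V)) (L : Finset V) (l v : V) : Finset V :=
  L.filter fun y => Tri H l y v

theorem mem_nbIn {L : Finset V} {l v y : V} : y ∈ nbIn H L l v ↔ y ∈ L ∧ Tri H l y v := by
  simp [nbIn]

variable [Fintype V]

/-- A hyperedge disjoint from the core has at most one vertex heavy to a given core vertex. -/
theorem Core.not_heavy_of_tri (hA : Admissible t B H) (hm : 2 * t + 1 ≤ m) {U : Finset V}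
    (hU : Core t B H m U) {w x y z : V} (hw : w ∈ U) (h : Tri H x y z) (hx : x ∉ U) (hy : y ∉ U)
    (hz : z ∉ U) : ¬ (Heavy B H w x ∧ Heavy B H w y) := by
  rintro ⟨hwx, hwy⟩
  have : Nonempty V := ⟨w⟩
  have ht := hA.one_lt
  have hUc := hU.card_eq (by omega)
  obtain ⟨Q, hQ, hsep, hg⟩ := hU
  obtain ⟨P, hPQ, hPc, hP⟩ := exists_pool_avoiding hsep (X := {x, y, z}) (r := t - 1) (by
    have : ({x, y, z} : Finset V).card ≤ 3 := Finset.card_le_three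
    omega)
  simp only [Finset.mem_insert, Finset.mem_singleton, not_or] at hP
  have hnot : (x, y) ∉ P := fun h => (hP _ h).1.1 rfl
  obtain ⟨f, hf, hinj⟩ := greedy P (fun _ => U.erase w) ∅ (fun p _ => by
    rw [Finset.card_erase_of_mem hw, hUc, hPc]
    simp)
  have hfU : ∀ p ∈ P, f p ∈ U ∧ f p ≠ w := fun p hp =>
    ⟨Finset.mem_of_mem_erase (hf p hp).1, Finset.ne_of_mem_erase (hf p hp).1⟩
  have hne : ∀ p ∈ P, p ≠ (x, y) := fun p hp h => hnot (h ▸ hp)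
  refine no_centred_fan hA (w := w) (Q := insert (x, y) P) (f := Function.update f (x, y) z)
    (by rw [Finset.card_insert_of_notMem hnot, hPc]; omega) ?_ ?_ ?_ ?_ ?_
  · intro p hp q hq hpq
    have hs : ∀ p ∈ P, Sep (x, y) p := fun p hp =>
      ⟨Ne.symm (hP p hp).1.1, Ne.symm (hP p hp).2.1, Ne.symm (hP p hp).1.2.1,
        Ne.symm (hP p hp).2.2.1⟩
    rcases Finset.mem_insert.1 hp with rfl | hp <;> rcases Finset.mem_insert.1 hq with rfl | hq
    · exact absurd rfl hpq
    · exact hs q hq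
    · exact (hs p hp).symm
    · exact hsep p (hPQ hp) q (hPQ hq) hpq
  · intro p hp
    rcases Finset.mem_insert.1 hp with rfl | hp
    · exact ⟨hwx, hwy⟩
    · exact Core.heavy hg hw (hPQ hp)
  · intro p hp q hq hpq
    rcases Finset.mem_insert.1 hp with rfl | hp <;> rcases Finset.mem_insert.1 hq with rfl | hq
    · rfl
    · rw [Function.update_self, Function.update_of_ne (hne q hq)] at hpq
      exact absurd (hpq ▸ (hfU q hq).1) hz
    · rw [Function.update_self, Function.update_of_ne (hne p hp)] at hpq
      exact absurd (hpq ▸ (hfU p hp).1) hz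
    · rw [Function.update_of_ne (hne p hp), Function.update_of_ne (hne q hq)] at hpq
      exact hinj hp hq hpq
  · intro p hp
    rcases Finset.mem_insert.1 hp with rfl | hp
    · rw [Function.update_self]
      exact ⟨mem_nb.2 h, fun h => hz (h ▸ hw)⟩
    · rw [Function.update_of_ne (hne p hp), (hg p (hPQ hp)).2]
      exact hfU p hp
  · intro p hp q hq hpq
    rcases Finset.mem_insert.1 hp with rfl | hp <;> rcases Finset.mem_insert.1 hq with rfl | hq
    · exact absurd rfl hpq
    · rw [Function.update_self]
      exact ⟨Ne.symm (hP q hq).1.2.2, Ne.symm (hP q hq).2.2.2⟩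
    · rw [Function.update_of_ne (hne p hp)]
      exact ⟨fun h => hx ((show f p = x from h) ▸ (hfU p hp).1),
        fun h => hy ((show f p = y from h) ▸ (hfU p hp).1)⟩
    · rw [Function.update_of_ne (hne p hp)]
      obtain ⟨h1, h2⟩ := Core.heavy hg (hfU p hp).1 (hPQ hq)
      exact ⟨h1.ne hA, h2.ne hA⟩

/-- Few vertices heavy to the whole core have large degree from `l` into a set `L`. -/
theorem Core.card_le_of_nbIn (hA : Admissible t B H) (hm : 2 * t + 1 ≤ m) {U : Finset V}
    (hU : Core t B H m U) {L X : Finset V} {l : V} (hl : l ∉ U) (hLU : Disjoint L U)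
    (hXU : Disjoint X U) (hXL : Disjoint X L) (hX : ∀ v ∈ X, ∀ w ∈ U, Heavy B H w v)
    (hd : ∀ v ∈ X, 2 * t ≤ (nbIn H L l v).card) {s : ℕ}
    (hs : cnt2 (fun x y => ¬ Good t B H x y) < (s + 1) * (s + 1)) : X.card ≤ 2 * t + s := by
  classical
  have ht := hA.one_lt
  have : Nonempty V := ⟨l⟩
  have hUc := hU.card_eq (by omega)
  obtain ⟨w, hw⟩ : U.Nonempty := Finset.card_pos.1 (by omega)
  rcases matching_or_cover (fun x y => x ∈ X ∧ y ∈ X ∧ Good t B H x y) t with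
    ⟨Q, hQ, hQX, hsep⟩ | ⟨C, hC, hcov⟩
  · exfalso
    have hnb : ∀ p ∈ Q, nb H p.1 p.2 = U := fun p hp => by
      obtain ⟨h1, h2, h4⟩ := hQX p hp
      exact hU.nb_eq hA hm hw h4 (hX _ h1 w hw) (hX _ h2 w hw)
        (Finset.disjoint_left.1 hXU h1) (Finset.disjoint_left.1 hXU h2)
    obtain ⟨g, hg, hginj⟩ := greedy Q (fun _ => U) ∅ (fun p _ => by simp [hQ, hUc])
    obtain ⟨f, hf, hfinj⟩ := greedy (Q ×ˢ ({0, 1} : Finset (Fin 3)))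
      (fun i => nbIn H L l (if i.2 = 0 then i.1.1 else i.1.2)) ∅ (by
        rintro ⟨p, k⟩ hp
        have hp' := hQX p (Finset.mem_product.1 hp).1
        rw [Finset.card_product, hQ]
        simp only [Finset.card_empty, zero_add]
        have h2 : ({0, 1} : Finset (Fin 3)).card = 2 := rfl
        rw [h2, mul_comm]
        split_ifs
        exacts [hd _ hp'.1, hd _ hp'.2.1])
    have hf0 : ∀ p ∈ Q, ∀ k : Fin 3, k ≠ 2 → f (p, k) ∈ L ∧
        Tri H l (f (p, k)) (if k = 0 then p.1 else p.2) := fun p hp k hk =>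
      mem_nbIn.1 (hf (p, k) (Finset.mem_product.2 ⟨hp, by
        revert hk
        fin_cases k <;> simp⟩)).1
    have hLne : ∀ {a b : V}, a ∈ L → b ∈ U → a ≠ b := fun ha hb h =>
      Finset.disjoint_left.1 hLU ha (h ▸ hb)
    have hXLne : ∀ {a b : V}, a ∈ L → b ∈ X → a ≠ b := fun ha hb h =>
      Finset.disjoint_left.1 hXL hb (h ▸ ha)
    have hXUne : ∀ {a b : V}, a ∈ U → b ∈ X → a ≠ b := fun ha hb h =>
      Finset.disjoint_left.1 hXU hb (h ▸ ha)
    refine hA.fan_free (fan_of_rep hA.card_eq (u := l) hQ hsep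
      (f := fun i => if i.2 = 2 then g i.1 else f i) ?_ ?_ ?_)
    · rintro ⟨p, k⟩ hp ⟨q, j⟩ hq h
      have hp' : p ∈ Q := by simpa using hp
      have hq' : q ∈ Q := by simpa using hq
      by_cases hk : k = 2 <;> by_cases hj : j = 2 <;> simp only [hk, hj, if_true, if_false] at h
      · rw [hk, hj, hginj hp' hq' h]
      · exact absurd h.symm (hLne (hf0 q hq' j hj).1 (hg p hp').1)
      · exact absurd h (hLne (hf0 p hp' k hk).1 (hg q hq').1)
      · refine hfinj ?_ ?_ h <;> simp only [Finset.coe_product, Set.mem_prod, Finset.mem_coe]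
        · exact ⟨hp', by revert hk; fin_cases k <;> simp⟩
        · exact ⟨hq', by revert hj; fin_cases j <;> simp⟩
    · intro p hp k
      obtain ⟨h1, h2, -⟩ := hQX p hp
      fin_cases k
      · obtain ⟨k1, k2⟩ := hf0 p hp 0 (by decide)
        exact Finset.mem_erase.2 ⟨hXLne k1 h2, mem_nb.2 k2.swap'⟩
      · obtain ⟨k1, k2⟩ := hf0 p hp 1 (by decide)
        exact Finset.mem_erase.2 ⟨hXLne k1 h1, mem_nb.2 k2.swap'⟩
      · have k1 := (hg p hp).1
        exact Finset.mem_erase.2 ⟨fun h => hl ((show g p = l from h) ▸ k1),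
          show g p ∈ nb H p.1 p.2 from (hnb p hp).symm ▸ k1⟩
    · intro p hp q hq _ k
      obtain ⟨h1, h2, -⟩ := hQX q hq
      by_cases hk : k = 2
      · simp only [hk, if_true]
        exact ⟨hXUne (hg p hp).1 h1, hXUne (hg p hp).1 h2⟩
      · simp only [hk, if_false]
        exact ⟨hXLne (hf0 p hp k hk).1 h1, hXLne (hf0 p hp k hk).1 h2⟩
  · by_contra! hlt
    have h1 := Finset.le_card_sdiff C X
    have h2 : s + 1 ≤ (X \ C).card := by omega
    have h4 : (X \ C).card * (X \ C).card ≤ cnt2 (fun x y => ¬ Good t B H x y) := by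
      rw [← Finset.card_product]
      refine Finset.card_le_card fun q hq => ?_
      simp only [Finset.mem_product, Finset.mem_sdiff] at hq
      simp only [Finset.mem_filter, Finset.mem_univ, true_and]
      intro hgood
      rcases hcov q.1 q.2 ⟨hq.1.1, hq.2.1, hgood⟩ with h | h
      exacts [hq.1.2 h, hq.2.2 h]
    have h5 := Nat.mul_le_mul h2 h2
    omega

/-- The degree of a core vertex is small if it has many light pairs. -/
theorem cnt2_tri_le (hA : Admissible t B H) {U : Finset V} {w : V} (hw : w ∈ U) :
    cnt2 (Tri H w) ≤ (Fintype.card V - 1 - (lightSet B H U w).card) *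
      (Fintype.card V - 1 - (lightSet B H U w).card) + 2 * ((lightSet B H U w).card * B) := by
  classical
  set L := lightSet B H U w with hL
  have hwL : w ∉ L := fun h => (mem_lightSet.1 h).1 hw
  set A : Finset V := Finset.univ \ insert w L with hAdef
  have hAc : A.card = Fintype.card V - 1 - L.card := by
    rw [hAdef, Finset.card_sdiff_of_subset (Finset.subset_univ _), Finset.card_insert_of_notMem hwL,
      Finset.card_univ]
    omega
  have h1 : cnt2 (fun v z => v ∈ A ∧ z ∈ A) ≤ A.card * A.card := by
    rw [← Finset.card_product]
    exact Finset.card_le_card fun q => by simp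
  have h2 : cnt2 (fun v z => v ∈ L ∧ Tri H w v z) ≤ L.card * B := by
    rw [cnt2_eq_sum, ← smul_eq_mul]
    have : ∀ v, (Finset.univ.filter fun z => v ∈ L ∧ Tri H w v z).card ≤
        if v ∈ L then B else 0 := by
      intro v
      split_ifs with h
      · refine le_trans (Finset.card_le_card fun z hz => ?_) (not_lt.1 (mem_lightSet.1 h).2)
        exact mem_nb.2 (Finset.mem_filter.1 hz).2.2
      · simp [h]
    refine (Finset.sum_le_sum fun v _ => this v).trans ?_
    simp
  have h4 : cnt2 (Tri H w) ≤ cnt2 (fun v z => (v ∈ A ∧ z ∈ A) ∨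
      ((v ∈ L ∧ Tri H w v z) ∨ (z ∈ L ∧ Tri H w z v))) := by
    refine cnt2_mono fun v z h => ?_
    obtain ⟨n1, n2, -⟩ := h.ne hA.card_eq
    have h' : Tri H w z v := h.swap'
    simp only [hAdef, Finset.mem_sdiff, Finset.mem_univ, true_and, Finset.mem_insert, not_or]
    have := n1.symm
    have := n2.symm
    tauto
  have h5 := cnt2_or (fun v z => v ∈ A ∧ z ∈ A)
    (fun v z => (v ∈ L ∧ Tri H w v z) ∨ (z ∈ L ∧ Tri H w z v))
  have h6 := cnt2_or (fun v z => v ∈ L ∧ Tri H w v z) (fun v z => z ∈ L ∧ Tri H w z v)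
  have h7 := cnt2_swap (fun v z => v ∈ L ∧ Tri H w v z)
  rw [← hAc]
  omega

/-- The number of ordered hyperedges with two vertices in `L` and the third one outside of the
core. -/
theorem Core.cnt3_two_le (hA : Admissible t B H) (hm : 2 * t + 1 ≤ m) {U : Finset V}
    (hU : Core t B H m U) {b : ℕ} (hb : ∀ w ∈ U, (lightSet B H U w).card ≤ b) {w₀ : V}
    (hw₀ : w₀ ∈ U) {L : Finset V} (hL : L = lightSet B H U w₀) {s : ℕ}
    (hs : cnt2 (fun x y => ¬ Good t B H x y) < (s + 1) * (s + 1)) :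
    cnt3 (fun x z y => x ∈ L ∧ z ∉ U ∧ y ∈ nbIn H L x z) ≤
      L.card * ((t * b + (2 * t + s)) * L.card + Fintype.card V * (2 * t - 1)) := by
  classical
  have ht := hA.one_lt
  have hUc := hU.card_eq (by omega)
  have hLm : ∀ v ∈ L, v ∉ U := fun v hv => (mem_lightSet.1 (hL ▸ hv)).1
  rw [cnt3_eq_sum]
  have key : ∀ x, cnt2 (fun z y => x ∈ L ∧ z ∉ U ∧ y ∈ nbIn H L x z) ≤
      if x ∈ L then (t * b + (2 * t + s)) * L.card + Fintype.card V * (2 * t - 1) else 0 := by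
    intro x
    split_ifs with hx
    · set M := U.biUnion (lightSet B H U) with hM
      have hMc : M.card ≤ t * b := by
        rw [← hUc]
        exact Finset.card_biUnion_le_card_mul _ _ _ hb
      set X : Finset V := Finset.univ.filter fun v =>
        (v ∉ U ∧ ∀ w ∈ U, Heavy B H w v) ∧ 2 * t ≤ (nbIn H L x v).card with hX
      have hXm : ∀ v ∈ X, (v ∉ U ∧ ∀ w ∈ U, Heavy B H w v) ∧ 2 * t ≤ (nbIn H L x v).card :=
        fun v hv => (Finset.mem_filter.1 hv).2
      have hXc : X.card ≤ 2 * t + s := hU.card_le_of_nbIn hA hm (L := L) (l := x) (hLm x hx)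
        (Finset.disjoint_left.2 hLm) (Finset.disjoint_left.2 fun v hv => (hXm v hv).1.1)
        (Finset.disjoint_left.2 fun v hv h => (mem_lightSet.1 (hL ▸ h)).2 ((hXm v hv).1.2 w₀ hw₀))
        (fun v hv => (hXm v hv).1.2) (fun v hv => (hXm v hv).2) hs
      rw [cnt2_eq_sum]
      have hbound : ∀ z, (Finset.univ.filter fun y => x ∈ L ∧ z ∉ U ∧ y ∈ nbIn H L x z).card ≤
          (if z ∈ M ∪ X then L.card else 0) + (2 * t - 1) := by
        intro z
        by_cases hz : z ∈ U
        · simp [hz]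
        have hsub : (Finset.univ.filter fun y => x ∈ L ∧ z ∉ U ∧ y ∈ nbIn H L x z) ⊆
            nbIn H L x z := fun y hy => (Finset.mem_filter.1 hy).2.2.2
        refine (Finset.card_le_card hsub).trans ?_
        split_ifs with h
        · exact (Finset.card_le_card fun y hy => (mem_nbIn.1 hy).1).trans (Nat.le_add_right _ _)
        · rw [Finset.mem_union, not_or] at h
          by_contra! hlt
          refine h.2 (Finset.mem_filter.2 ⟨Finset.mem_univ _, ⟨hz, fun w hw => ?_⟩, by omega⟩)
          by_contra hnot
          exact h.1 (Finset.mem_biUnion.2 ⟨w, hw, mem_lightSet.2 ⟨hz, hnot⟩⟩)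
      refine (Finset.sum_le_sum fun z _ => hbound z).trans ?_
      rw [Finset.sum_add_distrib]
      refine add_le_add ?_ (by simp)
      rw [← Finset.sum_filter, Finset.sum_const, smul_eq_mul]
      refine Nat.mul_le_mul_right _ ?_
      rw [Finset.filter_mem_eq_inter, Finset.univ_inter]
      exact (Finset.card_union_le _ _).trans (add_le_add hMc hXc)
    · simp [cnt2, hx]
  refine (Finset.sum_le_sum fun x _ => key x).trans ?_
  rw [← Finset.sum_filter, Finset.sum_const, smul_eq_mul, Finset.filter_mem_eq_inter,
    Finset.univ_inter]

/-- The number of ordered hyperedges of a hypergraph with a core. -/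
theorem Core.cnt3_tri_le (hA : Admissible t B H) (hm : 2 * t + 1 ≤ m) {U : Finset V}
    (hU : Core t B H m U) {b : ℕ} (hb : ∀ w ∈ U, (lightSet B H U w).card ≤ b) {s : ℕ}
    (hs : cnt2 (fun x y => ¬ Good t B H x y) < (s + 1) * (s + 1)) :
    ∃ a ≤ b, a + 1 ≤ Fintype.card V ∧ cnt3 (Tri H) ≤
      3 * (t * ((Fintype.card V - 1 - a) * (Fintype.card V - 1 - a) + 2 * (b * B))) +
      3 * (a * ((t * b + (2 * t + s)) * a + Fintype.card V * (2 * t - 1))) := by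
  classical
  have ht := hA.one_lt
  have hUc := hU.card_eq (by omega)
  obtain ⟨w₀, hw₀, hmin⟩ := U.exists_min_image (fun w => (lightSet B H U w).card)
    (Finset.card_pos.1 (by omega))
  set L := lightSet B H U w₀ with hL
  have hwL : w₀ ∉ L := fun h => (mem_lightSet.1 h).1 hw₀
  refine ⟨L.card, hb w₀ hw₀, ?_, ?_⟩
  · rw [← Finset.card_insert_of_notMem hwL]
    exact Finset.card_le_univ _
  have h1 := hU.cnt3_two_le hA hm hb hw₀ hL hs
  have h2 : cnt3 (fun x y z => x ∈ U ∧ Tri H x y z) ≤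
      t * ((Fintype.card V - 1 - L.card) * (Fintype.card V - 1 - L.card) + 2 * (b * B)) := by
    rw [cnt3_eq_sum, ← hUc, ← smul_eq_mul]
    have key : ∀ x, cnt2 (fun y z => x ∈ U ∧ Tri H x y z) ≤ if x ∈ U then
        (Fintype.card V - 1 - L.card) * (Fintype.card V - 1 - L.card) + 2 * (b * B) else 0 := by
      intro x
      split_ifs with hx
      · refine (cnt2_mono fun y z h => h.2).trans ((cnt2_tri_le hA hx).trans ?_)
        have k1 := hmin x hx
        have k2 := hb x hx
        gcongr
      · simp [cnt2, hx]
    refine (Finset.sum_le_sum fun x _ => key x).trans ?_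
    rw [← Finset.sum_filter, Finset.sum_const, Finset.filter_mem_eq_inter, Finset.univ_inter]
  set P : V → V → V → Prop := fun x y z => x ∈ U ∧ Tri H x y z with hP
  set R : V → V → V → Prop := fun x z y => x ∈ L ∧ z ∉ U ∧ y ∈ nbIn H L x z with hR
  have h4 : cnt3 (Tri H) ≤ cnt3 (fun x y z => (P x y z ∨ P y x z ∨ P z x y) ∨
      (R x y z ∨ R x z y ∨ R y x z)) := by
    refine cnt3_mono fun x y z h => ?_
    have e1 : Tri H y x z := h.swap
    have e2 : Tri H z x y := h.swap'.swap
    have e3 : Tri H x z y := h.swap'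
    have e4 : Tri H y z x := e1.swap'
    simp only [hP, hR, mem_nbIn]
    by_cases hx : x ∈ U
    · exact Or.inl (Or.inl ⟨hx, h⟩)
    by_cases hy : y ∈ U
    · exact Or.inl (Or.inr (Or.inl ⟨hy, e1⟩))
    by_cases hz : z ∈ U
    · exact Or.inl (Or.inr (Or.inr ⟨hz, e2⟩))
    have m1 := hU.not_heavy_of_tri hA hm hw₀ h hx hy hz
    have m2 := hU.not_heavy_of_tri hA hm hw₀ e3 hx hz hy
    have m3 := hU.not_heavy_of_tri hA hm hw₀ e4 hy hz hx
    have l1 : ¬ Heavy B H w₀ x → x ∈ L := fun h => mem_lightSet.2 ⟨hx, h⟩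
    have l2 : ¬ Heavy B H w₀ y → y ∈ L := fun h => mem_lightSet.2 ⟨hy, h⟩
    have l3 : ¬ Heavy B H w₀ z → z ∈ L := fun h => mem_lightSet.2 ⟨hz, h⟩
    right
    by_cases kx : Heavy B H w₀ x
    · have ly := l2 fun k => m1 ⟨kx, k⟩
      have lz := l3 fun k => m2 ⟨kx, k⟩
      exact Or.inr (Or.inr ⟨ly, hx, lz, e4⟩)
    · by_cases ky : Heavy B H w₀ y
      · exact Or.inl ⟨l1 kx, hy, l3 fun k => m3 ⟨ky, k⟩, e3⟩
      · exact Or.inr (Or.inl ⟨l1 kx, hz, l2 ky, h⟩)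
  have o1 := cnt3_or (fun x y z => P x y z ∨ P y x z ∨ P z x y)
    (fun x y z => R x y z ∨ R x z y ∨ R y x z)
  have o2 := cnt3_or P (fun x y z => P y x z ∨ P z x y)
  have o3 := cnt3_or (fun x y z => P y x z) (fun x y z => P z x y)
  have o4 := cnt3_or R (fun x y z => R x z y ∨ R y x z)
  have o5 := cnt3_or (fun x y z => R x z y) (fun x y z => R y x z)
  have s1 := cnt3_swap P
  have s2 : cnt3 (fun x y z => P z x y) = cnt3 P := by
    rw [cnt3_swap' (fun x y z => P y x z), s1]
  have s3 := cnt3_swap' R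
  have s4 := cnt3_swap R
  omega

end Counting

/-- The count of `Core.cnt3_tri_le` is too small for large `n`. -/
theorem core_count_le {t B b c n a s : ℕ} (ht : 1 < t) (ha : a ≤ b) (han : a + 1 ≤ n)
    (hs : s * s ≤ c * n)
    (hn₁ : 2 * (2 * (t * (b * B)) + b * b * (t * b + 2 * t) + t * ((2 * b + 1) * (b + 1))) ≤ n)
    (hn₂ : 4 * (b * b * (b * b)) * c ≤ n) :
    t * ((n - 1 - a) * (n - 1 - a) + 2 * (b * B)) +
      a * ((t * b + (2 * t + s)) * a + n * (2 * t - 1)) + n ≤ t * (n * (n - 1)) := by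
  have h1 : 2 * (b * b * s) ≤ n := by
    refine Nat.mul_self_le_mul_self_iff.1 ?_
    calc 2 * (b * b * s) * (2 * (b * b * s)) = 4 * (b * b * (b * b)) * (s * s) := by ring
      _ ≤ 4 * (b * b * (b * b)) * (c * n) := Nat.mul_le_mul_left _ hs
      _ = 4 * (b * b * (b * b)) * c * n := by ring
      _ ≤ n * n := Nat.mul_le_mul_right _ hn₂
  have h2 : 2 * (t * (b * B)) + a * a * (t * b + 2 * t) + t * ((2 * a + 1) * (a + 1)) ≤
      2 * (t * (b * B)) + b * b * (t * b + 2 * t) + t * ((2 * b + 1) * (b + 1)) := by gcongr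
  have h3 : a * a * s ≤ b * b * s := by gcongr
  have h4 : 2 * (t * (b * B)) + a * a * (t * b + 2 * t) + t * ((2 * a + 1) * (a + 1)) +
      a * a * s ≤ n := by omega
  obtain ⟨k, rfl⟩ : ∃ k, n = k + a + 1 := ⟨n - a - 1, by omega⟩
  obtain ⟨u, rfl⟩ : ∃ u, t = u + 2 := ⟨t - 2, by omega⟩
  have e1 : k + a + 1 - 1 - a = k := by omega
  have e2 : k + a + 1 - 1 = k + a := by omega
  have e3 : 2 * (u + 2) - 1 = 2 * u + 3 := by omega
  rw [e1, e2, e3]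
  zify at h4 ⊢
  nlinarith [mul_nonneg (Int.natCast_nonneg u) (Int.natCast_nonneg k),
    mul_nonneg (Int.natCast_nonneg u) (Int.natCast_nonneg a),
    mul_nonneg (Int.natCast_nonneg k) (Int.natCast_nonneg a), sq_nonneg (a : ℤ),
    mul_nonneg (Int.natCast_nonneg u) (sq_nonneg (a : ℤ))]

end FanExp

theorem fan_expansion_stability (t : ℕ) (ht : 1 < t) :
    ∃ c : ℝ, 0 < c ∧ ∃ N : ℕ, ∀ n ≥ N, ∀ H : Finset (Finset (Fin n)),
      (∀ e ∈ H, e.card = 3) → ¬ ContainsFanExp t H →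
      (¬ ∃ U : Finset (Fin n), U.card = t ∧ ∀ e ∈ H, (e ∩ U).Nonempty) →
      (H.card : ℝ) ≤ t * n.choose 2 - c * n := by
  obtain ⟨c, hc⟩ := FanExp.exists_cnt2_not_good_le t ht
  obtain ⟨N, b, hN⟩ := FanExp.exists_dominating_core t (9 * t ^ 2) c
  refine ⟨1 / 2, by norm_num, N +
    2 * (2 * (t * (b * (9 * t ^ 2))) + b * b * (t * b + 2 * t) + t * ((2 * b + 1) * (b + 1))) +
    4 * (b * b * (b * b)) * c + 1, fun n hn H h3 hF _ => ?_⟩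
  by_contra! hlt
  have hlow : 3 * t * (n * (n - 1)) < 6 * H.card + 3 * n := by
    obtain ⟨k, rfl⟩ : ∃ k, n = k + 1 := ⟨n - 1, by omega⟩
    rw [Nat.cast_choose_two] at hlt
    rw [← Nat.cast_lt (α := ℝ)]
    push_cast at hlt ⊢
    nlinarith
  have hA : FanExp.Admissible t (9 * t ^ 2) H := ⟨h3, hF, ht, by nlinarith⟩
  have hg := hc (Fin n) H h3 hF (by rw [Fintype.card_fin]; exact hlow.le)
  obtain ⟨U, hU, hb⟩ := hN (Fin n) H hA (by rw [Fintype.card_fin]; omega) hg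
  rw [Fintype.card_fin] at hg
  obtain ⟨a, hab, han, hle⟩ := hU.cnt3_tri_le hA (by omega) hb (s := Nat.sqrt (c * n))
    (hg.trans_lt (Nat.lt_succ_sqrt _))
  rw [Fintype.card_fin] at han hle
  have h1 := FanExp.core_count_le (B := 9 * t ^ 2) (b := b) (c := c) ht hab han
    (Nat.sqrt_le (c * n)) (by omega) (by omega)
  have h2 := FanExp.six_mul_card_le h3
  have h4 : 3 * t * (n * (n - 1)) = 3 * (t * (n * (n - 1))) := by ring
  omega
end
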